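/- (Main convergence theorem.) For all (t,m) ∈ [0,T] × 𝒫₂, the limit of the discrete-game values lim_{|π|→0} V_π(t,m) exists and equals V(t,m) = inf_{M ∈ 𝓜(t,m)} E[∫_t^T H(s, M_s) ds]. -/

import Mathlib

open MeasureTheory Filter Set
open scoped Topology ENNReal NNReal BoundedContinuousFunction

noncomputable section

/-- Euclidean space `ℝ^d`. -/
abbrev Ed (d : ℕ) : Type := EuclideanSpace ℝ (Fin d)

/-- `m ∈ 𝒫_p` : Borel probability measure on `ℝ^d` with finite `p`-th moment. -/
def MemP (d : ℕ) (p : ℝ) (m : Measure (Ed d)) : Prop :=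
  IsProbabilityMeasure m ∧ Integrable (fun x => ‖x‖ ^ p) m

/-- `γ` is a coupling of `m` and `m'`. -/
def IsCoupling (d : ℕ) (γ : Measure (Ed d × Ed d)) (m m' : Measure (Ed d)) : Prop :=
  γ.map Prod.fst = m ∧ γ.map Prod.snd = m'

/-- The `p`-Wasserstein distance. -/
def wdist (d : ℕ) (p : ℝ) (m m' : Measure (Ed d)) : ℝ :=
  sInf { c : ℝ | ∃ γ : Measure (Ed d × Ed d), IsProbabilityMeasure γ ∧ IsCoupling d γ m m' ∧
      c = (∫ q, ‖q.1 - q.2‖ ^ p ∂γ) ^ (1 / p) }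

/-- The Gaussian kernel `ρ_δ`. -/
def gaussDensity (d : ℕ) (δ : ℝ) (x : Ed d) : ℝ :=
  (2 * Real.pi * δ) ^ (-(d : ℝ) / 2) * Real.exp (-‖x‖ ^ 2 / (2 * δ))

/-- The centered Gaussian measure with variance `δ` on `ℝ^d`. -/
def gaussMeasure (d : ℕ) (δ : ℝ) : Measure (Ed d) :=
  volume.withDensity fun x => ENNReal.ofReal (gaussDensity d δ x)

/-- The heat flow `p^{t,m}_s` : the law at time `s` of a Brownian motion started
at time `t` with initial law `m`. -/
def heatFlow (d : ℕ) (t s : ℝ) (m : Measure (Ed d)) : Measure (Ed d) :=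
  if s ≤ t then m
  else Measure.map (fun q : Ed d × Ed d => q.1 + q.2) (m.prod (gaussMeasure d (s - t)))

/-- The natural filtration of a measure-valued process, made right-continuous:
`𝓕^M_s = ⋂_{u > s} σ(M_r, r ∈ [t,u])`. -/
def genFiltration {Ω : Type} (d : ℕ) (M : ℝ → Ω → Measure (Ed d)) (t s : ℝ) :
    MeasurableSpace Ω :=
  ⨅ u ∈ Set.Ioi s, ⨆ r ∈ Set.Icc t u, MeasurableSpace.comap (M r) inferInstance

/-- A path `[t,T] → (𝒫₁,d₁)` is càdlàg: right-continuous with left limits (for `d₁`). -/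
def CadlagD1 (d : ℕ) (t T : ℝ) (g : ℝ → Measure (Ed d)) : Prop :=
  (∀ s ∈ Set.Ico t T, Tendsto (fun r => wdist d 1 (g r) (g s)) (𝓝[Set.Ici s] s) (𝓝 0)) ∧
  (∀ s ∈ Set.Ioc t T, ∃ μ : Measure (Ed d),
      Tendsto (fun r => wdist d 1 (g r) μ) (𝓝[Set.Ico t s] s) (𝓝 0))

/-- An element of `𝓜(t,m)` : a càdlàg `(𝒫₁,d₁)`-valued process `M = (M_s)_{s∈[t,T]}`
on some probability space such that (i) `E[M_t(φ)] = m(φ)` for all bounded continuous `φ`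
and (ii) `E[M_{t₂}(φ) | 𝓕^M_{t₁}] = p^{t₁,M_{t₁}}_{t₂}(φ)` for all `t ≤ t₁ ≤ t₂ ≤ T` and
all bounded continuous `φ`. -/
structure MVP (d : ℕ) (T t : ℝ) (m : Measure (Ed d)) where
  Ω : Type
  mΩ : MeasurableSpace Ω
  P : @Measure Ω mΩ
  probP : IsProbabilityMeasure P
  M : ℝ → Ω → Measure (Ed d)
  meas : ∀ s, @Measurable Ω (Measure (Ed d)) mΩ inferInstance (M s)
  inP1 : ∀ s ∈ Set.Icc t T, ∀ ω, MemP d 1 (M s ω)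
  cadlag : ∀ ω, CadlagD1 d t T (fun s => M s ω)
  init : ∀ φ : Ed d →ᵇ ℝ, ∫ ω, (∫ x, φ x ∂(M t ω)) ∂P = ∫ x, φ x ∂m
  cond : ∀ t₁ t₂ : ℝ, t ≤ t₁ → t₁ ≤ t₂ → t₂ ≤ T → ∀ φ : Ed d →ᵇ ℝ,
    P[(fun ω => ∫ x, φ x ∂(M t₂ ω)) | genFiltration d M t t₁]
      =ᵐ[P] fun ω => ∫ x, φ x ∂(heatFlow d t₁ t₂ (M t₁ ω))
/-- The Hamiltonian `H(t,m) = inf_u sup_v ∫ f(t,x,u,v) dm(x)`. -/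
def hamiltonian {d : ℕ} {A B : Type} (f : ℝ → Ed d → A → B → ℝ)
    (t : ℝ) (m : Measure (Ed d)) : ℝ :=
  ⨅ u : A, ⨆ v : B, ∫ x, f t x u v ∂m

/-- The cost `E[∫_t^T H(s, M_s) ds]` of a measure-valued process. -/
def mvCost {d : ℕ} {A B : Type} (f : ℝ → Ed d → A → B → ℝ)
    {T t : ℝ} {m : Measure (Ed d)} (X : MVP d T t m) : ℝ :=
  ∫ ω, (∫ s in Set.Icc t T, hamiltonian f s (X.M s ω)) ∂X.P

/-- The value function `V(t,m) = inf_{M ∈ 𝓜(t,m)} E[∫_t^T H(s, M_s) ds]`. -/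
def gameValue (d : ℕ) {A B : Type} (f : ℝ → Ed d → A → B → ℝ)
    (T t : ℝ) (m : Measure (Ed d)) : ℝ :=
  sInf { r : ℝ | ∃ X : MVP d T t m, r = mvCost f X }
/-- A behaviour strategy of player 1 in `Γ_π(t,m)` : a family of transition probabilities
`σ_q : (ℝ^d × U × V)^{q−1} × ℝ^d → Δ(U)`. -/
def IsStrategy1 (d : ℕ) {A B : Type} [MeasurableSpace A] [MeasurableSpace B]
    (σs : (q : ℕ) → (Fin q → Ed d × A × B) → Ed d → Measure A) : Prop :=
  ∀ q : ℕ, (∀ h x, IsProbabilityMeasure (σs q h x)) ∧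
    Measurable fun p : (Fin q → Ed d × A × B) × Ed d => σs q p.1 p.2

/-- A behaviour strategy of player 2 in `Γ_π(t,m)` : a family of transition probabilities
`τ_q : (U × V)^{q−1} → Δ(V)`. -/
def IsStrategy2 (d : ℕ) {A B : Type} [MeasurableSpace A] [MeasurableSpace B]
    (τs : (q : ℕ) → (Fin q → A × B) → Measure B) : Prop :=
  ∀ q : ℕ, (∀ h, IsProbabilityMeasure (τs q h)) ∧ Measurable (τs q)

/-- The expected future payoff in the discretized game, defined by backward recursion:
`stageVal k q h x` is the expected payoff of the `k` remaining stages, at stage `q`,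
given the past history `h` of observations and actions and the current observation
`B_{t_q} = x` of player 1 (the conditional law of `B_{t_{q+1}}` given `B_{t_q} = x` is
`p^{t_q,δ_x}_{t_{q+1}}`). -/
noncomputable def stageVal (d : ℕ) {A B : Type} [MeasurableSpace A] [MeasurableSpace B]
    (f : ℝ → Ed d → A → B → ℝ) (τg : ℕ → ℝ)
    (σs : (q : ℕ) → (Fin q → Ed d × A × B) → Ed d → Measure A)
    (τs : (q : ℕ) → (Fin q → A × B) → Measure B) :
    (k : ℕ) → (q : ℕ) → (Fin q → Ed d × A × B) → Ed d → ℝ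
  | 0, _, _, _ => 0
  | k + 1, q, h, x =>
      ∫ u, (∫ v, ((τg (q + 1) - τg q) * f (τg q) x u v +
            ∫ y, stageVal d f τg σs τs k (q + 1) (Fin.snoc h (x, u, v)) y
              ∂(heatFlow d (τg q) (τg (q + 1)) (Measure.dirac x)))
          ∂(τs q fun i => ((h i).2.1, (h i).2.2)))
        ∂(σs q h x)

/-- The total expected payoff `γ_π(t,m,σ,τ)` of the discrete-time game `Γ_π(t,m)`
(recall `t₁ = t` so that `B_{t₁}` has law `m`). -/
noncomputable def discretePayoff (d : ℕ) {A B : Type} [MeasurableSpace A] [MeasurableSpace B]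
    (f : ℝ → Ed d → A → B → ℝ) (m : Measure (Ed d)) (N : ℕ) (τg : ℕ → ℝ)
    (σs : (q : ℕ) → (Fin q → Ed d × A × B) → Ed d → Measure A)
    (τs : (q : ℕ) → (Fin q → A × B) → Measure B) : ℝ :=
  ∫ x, stageVal d f τg σs τs (N - 1) 0 (fun i => i.elim0) x ∂m

/-- The lower value `sup_τ inf_σ γ_π(t,m,σ,τ)` of the discrete-time game `Γ_π(t,m)`. -/
noncomputable def lowerValueDisc (d : ℕ) {A B : Type} [MeasurableSpace A] [MeasurableSpace B]
    (f : ℝ → Ed d → A → B → ℝ) (m : Measure (Ed d)) (N : ℕ) (τg : ℕ → ℝ) : ℝ :=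
  sSup { r : ℝ | ∃ τs, IsStrategy2 d τs ∧
    r = sInf { r' : ℝ | ∃ σs, IsStrategy1 d σs ∧
      r' = discretePayoff d f m N τg σs τs } }

/-- The upper value `inf_σ sup_τ γ_π(t,m,σ,τ)` of the discrete-time game `Γ_π(t,m)`. -/
noncomputable def upperValueDisc (d : ℕ) {A B : Type} [MeasurableSpace A] [MeasurableSpace B]
    (f : ℝ → Ed d → A → B → ℝ) (m : Measure (Ed d)) (N : ℕ) (τg : ℕ → ℝ) : ℝ :=
  sInf { r : ℝ | ∃ σs, IsStrategy1 d σs ∧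
    r = sSup { r' : ℝ | ∃ τs, IsStrategy2 d τs ∧
      r' = discretePayoff d f m N τg σs τs } }

section HeatFlow

open ProbabilityTheory RealInnerProductSpace

/-- Bounded measurable functions are integrable against finite measures. -/
theorem integrable_of_abs_le {X : Type*} [MeasurableSpace X] {μ : Measure X} [IsFiniteMeasure μ]
    {φ : X → ℝ} (hφ : Measurable φ) {K : ℝ} (hK : ∀ x, |φ x| ≤ K) : Integrable φ μ :=
  Integrable.of_bound hφ.aestronglyMeasurable K (ae_of_all _ hK)

theorem abs_integral_le_of_abs_le {X : Type*} [MeasurableSpace X] {μ : Measure X}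
    [IsProbabilityMeasure μ] {φ : X → ℝ} {K : ℝ} (hK : ∀ x, |φ x| ≤ K) : |∫ x, φ x ∂μ| ≤ K := by
  have := norm_integral_le_of_norm_le_const (μ := μ) (f := φ) (C := K) (ae_of_all _ hK)
  simpa using this

/-- The standard Gaussian measure on `ℝ^d`. -/
abbrev stdG (d : ℕ) : Measure (Ed d) := stdGaussian (Ed d)

theorem integrable_gaussDensity (d : ℕ) {δ : ℝ} (hδ : 0 < δ) : Integrable (gaussDensity d δ) := by
  unfold gaussDensity
  apply Integrable.const_mul
  have h := (GaussianFourier.integrable_cexp_neg_mul_sq_norm_add (V := Ed d)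
    (b := ((1 / (2 * δ) : ℝ) : ℂ)) (by rw [Complex.ofReal_re]; positivity) 0 0).re
  refine h.congr (ae_of_all _ fun x => ?_)
  have : (-((1 / (2 * δ) : ℝ) : ℂ) * (‖x‖ : ℂ) ^ 2 + 0 * ((inner ℝ 0 x : ℝ) : ℂ))
      = ((-‖x‖ ^ 2 / (2 * δ) : ℝ) : ℂ) := by push_cast; ring
  simp only [RCLike.re_eq_complex_re]
  rw [this, Complex.exp_ofReal_re]

theorem integral_gaussDensity (d : ℕ) {δ : ℝ} (hδ : 0 < δ) :
    ∫ x : Ed d, gaussDensity d δ x = 1 := by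
  unfold gaussDensity
  rw [integral_const_mul]
  have h := GaussianFourier.integral_rexp_neg_mul_sq_norm (V := Ed d) (b := 1 / (2 * δ))
    (by positivity)
  have h2 : ∀ x : Ed d, Real.exp (-‖x‖ ^ 2 / (2 * δ)) = Real.exp (-(1 / (2 * δ)) * ‖x‖ ^ 2) :=
    fun x => by congr 1; ring
  simp_rw [h2, h]
  have h3 : Real.pi / (1 / (2 * δ)) = 2 * Real.pi * δ := by field_simp
  rw [h3, finrank_euclideanSpace_fin, ← Real.rpow_add (by positivity)]
  have : -(d : ℝ) / 2 + d / 2 = 0 := by ring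
  rw [this, Real.rpow_zero]

theorem isProbabilityMeasure_gaussMeasure (d : ℕ) {δ : ℝ} (hδ : 0 < δ) :
    IsProbabilityMeasure (gaussMeasure d δ) := by
  constructor
  unfold gaussMeasure
  rw [withDensity_apply _ MeasurableSet.univ, Measure.restrict_univ,
    ← ofReal_integral_eq_lintegral_ofReal (integrable_gaussDensity d hδ),
    integral_gaussDensity d hδ, ENNReal.ofReal_one]
  exact ae_of_all _ fun x => by unfold gaussDensity; positivity

theorem charFun_gaussMeasure (d : ℕ) {δ : ℝ} (hδ : 0 < δ) (ξ : Ed d) :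
    charFun (gaussMeasure d δ) ξ = Complex.exp (-(δ * ‖ξ‖ ^ 2 / 2 : ℝ)) := by
  have hmeas : Measurable (gaussDensity d δ) := by unfold gaussDensity; fun_prop
  rw [charFun_apply]
  unfold gaussMeasure
  rw [integral_withDensity_eq_integral_toReal_smul (by fun_prop)
    (ae_of_all _ fun x => ENNReal.ofReal_lt_top)]
  have h := GaussianFourier.integral_cexp_neg_mul_sq_norm_add (V := Ed d)
    (b := ((1 / (2 * δ) : ℝ) : ℂ)) (by rw [Complex.ofReal_re]; positivity) Complex.I ξ
  have h1 : ∀ x : Ed d, (ENNReal.ofReal (gaussDensity d δ x)).toReal •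
      Complex.exp (⟪x, ξ⟫ * Complex.I) = ((2 * Real.pi * δ) ^ (-(d : ℝ) / 2) : ℝ) *
      Complex.exp (-((1 / (2 * δ) : ℝ) : ℂ) * (‖x‖ : ℂ) ^ 2
        + Complex.I * ((inner ℝ ξ x : ℝ) : ℂ)) := by
    intro x
    rw [ENNReal.toReal_ofReal (by unfold gaussDensity; positivity)]
    unfold gaussDensity
    rw [Complex.real_smul, Complex.exp_add, real_inner_comm x ξ]
    push_cast
    rw [mul_assoc]
    congr 2
    · congr 1; ring
    · rw [real_inner_comm, mul_comm]
  simp_rw [h1]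
  rw [integral_const_mul, h, finrank_euclideanSpace_fin]
  have h3 : (Real.pi : ℂ) / ((1 / (2 * δ) : ℝ) : ℂ) = ((2 * Real.pi * δ : ℝ) : ℂ) := by
    push_cast; field_simp
  have h4 : ((d : ℂ) / 2) = ((d / 2 : ℝ) : ℂ) := by push_cast; ring
  rw [h3, h4, ← Complex.ofReal_cpow (by positivity), ← mul_assoc, ← Complex.ofReal_mul,
    ← Real.rpow_add (by positivity)]
  have : -(d : ℝ) / 2 + d / 2 = 0 := by ring
  rw [this, Real.rpow_zero, Complex.ofReal_one, one_mul]
  congr 1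
  push_cast
  rw [Complex.I_sq]
  have : (δ : ℂ) ≠ 0 := by exact_mod_cast hδ.ne'
  field_simp
  ring

theorem gaussMeasure_eq_map (d : ℕ) {δ : ℝ} (hδ : 0 < δ) :
    gaussMeasure d δ = (stdG d).map (Real.sqrt δ • ·) := by
  have := isProbabilityMeasure_gaussMeasure d hδ
  have : IsProbabilityMeasure ((stdG d).map (Real.sqrt δ • · : Ed d → Ed d)) :=
    Measure.isProbabilityMeasure_map (by fun_prop)
  apply Measure.ext_of_charFun
  ext ξ
  rw [charFun_gaussMeasure d hδ, charFun_map_smul, charFun_stdGaussian, norm_smul,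
    Real.norm_of_nonneg (Real.sqrt_nonneg _)]
  congr 1
  push_cast
  simp only [mul_pow, ← Complex.ofReal_pow, Real.sq_sqrt hδ.le]
  ring

theorem heatFlow_eq (d : ℕ) (t s : ℝ) (μ : Measure (Ed d)) [SFinite μ] :
    heatFlow d t s μ
      = (μ.prod (stdG d)).map (fun q => q.1 + Real.sqrt (s - t) • q.2) := by
  unfold heatFlow
  split_ifs with h
  · rw [Real.sqrt_eq_zero_of_nonpos (by linarith)]
    simp only [zero_smul, add_zero]
    have : (fun q : Ed d × Ed d => q.1) = Prod.fst := rfl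
    rw [this, Measure.map_fst_prod]
    simp
  · rw [gaussMeasure_eq_map d (by linarith)]
    conv_lhs => rw [← Measure.map_id (μ := μ)]
    rw [Measure.map_prod_map _ _ measurable_id (by fun_prop),
      Measure.map_map (by fun_prop) (by fun_prop)]
    rfl

theorem heatFlow_self (d : ℕ) (t : ℝ) (μ : Measure (Ed d)) : heatFlow d t t μ = μ := by
  simp [heatFlow]

instance isFiniteMeasure_heatFlow (d : ℕ) (t s : ℝ) (μ : Measure (Ed d)) [IsFiniteMeasure μ] :
    IsFiniteMeasure (heatFlow d t s μ) := by
  rw [heatFlow_eq]; infer_instance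

instance isProbabilityMeasure_heatFlow (d : ℕ) (t s : ℝ) (μ : Measure (Ed d))
    [IsProbabilityMeasure μ] : IsProbabilityMeasure (heatFlow d t s μ) := by
  rw [heatFlow_eq]; exact Measure.isProbabilityMeasure_map (by fun_prop)

/-- The heat semigroup acting on functions. -/
def heatOp {d : ℕ} (r : ℝ) (φ : Ed d → ℝ) (x : Ed d) : ℝ :=
  ∫ z, φ (x + Real.sqrt r • z) ∂(stdG d)

variable {d : ℕ} {φ : Ed d → ℝ}

theorem heatOp_zero (φ : Ed d → ℝ) : heatOp 0 φ = φ := by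
  funext x; simp [heatOp]

theorem measurable_heatOp (hφ : Measurable φ) (r : ℝ) : Measurable (heatOp r φ) := by
  unfold heatOp
  have : StronglyMeasurable (fun q : Ed d × Ed d => φ (q.1 + Real.sqrt r • q.2)) :=
    Measurable.stronglyMeasurable (by fun_prop)
  exact this.integral_prod_right.measurable

theorem abs_heatOp_le {K : ℝ} (hK : ∀ x, |φ x| ≤ K) (r : ℝ) (x : Ed d) : |heatOp r φ x| ≤ K :=
  abs_integral_le_of_abs_le fun _ => hK _

theorem integral_heatFlow (hφ : Measurable φ) {K : ℝ} (hK : ∀ x, |φ x| ≤ K) (t s : ℝ)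
    (μ : Measure (Ed d)) [IsFiniteMeasure μ] :
    ∫ x, φ x ∂(heatFlow d t s μ) = ∫ x, heatOp (s - t) φ x ∂μ := by
  rw [heatFlow_eq, integral_map (by fun_prop) hφ.aestronglyMeasurable, integral_prod]
  · rfl
  · exact integrable_of_abs_le (by fun_prop) fun _ => hK _

theorem continuous_heatOp (hφ : Continuous φ) {K : ℝ} (hK : ∀ x, |φ x| ≤ K) (r : ℝ) :
    Continuous (heatOp r φ) := by
  refine continuous_of_dominated (bound := fun _ => K) (fun x => ?_) (fun x => ?_)
    (integrable_const _) ?_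
  · exact Continuous.aestronglyMeasurable (by fun_prop)
  · exact ae_of_all _ fun z => hK _
  · exact ae_of_all _ fun z => by fun_prop

/-- The heat semigroup on bounded continuous functions. -/
def heatBCF (r : ℝ) (φ : Ed d →ᵇ ℝ) : Ed d →ᵇ ℝ :=
  BoundedContinuousFunction.ofNormedAddCommGroup (heatOp r φ)
    (continuous_heatOp φ.continuous (K := ‖φ‖) (fun x => φ.norm_coe_le_norm x) r) ‖φ‖
    (fun x => abs_heatOp_le (fun x => φ.norm_coe_le_norm x) r x)

theorem heatBCF_apply (r : ℝ) (φ : Ed d →ᵇ ℝ) (x : Ed d) : heatBCF r φ x = heatOp r φ x := rfl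

theorem integral_heatFlow_bcf (φ : Ed d →ᵇ ℝ) (t s : ℝ) (μ : Measure (Ed d))
    [IsFiniteMeasure μ] : ∫ x, φ x ∂(heatFlow d t s μ) = ∫ x, heatBCF (s - t) φ x ∂μ :=
  integral_heatFlow φ.continuous.measurable (K := ‖φ‖) (fun x => φ.norm_coe_le_norm x) t s μ

theorem map_prod_stdG (d : ℕ) {a b : ℝ} (ha : 0 ≤ a) (hb : 0 ≤ b) :
    ((stdG d).prod (stdG d)).map (fun q => Real.sqrt a • q.1 + Real.sqrt b • q.2)
      = (stdG d).map (Real.sqrt (a + b) • ·) := by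
  have : IsProbabilityMeasure ((stdG d).map (Real.sqrt (a + b) • · : Ed d → Ed d)) :=
    Measure.isProbabilityMeasure_map (by fun_prop)
  have h1 : ((stdG d).prod (stdG d)).map (fun q => Real.sqrt a • q.1 + Real.sqrt b • q.2)
      = ((stdG d).map (Real.sqrt a • ·)) ∗ ((stdG d).map (Real.sqrt b • ·)) := by
    unfold Measure.conv
    rw [Measure.map_prod_map _ _ (by fun_prop) (by fun_prop),
      Measure.map_map (by fun_prop) (by fun_prop)]
    rfl
  rw [h1]
  apply Measure.ext_of_charFun
  ext ξ
  rw [charFun_conv]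
  simp only [charFun_map_smul, charFun_stdGaussian, norm_smul,
    Real.norm_of_nonneg (Real.sqrt_nonneg _)]
  rw [← Complex.exp_add]
  congr 1
  push_cast
  simp only [mul_pow, ← Complex.ofReal_pow, Real.sq_sqrt ha, Real.sq_sqrt hb,
    Real.sq_sqrt (add_nonneg ha hb)]
  push_cast
  ring

theorem heatOp_heatOp (hφ : Measurable φ) {K : ℝ} (hK : ∀ x, |φ x| ≤ K) {a b : ℝ}
    (ha : 0 ≤ a) (hb : 0 ≤ b) : heatOp a (heatOp b φ) = heatOp (a + b) φ := by
  funext x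
  unfold heatOp
  have h1 : ∫ z, φ (x + Real.sqrt (a + b) • z) ∂(stdG d)
      = ∫ z, φ (x + z) ∂((stdG d).map (Real.sqrt (a + b) • · : Ed d → Ed d)) := by
    rw [integral_map (by fun_prop) (Measurable.aestronglyMeasurable (by fun_prop))]
  rw [h1, ← map_prod_stdG d ha hb,
    integral_map (by fun_prop) (Measurable.aestronglyMeasurable (by fun_prop)), integral_prod]
  · simp only [add_assoc]
  · exact integrable_of_abs_le (by fun_prop) fun _ => hK _

theorem heatFlow_heatFlow (d : ℕ) {t₁ t₂ t₃ : ℝ} (h₁ : t₁ ≤ t₂) (h₂ : t₂ ≤ t₃)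
    (μ : Measure (Ed d)) [IsFiniteMeasure μ] :
    heatFlow d t₂ t₃ (heatFlow d t₁ t₂ μ) = heatFlow d t₁ t₃ μ := by
  apply ext_of_forall_integral_eq_of_IsFiniteMeasure
  intro φ
  rw [integral_heatFlow_bcf, integral_heatFlow_bcf, integral_heatFlow_bcf]
  congr 1
  funext x
  simp only [heatBCF_apply]
  have := congrFun (heatOp_heatOp φ.continuous.measurable (K := ‖φ‖)
    (fun x => φ.norm_coe_le_norm x) (sub_nonneg.2 h₁) (sub_nonneg.2 h₂)) x
  rw [show t₃ - t₁ = t₂ - t₁ + (t₃ - t₂) by ring, ← this]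
  rfl

/-- First absolute moment of the standard Gaussian. -/
def gaussM1 (d : ℕ) : ℝ := ∫ z, ‖z‖ ∂(stdG d)

/-- Second moment of the standard Gaussian. -/
def gaussM2 (d : ℕ) : ℝ := ∫ z, ‖z‖ ^ 2 ∂(stdG d)

theorem gaussM1_nonneg (d : ℕ) : 0 ≤ gaussM1 d := integral_nonneg fun _ => norm_nonneg _

theorem gaussM2_nonneg (d : ℕ) : 0 ≤ gaussM2 d := integral_nonneg fun _ => by positivity

theorem integrable_norm_stdG (d : ℕ) : Integrable (fun z => ‖z‖) (stdG d) :=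
  (IsGaussian.integrable_id (μ := stdG d)).norm

theorem integrable_norm_sq_stdG (d : ℕ) : Integrable (fun z => ‖z‖ ^ 2) (stdG d) :=
  (IsGaussian.memLp_two_id (μ := stdG d)).integrable_norm_pow (by norm_num)

theorem integral_norm_add_sq_stdG (x : Ed d) (r : ℝ) :
    ∫ z, ‖x + r • z‖ ^ 2 ∂(stdG d) = ‖x‖ ^ 2 + r ^ 2 * gaussM2 d := by
  have hz : Integrable (fun z : Ed d => z) (stdG d) := IsGaussian.integrable_id (μ := stdG d)
  have h0 : ∫ z, ⟪x, r • z⟫ ∂(stdG d) = 0 := by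
    have h : Integrable (fun z : Ed d => r • z) (stdG d) := hz.smul r
    rw [integral_inner h x, integral_smul, integral_id_stdGaussian]
    simp
  have : ∀ z : Ed d, ‖x + r • z‖ ^ 2 = ‖x‖ ^ 2 + 2 * ⟪x, r • z⟫ + r ^ 2 * ‖z‖ ^ 2 := by
    intro z
    rw [norm_add_sq_real, norm_smul, mul_pow, Real.norm_eq_abs, sq_abs]
  simp_rw [this]
  rw [integral_add, integral_add, integral_const_mul, integral_const_mul, h0]
  · simp [gaussM2]
  · exact integrable_const _
  · exact ((hz.smul r).const_inner x).const_mul 2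
  · exact (integrable_const _).add (((hz.smul r).const_inner x).const_mul 2)
  · exact (integrable_norm_sq_stdG d).const_mul _

theorem integrable_comp_add_prod {μ : Measure (Ed d)} [IsProbabilityMeasure μ]
    (hμ : Integrable (fun x => ‖x‖ ^ 2) μ) (r : ℝ) :
    Integrable (fun q : Ed d × Ed d => ‖q.1 + r • q.2‖ ^ 2) (μ.prod (stdG d)) := by
  have h1 : Integrable (fun q : Ed d × Ed d => 2 * ‖q.1‖ ^ 2 + 2 * (r ^ 2 * ‖q.2‖ ^ 2))
      (μ.prod (stdG d)) :=
    ((hμ.comp_fst (stdG d)).const_mul 2).add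
      ((((integrable_norm_sq_stdG d).comp_snd μ).const_mul (r ^ 2)).const_mul 2)
  refine h1.mono' (Continuous.aestronglyMeasurable (by fun_prop)) (ae_of_all _ fun q => ?_)
  rw [Real.norm_of_nonneg (by positivity)]
  have h2 := parallelogram_law_with_norm ℝ q.1 (r • q.2)
  have h3 : ‖r • q.2‖ ^ 2 = r ^ 2 * ‖q.2‖ ^ 2 := by
    rw [norm_smul, mul_pow, Real.norm_eq_abs, sq_abs]
  nlinarith [norm_nonneg (q.1 - r • q.2), mul_self_nonneg (‖q.1 - r • q.2‖)]

theorem memP_two_iff {μ : Measure (Ed d)} :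
    MemP d 2 μ ↔ IsProbabilityMeasure μ ∧ Integrable (fun x => ‖x‖ ^ 2) μ := by
  unfold MemP; simp

theorem memP_one_iff {μ : Measure (Ed d)} :
    MemP d 1 μ ↔ IsProbabilityMeasure μ ∧ Integrable (fun x => ‖x‖) μ := by
  unfold MemP; simp

theorem MemP.memP_one {μ : Measure (Ed d)} (h : MemP d 2 μ) : MemP d 1 μ := by
  rw [memP_two_iff] at h
  have := h.1
  refine memP_one_iff.2 ⟨h.1, ((integrable_const (1 : ℝ)).add h.2).mono'
    (Continuous.aestronglyMeasurable (by fun_prop)) (ae_of_all _ fun x => ?_)⟩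
  simp only [Pi.add_apply, norm_norm]
  nlinarith [sq_nonneg (‖x‖ - 1)]

theorem MemP.heatFlow_two {μ : Measure (Ed d)} (h : MemP d 2 μ) (t s : ℝ) :
    MemP d 2 (heatFlow d t s μ) := by
  rw [memP_two_iff] at h ⊢
  have := h.1
  refine ⟨inferInstance, ?_⟩
  rw [heatFlow_eq, integrable_map_measure (Continuous.aestronglyMeasurable (by fun_prop))
    (by fun_prop)]
  exact integrable_comp_add_prod h.2 _

theorem integral_sq_heatFlow {μ : Measure (Ed d)} (h : MemP d 2 μ) {t s : ℝ} (hts : t ≤ s) :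
    ∫ x, ‖x‖ ^ 2 ∂(heatFlow d t s μ) = ∫ x, ‖x‖ ^ 2 ∂μ + (s - t) * gaussM2 d := by
  rw [memP_two_iff] at h
  have := h.1
  rw [heatFlow_eq, integral_map (by fun_prop) (Continuous.aestronglyMeasurable (by fun_prop)),
    integral_prod _ (integrable_comp_add_prod h.2 _)]
  simp only [integral_norm_add_sq_stdG, Real.sq_sqrt (sub_nonneg.2 hts)]
  rw [integral_add h.2 (integrable_const _)]
  simp

theorem abs_heatOp_sub_le {L : ℝ} (hL : ∀ x y, |φ x - φ y| ≤ L * ‖x - y‖) (hφ : Measurable φ)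
    {K : ℝ} (hK : ∀ x, |φ x| ≤ K) (a b : ℝ) (x : Ed d) :
    |heatOp a φ x - heatOp b φ x| ≤ L * (|Real.sqrt a - Real.sqrt b| * gaussM1 d) := by
  unfold heatOp
  rw [← integral_sub (integrable_of_abs_le (by fun_prop) fun _ => hK _)
    (integrable_of_abs_le (by fun_prop) fun _ => hK _)]
  unfold gaussM1
  rw [← integral_const_mul, ← integral_const_mul, ← Real.norm_eq_abs]
  refine norm_integral_le_of_norm_le
    (((integrable_norm_stdG d).const_mul _).const_mul _) (ae_of_all _ fun z => ?_)
  rw [Real.norm_eq_abs]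
  refine (hL _ _).trans (le_of_eq ?_)
  rw [add_sub_add_left_eq_sub, ← sub_smul, norm_smul, Real.norm_eq_abs]

end HeatFlow

/-- The standing assumptions on the running payoff. -/
structure IsPayoff {d : ℕ} {A B : Type} [TopologicalSpace A] [TopologicalSpace B]
    (f : ℝ → Ed d → A → B → ℝ) (C : ℝ) : Prop where
  bdd : ∀ s x u v, |f s x u v| ≤ C
  cont : Continuous fun q : ℝ × Ed d × A × B => f q.1 q.2.1 q.2.2.1 q.2.2.2
  lip : ∀ (u : A) (v : B), ∀ s s' : ℝ, ∀ x x' : Ed d,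
    |f s x u v - f s' x' u v| ≤ C * (‖x - x'‖ + |s - s'|)

section Wasserstein

variable {d : ℕ}

theorem wdist_one_le {γ : Measure (Ed d × Ed d)} [IsProbabilityMeasure γ]
    {μ μ' : Measure (Ed d)} (h : IsCoupling d γ μ μ') :
    wdist d 1 μ μ' ≤ ∫ q, ‖q.1 - q.2‖ ∂γ := by
  refine csInf_le ⟨0, ?_⟩ ⟨γ, inferInstance, h, by simp⟩
  rintro c ⟨γ', -, -, rfl⟩
  exact Real.rpow_nonneg (integral_nonneg fun q => Real.rpow_nonneg (norm_nonneg _) _) _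

theorem wdist_one_nonneg (μ μ' : Measure (Ed d)) : 0 ≤ wdist d 1 μ μ' := by
  refine Real.sInf_nonneg ?_
  rintro c ⟨γ', -, -, rfl⟩
  exact Real.rpow_nonneg (integral_nonneg fun q => Real.rpow_nonneg (norm_nonneg _) _) _

/-- Easy half of Kantorovich duality. -/
theorem abs_integral_sub_le_wdist {μ μ' : Measure (Ed d)} (hμ : MemP d 1 μ) (hμ' : MemP d 1 μ')
    {φ ψ : Ed d → ℝ} (hφ : Measurable φ) (hψ : Measurable ψ) {K : ℝ} (hK : ∀ x, |φ x| ≤ K)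
    (hK' : ∀ x, |ψ x| ≤ K) {L D : ℝ} (hL : 0 ≤ L)
    (h : ∀ x y, |φ x - ψ y| ≤ L * (‖x - y‖ + D)) :
    |∫ x, φ x ∂μ - ∫ x, ψ x ∂μ'| ≤ L * (wdist d 1 μ μ' + D) := by
  rw [memP_one_iff] at hμ hμ'
  have := hμ.1
  have := hμ'.1
  have key : ∀ γ : Measure (Ed d × Ed d), IsProbabilityMeasure γ → IsCoupling d γ μ μ' →
      |∫ x, φ x ∂μ - ∫ x, ψ x ∂μ'| ≤ L * (∫ q, ‖q.1 - q.2‖ ∂γ + D) := by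
    intro γ hγ hc
    have i1 : Integrable (fun q : Ed d × Ed d => ‖q.1‖) γ :=
      (integrable_map_measure (f := Prod.fst)
        (Continuous.aestronglyMeasurable (by fun_prop)) (by fun_prop)).1 (hc.1 ▸ hμ.2)
    have i2 : Integrable (fun q : Ed d × Ed d => ‖q.2‖) γ :=
      (integrable_map_measure (f := Prod.snd)
        (Continuous.aestronglyMeasurable (by fun_prop)) (by fun_prop)).1 (hc.2 ▸ hμ'.2)
    have i3 : Integrable (fun q : Ed d × Ed d => ‖q.1 - q.2‖) γ :=
      (i1.add i2).mono' (Continuous.aestronglyMeasurable (by fun_prop))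
        (ae_of_all _ fun q => by simpa using norm_sub_le q.1 q.2)
    have e1 : ∫ x, φ x ∂μ = ∫ q, φ q.1 ∂γ := by
      rw [← hc.1, integral_map (by fun_prop) hφ.aestronglyMeasurable]
    have e2 : ∫ x, ψ x ∂μ' = ∫ q, ψ q.2 ∂γ := by
      rw [← hc.2, integral_map (by fun_prop) hψ.aestronglyMeasurable]
    have e3 : L * (∫ q, ‖q.1 - q.2‖ ∂γ + D) = ∫ q, L * (‖q.1 - q.2‖ + D) ∂γ := by
      rw [integral_const_mul, integral_add i3 (integrable_const _)]; simp
    rw [e1, e2, e3, ← integral_sub (integrable_of_abs_le (by fun_prop) fun _ => hK _)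
      (integrable_of_abs_le (by fun_prop) fun _ => hK' _), ← Real.norm_eq_abs]
    exact norm_integral_le_of_norm_le ((i3.add (integrable_const _)).const_mul _)
      (ae_of_all _ fun q => h _ _)
  rcases hL.eq_or_lt with rfl | hL
  · have := key (μ.prod μ') inferInstance ⟨by simp [Measure.map_fst_prod],
      by simp [Measure.map_snd_prod]⟩
    simpa using this
  · have : |∫ x, φ x ∂μ - ∫ x, ψ x ∂μ'| / L - D ≤ wdist d 1 μ μ' := by
      refine le_csInf ⟨_, μ.prod μ', inferInstance, ⟨by simp [Measure.map_fst_prod],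
        by simp [Measure.map_snd_prod]⟩, rfl⟩ ?_
      rintro c ⟨γ, hγ, hc, rfl⟩
      have := key γ hγ hc
      simp only [Real.rpow_one, div_one]
      rw [sub_le_iff_le_add, div_le_iff₀ hL]
      linarith
    rw [sub_le_iff_le_add, div_le_iff₀ hL] at this
    linarith

theorem wdist_heatFlow_le (μ : Measure (Ed d)) [IsProbabilityMeasure μ] (t r s : ℝ) :
    wdist d 1 (heatFlow d t r μ) (heatFlow d t s μ)
      ≤ |Real.sqrt (r - t) - Real.sqrt (s - t)| * gaussM1 d := by
  have : IsProbabilityMeasure ((μ.prod (stdG d)).map (fun q : Ed d × Ed d =>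
      (q.1 + Real.sqrt (r - t) • q.2, q.1 + Real.sqrt (s - t) • q.2))) :=
    Measure.isProbabilityMeasure_map (by fun_prop)
  refine (wdist_one_le (γ := (μ.prod (stdG d)).map (fun q : Ed d × Ed d =>
      (q.1 + Real.sqrt (r - t) • q.2, q.1 + Real.sqrt (s - t) • q.2))) ⟨?_, ?_⟩).trans ?_
  · rw [Measure.map_map (by fun_prop) (by fun_prop), heatFlow_eq]; rfl
  · rw [Measure.map_map (by fun_prop) (by fun_prop), heatFlow_eq]; rfl
  · rw [integral_map (by fun_prop) (Continuous.aestronglyMeasurable (by fun_prop))]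
    have : ∀ q : Ed d × Ed d, ‖(q.1 + Real.sqrt (r - t) • q.2) - (q.1 + Real.sqrt (s - t) • q.2)‖
        = |Real.sqrt (r - t) - Real.sqrt (s - t)| * ‖q.2‖ := fun q => by
      rw [add_sub_add_left_eq_sub, ← sub_smul, norm_smul, Real.norm_eq_abs]
    simp_rw [this]
    rw [integral_const_mul, integral_fun_snd (f := fun z : Ed d => ‖z‖)]
    simp [gaussM1]

theorem tendsto_wdist_heatFlow (μ : Measure (Ed d)) [IsProbabilityMeasure μ] (t s : ℝ) :
    Tendsto (fun r => wdist d 1 (heatFlow d t r μ) (heatFlow d t s μ)) (𝓝 s) (𝓝 0) := by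
  have h : Tendsto (fun r => |Real.sqrt (r - t) - Real.sqrt (s - t)| * gaussM1 d) (𝓝 s) (𝓝 0) := by
    have hc : Continuous (fun r => |Real.sqrt (r - t) - Real.sqrt (s - t)| * gaussM1 d) := by
      fun_prop
    simpa using hc.tendsto s
  exact squeeze_zero (fun r => wdist_one_nonneg _ _) (fun r => wdist_heatFlow_le μ t r s) h

end Wasserstein

section Hamiltonian

variable {d : ℕ} {A B : Type} [MetricSpace A] [CompactSpace A] [Nonempty A]
  [MetricSpace B] [CompactSpace B] [Nonempty B] {f : ℝ → Ed d → A → B → ℝ} {C : ℝ}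

omit [CompactSpace A] [CompactSpace B] in
theorem IsPayoff.nonneg (hf : IsPayoff f C) : 0 ≤ C :=
  (abs_nonneg _).trans (hf.bdd 0 0 (Classical.arbitrary A) (Classical.arbitrary B))

omit [CompactSpace A] [CompactSpace B] [Nonempty A] [Nonempty B] in
theorem IsPayoff.continuous_space (hf : IsPayoff f C) (s : ℝ) (u : A) (v : B) :
    Continuous fun x => f s x u v :=
  hf.cont.comp (f := fun x => (s, x, u, v)) (by fun_prop)

omit [CompactSpace A] [CompactSpace B] [Nonempty A] [Nonempty B] in
theorem IsPayoff.measurable_space (hf : IsPayoff f C) (s : ℝ) (u : A) (v : B) :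
    Measurable fun x => f s x u v :=
  (hf.continuous_space s u v).measurable

omit [CompactSpace A] [CompactSpace B] [Nonempty A] [Nonempty B] in
theorem IsPayoff.integrable (hf : IsPayoff f C) (μ : Measure (Ed d)) [IsFiniteMeasure μ]
    (s : ℝ) (u : A) (v : B) : Integrable (fun x => f s x u v) μ :=
  integrable_of_abs_le (hf.measurable_space s u v) fun _ => hf.bdd _ _ _ _

omit [CompactSpace A] [CompactSpace B] [Nonempty A] [Nonempty B] in
theorem IsPayoff.abs_integral_le (hf : IsPayoff f C) (μ : Measure (Ed d)) [IsProbabilityMeasure μ]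
    (s : ℝ) (u : A) (v : B) : |∫ x, f s x u v ∂μ| ≤ C :=
  abs_integral_le_of_abs_le fun _ => hf.bdd _ _ _ _

omit [CompactSpace A] [CompactSpace B] [Nonempty A] [Nonempty B] in
theorem IsPayoff.bddAbove (hf : IsPayoff f C) (μ : Measure (Ed d)) [IsProbabilityMeasure μ]
    (s : ℝ) (u : A) : BddAbove (range fun v : B => ∫ x, f s x u v ∂μ) :=
  ⟨C, by rintro _ ⟨v, rfl⟩; exact (abs_le.1 (hf.abs_integral_le μ s u v)).2⟩

omit [CompactSpace A] [CompactSpace B] [Nonempty A] in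
theorem IsPayoff.abs_iSup_le (hf : IsPayoff f C) (μ : Measure (Ed d)) [IsProbabilityMeasure μ]
    (s : ℝ) (u : A) : |⨆ v : B, ∫ x, f s x u v ∂μ| ≤ C := by
  rw [abs_le]
  refine ⟨?_, ciSup_le fun v => (abs_le.1 (hf.abs_integral_le μ s u v)).2⟩
  exact (abs_le.1 (hf.abs_integral_le μ s u (Classical.arbitrary B))).1.trans
    (le_ciSup (hf.bddAbove μ s u) _)

omit [CompactSpace A] [CompactSpace B] [Nonempty A] in
theorem IsPayoff.bddBelow (hf : IsPayoff f C) (μ : Measure (Ed d)) [IsProbabilityMeasure μ]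
    (s : ℝ) : BddBelow (range fun u : A => ⨆ v : B, ∫ x, f s x u v ∂μ) :=
  ⟨-C, by rintro _ ⟨u, rfl⟩; exact (abs_le.1 (hf.abs_iSup_le μ s u)).1⟩

omit [CompactSpace A] [CompactSpace B] in
theorem IsPayoff.abs_hamiltonian_le (hf : IsPayoff f C) (μ : Measure (Ed d))
    [IsProbabilityMeasure μ] (s : ℝ) : |hamiltonian f s μ| ≤ C := by
  unfold hamiltonian
  rw [abs_le]
  refine ⟨le_ciInf fun u => (abs_le.1 (hf.abs_iSup_le μ s u)).1, ?_⟩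
  exact (ciInf_le (hf.bddBelow μ s) (Classical.arbitrary A)).trans
    (abs_le.1 (hf.abs_iSup_le μ s _)).2

omit [CompactSpace A] [CompactSpace B] in
theorem IsPayoff.hamiltonian_le_add (hf : IsPayoff f C) (μ μ' : Measure (Ed d))
    [IsProbabilityMeasure μ] [IsProbabilityMeasure μ'] {s s' D : ℝ}
    (h : ∀ u v, ∫ x, f s x u v ∂μ ≤ ∫ x, f s' x u v ∂μ' + D) :
    hamiltonian f s μ ≤ hamiltonian f s' μ' + D := by
  unfold hamiltonian
  rw [← sub_le_iff_le_add]
  refine le_ciInf fun u => ?_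
  rw [sub_le_iff_le_add]
  refine (ciInf_le (hf.bddBelow μ s) u).trans (ciSup_le fun v => (h u v).trans ?_)
  gcongr
  exact le_ciSup (hf.bddAbove μ' s' u) v

omit [CompactSpace A] [CompactSpace B] in
theorem IsPayoff.abs_hamiltonian_sub_le (hf : IsPayoff f C) {μ μ' : Measure (Ed d)}
    (hμ : MemP d 1 μ) (hμ' : MemP d 1 μ') (s s' : ℝ) :
    |hamiltonian f s μ - hamiltonian f s' μ'| ≤ C * (wdist d 1 μ μ' + |s - s'|) := by
  have := hμ.1
  have := hμ'.1
  have key : ∀ u v, |∫ x, f s x u v ∂μ - ∫ x, f s' x u v ∂μ'| ≤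
      C * (wdist d 1 μ μ' + |s - s'|) := fun u v =>
    abs_integral_sub_le_wdist hμ hμ' (hf.measurable_space s u v) (hf.measurable_space s' u v)
      (fun x => hf.bdd _ _ _ _) (fun x => hf.bdd _ _ _ _) hf.nonneg
      (fun x y => hf.lip u v s s' x y)
  rw [abs_le]
  constructor
  · have := hf.hamiltonian_le_add μ' μ (s := s') (s' := s) (D := C * (wdist d 1 μ μ' + |s - s'|))
      (fun u v => by linarith [(abs_le.1 (key u v)).1])
    linarith
  · have := hf.hamiltonian_le_add μ μ' (s := s) (s' := s') (D := C * (wdist d 1 μ μ' + |s - s'|))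
      (fun u v => by linarith [(abs_le.1 (key u v)).2])
    linarith

omit [CompactSpace A] [CompactSpace B] [Nonempty A] [Nonempty B] in
theorem IsPayoff.continuous_integral (hf : IsPayoff f C) (μ : Measure (Ed d))
    [IsFiniteMeasure μ] (s : ℝ) : Continuous fun p : A × B => ∫ x, f s x p.1 p.2 ∂μ := by
  refine continuous_of_dominated (bound := fun _ => C) (fun p => ?_) (fun p => ?_)
    (integrable_const _) ?_
  · exact (hf.measurable_space s p.1 p.2).aestronglyMeasurable
  · exact ae_of_all _ fun x => hf.bdd _ _ _ _
  · exact ae_of_all _ fun x => hf.cont.comp (f := fun p : A × B => (s, x, p.1, p.2)) (by fun_prop)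

omit [CompactSpace A] [CompactSpace B] [Nonempty A] [Nonempty B] in
theorem IsPayoff.measurable_integral (hf : IsPayoff f C) {Ω : Type*} [MeasurableSpace Ω]
    {M : Ω → Measure (Ed d)} (hM : Measurable M) (s : ℝ) (u : A) (v : B) :
    Measurable fun ω => ∫ x, f s x u v ∂(M ω) :=
  (StronglyMeasurable.integral_kernel (κ := ⟨M, hM⟩)
    (hf.measurable_space s u v).stronglyMeasurable).measurable

omit [CompactSpace A] [Nonempty A] [Nonempty B] in
theorem IsPayoff.measurable_iSup (hf : IsPayoff f C) {Ω : Type*} [MeasurableSpace Ω]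
    {M : Ω → Measure (Ed d)} (hM : Measurable M) (hP : ∀ ω, IsProbabilityMeasure (M ω))
    (s : ℝ) (u : A) : Measurable fun ω => ⨆ v : B, ∫ x, f s x u v ∂(M ω) := by
  obtain ⟨S, hSc, hSd⟩ := TopologicalSpace.exists_countable_dense B
  have : Countable S := hSc
  have h : (fun ω => ⨆ v : B, ∫ x, f s x u v ∂(M ω))
      = fun ω => ⨆ v : S, ∫ x, f s x u v ∂(M ω) := by
    funext ω
    exact (hSd.ciSup' (f := fun v => ∫ x, f s x u v ∂(M ω))
      ((hf.continuous_integral (M ω) s).comp (f := fun v => (u, v)) (by fun_prop))).symm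
  rw [h]
  exact Measurable.iSup fun v => hf.measurable_integral hM s u v

omit [Nonempty A] [Nonempty B] in
theorem IsPayoff.measurable_hamiltonian (hf : IsPayoff f C) {Ω : Type*} [MeasurableSpace Ω]
    {M : Ω → Measure (Ed d)} (hM : Measurable M) (hP : ∀ ω, IsProbabilityMeasure (M ω))
    (s : ℝ) : Measurable fun ω => hamiltonian f s (M ω) := by
  obtain ⟨S, hSc, hSd⟩ := TopologicalSpace.exists_countable_dense A
  have : Countable S := hSc
  have h : (fun ω => hamiltonian f s (M ω))
      = fun ω => ⨅ u : S, ⨆ v : B, ∫ x, f s x u v ∂(M ω) := by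
    funext ω
    refine (hSd.ciInf' (f := fun u => ⨆ v : B, ∫ x, f s x u v ∂(M ω)) ?_).symm
    have := isCompact_univ.continuous_sSup (f := fun u (v : B) => ∫ x, f s x u v ∂(M ω))
      (hf.continuous_integral (M ω) s)
    simpa only [image_univ, sSup_range] using this
  rw [h]
  exact Measurable.iInf fun u => hf.measurable_iSup hM hP s u

omit [Nonempty A] [Nonempty B] in
/-- Uniform continuity in the actions, up to a quadratic weight in space. -/
theorem IsPayoff.exists_modulus (hf : IsPayoff f C) (T : ℝ) {ε : ℝ} (hε : 0 < ε) :
    ∃ δ > 0, ∀ s ∈ Icc 0 T, ∀ x : Ed d, ∀ u u' : A, ∀ v v' : B, dist u u' < δ → dist v v' < δ →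
      |f s x u v - f s x u' v'| ≤ ε * (1 + ‖x‖ ^ 2) := by
  set R : ℝ := Real.sqrt (2 * |C| / ε)
  have hcomp : IsCompact (Icc 0 T ×ˢ (Metric.closedBall (0 : Ed d) R ×ˢ (univ : Set (A × B)))) :=
    isCompact_Icc.prod ((isCompact_closedBall _ _).prod isCompact_univ)
  have huc := hcomp.uniformContinuousOn_of_continuous hf.cont.continuousOn
  obtain ⟨δ, hδ, h⟩ := Metric.uniformContinuousOn_iff.1 huc ε hε
  refine ⟨δ, hδ, fun s hs x u u' v v' huu hvv => ?_⟩
  by_cases hx : ‖x‖ ≤ R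
  · have := h (s, x, u, v) ⟨hs, by simpa using hx, mem_univ _⟩ (s, x, u', v')
      ⟨hs, by simpa using hx, mem_univ _⟩ (by simp [Prod.dist_eq, huu, hvv])
    rw [Real.dist_eq] at this
    nlinarith [sq_nonneg ‖x‖]
  · push Not at hx
    have h1 : 2 * |C| / ε ≤ ‖x‖ ^ 2 := by
      have h0 : 0 ≤ 2 * |C| / ε := by positivity
      calc 2 * |C| / ε = R ^ 2 := (Real.sq_sqrt h0).symm
        _ ≤ ‖x‖ ^ 2 := by
          have : 0 ≤ R := Real.sqrt_nonneg _
          gcongr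
    rw [div_le_iff₀ hε] at h1
    have h2 := hf.bdd s x u v
    have h3 := hf.bdd s x u' v'
    have h4 := abs_sub (f s x u v) (f s x u' v')
    nlinarith [le_abs_self C]

end Hamiltonian

section Net

variable {X : Type*} [MetricSpace X] [CompactSpace X] [Nonempty X] [MeasurableSpace X]
  [BorelSpace X]

/-- A finite net in a compact metric space, with a measurable projection onto it. -/
theorem exists_finite_net {δ : ℝ} (hδ : 0 < δ) :
    ∃ F : Finset X, F.Nonempty ∧ ∃ κ : X → F, Measurable κ ∧ (∀ y : F, κ y = y) ∧
      ∀ x : X, dist x (κ x : X) < δ := by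
  classical
  obtain ⟨t, -, htf, ht⟩ := finite_cover_balls_of_compact (isCompact_univ (X := X)) hδ
  obtain ⟨F0, rfl⟩ := htf.exists_finset_coe
  have hne : F0.Nonempty := by
    obtain ⟨y, hy, -⟩ := mem_iUnion₂.1 (ht (mem_univ (Classical.arbitrary X)))
    exact ⟨y, hy⟩
  obtain ⟨e, he⟩ : ∃ e : ℕ → X, range e = (F0 : Set X) :=
    (F0.countable_toSet.exists_eq_range hne).imp fun _ h => h.symm
  choose! g hg using fun y (hy : y ∈ F0) => (show y ∈ range e by rw [he]; exact hy)
  obtain ⟨N, hN⟩ : ∃ N, ∀ y ∈ F0, g y ≤ N :=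
    ⟨F0.sup g, fun y hy => Finset.le_sup hy⟩
  set p : X → X := fun x => if x ∈ F0 then x else SimpleFunc.nearestPt e N x with hp
  have hpF : ∀ x, p x ∈ F0 := by
    intro x
    simp only [hp]
    split_ifs with h
    · exact h
    · have : e (SimpleFunc.nearestPtInd e N x) ∈ range e := mem_range_self _
      rw [he] at this
      exact this
  have hpm : Measurable p :=
    Measurable.ite F0.measurableSet measurable_id (SimpleFunc.measurable _)
  refine ⟨F0, hne, fun x => ⟨p x, hpF x⟩, hpm.subtype_mk, fun y => ?_, fun x => ?_⟩
  · apply Subtype.ext; simp [hp]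
  · simp only [hp]
    split_ifs with h
    · simpa using hδ
    · obtain ⟨y, hy, hxy⟩ := mem_iUnion₂.1 (ht (mem_univ x))
      have h1 := SimpleFunc.edist_nearestPt_le e x (hN y hy)
      rw [hg y hy, edist_dist, edist_dist, ENNReal.ofReal_le_ofReal_iff dist_nonneg] at h1
      rw [dist_comm]
      rw [Metric.mem_ball, dist_comm] at hxy
      exact h1.trans_lt hxy

end Net

section Riemann

/-- A real function that is right-continuous everywhere has countably many discontinuities. -/
theorem countable_not_continuousAt_of_rightContinuous {h : ℝ → ℝ}
    (hc : ∀ s, ContinuousWithinAt h (Ici s) s) : {s | ¬ ContinuousAt h s}.Countable := by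
  let S : ℕ → Set ℝ := fun n => {s | ¬ ∃ U ∈ 𝓝 s, ∀ x ∈ U, ∀ y ∈ U, |h x - h y| ≤ 1 / (n + 1 : ℝ)}
  have hS : ∀ n, (S n).Countable := by
    intro n
    refine (countable_setOfPred_isolated_right_within (s := S n)).mono fun s hs => ?_
    rw [mem_ofPred_eq]
    refine ⟨hs, ?_⟩
    have hpos : (0 : ℝ) < 1 / (n + 1 : ℝ) / 2 := by positivity
    obtain ⟨δ, hδ, hδ'⟩ := Metric.continuousWithinAt_iff.1 (hc s) _ hpos
    have : S n ∩ Ioi s ∩ Iio (s + δ) = ∅ := by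
      ext r
      simp only [mem_inter_iff, mem_Ioi, mem_Iio, mem_empty_iff_false, iff_false, not_and, not_lt]
      rintro ⟨hr, hsr⟩
      by_contra! hr2
      refine hr ⟨Ioo s (s + δ), Ioo_mem_nhds hsr hr2, fun x hx y hy => ?_⟩
      have h1 := hδ' hx.1.le (by rw [Real.dist_eq, abs_lt]; constructor <;> linarith [hx.1, hx.2])
      have h2 := hδ' hy.1.le (by rw [Real.dist_eq, abs_lt]; constructor <;> linarith [hy.1, hy.2])
      rw [Real.dist_eq] at h1 h2
      rw [abs_lt] at h1 h2
      rw [abs_le]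
      constructor <;> linarith
    rw [← empty_mem_iff_bot, ← this]
    exact inter_mem self_mem_nhdsWithin (mem_nhdsWithin_of_mem_nhds (Iio_mem_nhds (by linarith)))
  refine (countable_iUnion hS).mono fun s hs => ?_
  rw [mem_ofPred_eq] at hs
  by_contra hcon
  apply hs
  simp only [S, mem_iUnion, mem_ofPred_eq, not_exists (α := ℕ), not_not] at hcon
  rw [Metric.continuousAt_iff']
  intro ε hε
  obtain ⟨n, hn⟩ := exists_nat_one_div_lt hε
  obtain ⟨U, hU, hUU⟩ := hcon n
  filter_upwards [hU] with x hx
  rw [Real.dist_eq]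
  exact (hUU x hx s (mem_of_mem_nhds hU)).trans_lt hn

/-- A subdivision of `[t,T]` into `K` intervals, of mesh less than `η`. -/
structure IsGrid (t T η : ℝ) (K : ℕ) (τ : ℕ → ℝ) : Prop where
  start : τ 0 = t
  final : τ K = T
  lt : ∀ q < K, τ q < τ (q + 1)
  mesh : ∀ q < K, τ (q + 1) - τ q < η

variable {t T η : ℝ} {K : ℕ} {τ : ℕ → ℝ}

theorem IsGrid.mono_le (hg : IsGrid t T η K τ) {i j : ℕ} (hij : i ≤ j) (hj : j ≤ K) :
    τ i ≤ τ j := by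
  induction j, hij using Nat.le_induction with
  | base => exact le_rfl
  | succ j _ ih => exact (ih (by omega)).trans (hg.lt j (by omega)).le

theorem IsGrid.mem_Icc (hg : IsGrid t T η K τ) {q : ℕ} (hq : q ≤ K) : τ q ∈ Icc t T :=
  ⟨hg.start ▸ hg.mono_le (Nat.zero_le q) hq, hg.final ▸ hg.mono_le hq le_rfl⟩

theorem IsGrid.mem_Ico (hg : IsGrid t T η K τ) {q : ℕ} (hq : q < K) : τ q ∈ Ico t T :=
  ⟨(hg.mem_Icc hq.le).1, (hg.lt q hq).trans_le (hg.mem_Icc (Nat.succ_le_of_lt hq)).2⟩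

theorem IsGrid.exists_mem (hg : IsGrid t T η K τ) {s : ℝ} (hs : s ∈ Ico t T) :
    ∃ q < K, s ∈ Ico (τ q) (τ (q + 1)) := by
  have hP : ∃ n, s < τ n := ⟨K, hg.final ▸ hs.2⟩
  classical
  set n := Nat.find hP
  have h1 : s < τ n := Nat.find_spec hP
  have h2 : n ≤ K := Nat.find_min' hP (hg.final ▸ hs.2)
  have h3 : n ≠ 0 := fun h => by rw [h, hg.start] at h1; exact absurd hs.1 (not_le.2 h1)
  obtain ⟨q, hq⟩ := Nat.exists_eq_succ_of_ne_zero h3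
  refine ⟨q, by omega, not_lt.1 (Nat.find_min hP (m := q) (by omega)), ?_⟩
  rw [← Nat.succ_eq_add_one, ← hq]
  exact h1

theorem IsGrid.sum_eq (hg : IsGrid t T η K τ) :
    ∑ q ∈ Finset.range K, (τ (q + 1) - τ q) = T - t := by
  rw [Finset.sum_range_sub, hg.final, hg.start]

theorem IsGrid.abs_sum_le (hg : IsGrid t T η K τ) {c : ℕ → ℝ} {C : ℝ} (hc : ∀ q < K, |c q| ≤ C) :
    |∑ q ∈ Finset.range K, (τ (q + 1) - τ q) * c q| ≤ C * (T - t) := by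
  refine (Finset.abs_sum_le_sum_abs _ _).trans ?_
  rw [← hg.sum_eq, Finset.mul_sum]
  refine Finset.sum_le_sum fun q hq => ?_
  rw [Finset.mem_range] at hq
  have := hg.lt q hq
  rw [abs_mul, abs_of_pos (by linarith), mul_comm]
  exact mul_le_mul_of_nonneg_right (hc q hq) (by linarith)

/-- The step function with value `h (τ q)` on `[τ q, τ (q+1))`. -/
def gridStep (h : ℝ → ℝ) (K : ℕ) (τ : ℕ → ℝ) (s : ℝ) : ℝ :=
  ∑ q ∈ Finset.range K, (Ico (τ q) (τ (q + 1))).indicator (fun _ => h (τ q)) s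

theorem measurable_gridStep (h : ℝ → ℝ) (K : ℕ) (τ : ℕ → ℝ) : Measurable (gridStep h K τ) :=
  Finset.measurable_fun_sum _ fun _ _ => measurable_const.indicator measurableSet_Ico

theorem IsGrid.exists_gridStep_eq (hg : IsGrid t T η K τ) (h : ℝ → ℝ) {s : ℝ} (hs : s ∈ Ico t T) :
    ∃ r ∈ Ico t T, |r - s| < η ∧ gridStep h K τ s = h r := by
  obtain ⟨q, hq, hsq⟩ := hg.exists_mem hs
  refine ⟨τ q, hg.mem_Ico hq, ?_, ?_⟩
  · rw [abs_lt]
    constructor <;> linarith [hg.mesh q hq, hsq.1, hsq.2, hg.lt q hq]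
  · unfold gridStep
    rw [Finset.sum_eq_single q, indicator_of_mem hsq]
    · intro j hj hjq
      refine indicator_of_notMem (fun hsj => ?_) _
      rw [Finset.mem_range] at hj
      rcases lt_or_gt_of_ne hjq with hlt | hlt
      · linarith [hg.mono_le (Nat.succ_le_of_lt hlt) hq.le, hsj.2, hsq.1]
      · linarith [hg.mono_le (Nat.succ_le_of_lt hlt) hj.le, hsj.1, hsq.2]
    · intro hq'
      exact absurd (Finset.mem_range.2 hq) hq'

theorem IsGrid.integral_gridStep (hg : IsGrid t T η K τ) (h : ℝ → ℝ) :
    ∫ s in Ico t T, gridStep h K τ s = ∑ q ∈ Finset.range K, (τ (q + 1) - τ q) * h (τ q) := by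
  unfold gridStep
  rw [integral_finsetSum]
  · refine Finset.sum_congr rfl fun q hq => ?_
    rw [Finset.mem_range] at hq
    rw [integral_indicator measurableSet_Ico, Measure.restrict_restrict measurableSet_Ico]
    have : Ico (τ q) (τ (q + 1)) ∩ Ico t T = Ico (τ q) (τ (q + 1)) :=
      inter_eq_left.2 (Ico_subset_Ico (hg.mem_Icc hq.le).1 (hg.mem_Icc (Nat.succ_le_of_lt hq)).2)
    rw [this, setIntegral_const, smul_eq_mul, Measure.real, Real.volume_Ico,
      ENNReal.toReal_ofReal (by linarith [hg.lt q hq])]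
  · intro q _
    exact (integrable_const _).indicator measurableSet_Ico

/-- Conditions under which Riemann sums converge. -/
structure RightRegular (t T C : ℝ) (h : ℝ → ℝ) : Prop where
  bdd : ∀ s ∈ Ico t T, |h s| ≤ C
  right : ∀ s ∈ Ico t T, ContinuousWithinAt h (Ici s) s

theorem RightRegular.ae_continuousAt {C : ℝ} {h : ℝ → ℝ} (hh : RightRegular t T C h) :
    ∀ᵐ s ∂volume.restrict (Ico t T), ContinuousWithinAt h (Ico t T) s := by
  let h' : ℝ → ℝ := (Ico t T).indicator h
  have hc : ∀ s, ContinuousWithinAt h' (Ici s) s := by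
    intro s
    rcases lt_or_ge s t with hst | hst
    · have : h' =ᶠ[𝓝 s] fun _ => 0 := by
        filter_upwards [Iio_mem_nhds hst] with r hr
        exact indicator_of_notMem (fun h => absurd h.1 (not_le.2 hr)) _
      exact (continuousAt_const.congr this.symm).continuousWithinAt
    rcases lt_or_ge s T with hsT | hsT
    · have hs : s ∈ Ico t T := ⟨hst, hsT⟩
      refine (hh.right s hs).congr_of_eventuallyEq ?_ (indicator_of_mem hs _)
      filter_upwards [self_mem_nhdsWithin, mem_nhdsWithin_of_mem_nhds (Iio_mem_nhds hsT)]
        with r hr hr'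
      exact indicator_of_mem (show r ∈ Ico t T from ⟨hst.trans hr, hr'⟩) _
    · have h0 : ∀ r ∈ Ici s, h' r = 0 := fun r hr =>
        indicator_of_notMem (fun h => absurd h.2 (not_lt.2 (hsT.trans hr))) _
      exact continuousWithinAt_const.congr h0 (h0 s self_mem_Ici)
  have h0 := (countable_not_continuousAt_of_rightContinuous hc).ae_notMem
    (volume.restrict (Ico t T))
  filter_upwards [h0, ae_restrict_mem measurableSet_Ico] with s hs hsm
  rw [not_not] at hs
  exact hs.continuousWithinAt.congr (fun r hr => (indicator_of_mem hr _).symm)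
    (indicator_of_mem hsm _).symm

theorem RightRegular.tendsto_gridStep {C : ℝ} {h : ℝ → ℝ} (hh : RightRegular t T C h)
    {η : ℕ → ℝ} (hη : Tendsto η atTop (𝓝 0)) {K : ℕ → ℕ} {τ : ℕ → ℕ → ℝ}
    (hg : ∀ n, IsGrid t T (η n) (K n) (τ n)) :
    ∀ᵐ s ∂volume.restrict (Ico t T),
      Tendsto (fun n => gridStep h (K n) (τ n) s) atTop (𝓝 (h s)) := by
  filter_upwards [hh.ae_continuousAt, ae_restrict_mem measurableSet_Ico] with s hs hsm
  choose r hr hrs hrh using fun n => (hg n).exists_gridStep_eq h hsm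
  simp_rw [hrh]
  refine hs.tendsto.comp (tendsto_nhdsWithin_iff.2 ⟨?_, Eventually.of_forall hr⟩)
  rw [tendsto_iff_norm_sub_tendsto_zero]
  exact squeeze_zero (fun _ => norm_nonneg _) (fun n => (hrs n).le) hη

/-- The uniform subdivision. -/
theorem exists_isGrid (h : t < T) : ∃ (η : ℕ → ℝ) (K : ℕ → ℕ) (τ : ℕ → ℕ → ℝ),
    Tendsto η atTop (𝓝 0) ∧ ∀ n, IsGrid t T (η n) (K n) (τ n) := by
  refine ⟨fun n => 2 * (T - t) * (1 / (n + 1 : ℝ)), fun n => n + 1,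
    fun n q => t + q * ((T - t) / (n + 1)), ?_, fun n => ⟨by simp, ?_, ?_, ?_⟩⟩
  · simpa using tendsto_one_div_add_atTop_nhds_zero_nat.const_mul (2 * (T - t))
  · push_cast
    field_simp
    ring
  · intro q _
    have : 0 < (T - t) / (n + 1) := div_pos (by linarith) (by positivity)
    push_cast
    linarith
  · intro q _
    have : 0 < (T - t) / (n + 1) := div_pos (by linarith) (by positivity)
    have h2 : 2 * (T - t) * (1 / (n + 1 : ℝ)) = 2 * ((T - t) / (n + 1)) := by ring
    beta_reduce
    rw [h2]
    push_cast
    linarith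

theorem RightRegular.integrableOn {C : ℝ} {h : ℝ → ℝ} (hh : RightRegular t T C h) :
    IntegrableOn h (Icc t T) := by
  rcases lt_or_ge t T with htT | htT
  · rw [integrableOn_Icc_iff_integrableOn_Ico]
    obtain ⟨η, K, τ, hη, hg⟩ := exists_isGrid htT
    refine Integrable.of_bound (aestronglyMeasurable_of_tendsto_ae atTop
      (fun n => (measurable_gridStep h (K n) (τ n)).aestronglyMeasurable)
      (hh.tendsto_gridStep hη hg)) C ?_
    filter_upwards [ae_restrict_mem measurableSet_Ico] with s hs using hh.bdd s hs
  · refine (integrableOn_empty (f := h) (μ := volume)).congr_set_ae ?_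
    refine (ae_eq_empty.2 ?_)
    rw [Real.volume_Icc, ENNReal.ofReal_eq_zero]
    linarith

theorem RightRegular.tendsto_sum {C : ℝ} {h : ℝ → ℝ} (hh : RightRegular t T C h)
    {η : ℕ → ℝ} (hη : Tendsto η atTop (𝓝 0)) {K : ℕ → ℕ} {τ : ℕ → ℕ → ℝ}
    (hg : ∀ n, IsGrid t T (η n) (K n) (τ n)) :
    Tendsto (fun n => ∑ q ∈ Finset.range (K n), (τ n (q + 1) - τ n q) * h (τ n q)) atTop
      (𝓝 (∫ s in Icc t T, h s)) := by
  simp_rw [← (hg _).integral_gridStep, integral_Icc_eq_integral_Ico]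
  refine tendsto_integral_of_dominated_convergence (fun _ => C)
    (fun n => (measurable_gridStep h (K n) (τ n)).aestronglyMeasurable) (integrable_const _)
    (fun n => ?_) (hh.tendsto_gridStep hη hg)
  filter_upwards [ae_restrict_mem measurableSet_Ico] with s hs
  obtain ⟨r, hr, -, hrh⟩ := (hg n).exists_gridStep_eq h hs
  rw [hrh]
  exact hh.bdd r hr

theorem RightRegular.abs_integral_le {C : ℝ} {h : ℝ → ℝ} (hh : RightRegular t T C h)
    (htT : t ≤ T) : |∫ s in Icc t T, h s| ≤ C * (T - t) := by
  rw [integral_Icc_eq_integral_Ico]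
  have := norm_setIntegral_le_of_norm_le_const (μ := volume) (s := Ico t T) (f := h) (C := C)
    (by simp) (fun s hs => hh.bdd s hs)
  simpa [Measure.real, Real.volume_Ico, htT] using this

end Riemann

section Cost

variable {d : ℕ} {T t : ℝ} {μ : Measure (Ed d)}

instance (X : MVP d T t μ) : MeasurableSpace X.Ω := X.mΩ

instance (X : MVP d T t μ) : IsProbabilityMeasure X.P := X.probP

variable {A B : Type} [MetricSpace A] [CompactSpace A] [Nonempty A]
  [MetricSpace B] [CompactSpace B] [Nonempty B] {f : ℝ → Ed d → A → B → ℝ} {C : ℝ}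

omit [CompactSpace A] [CompactSpace B] in
theorem CadlagD1.rightRegular (hf : IsPayoff f C) {g : ℝ → Measure (Ed d)}
    (hg : CadlagD1 d t T g) (hP : ∀ s ∈ Icc t T, MemP d 1 (g s)) :
    RightRegular t T C fun s => hamiltonian f s (g s) := by
  refine ⟨fun s hs => ?_, fun s hs => ?_⟩
  · have := (hP s ⟨hs.1, hs.2.le⟩).1
    exact hf.abs_hamiltonian_le _ _
  · rw [ContinuousWithinAt, tendsto_iff_norm_sub_tendsto_zero]
    have h1 : Tendsto (fun r => C * (wdist d 1 (g r) (g s) + |r - s|)) (𝓝[Ici s] s) (𝓝 0) := by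
      have h2 : Tendsto (fun r => |r - s|) (𝓝[Ici s] s) (𝓝 0) := by
        have : Tendsto (fun r => |r - s|) (𝓝 s) (𝓝 |s - s|) :=
          (continuous_id.sub continuous_const).abs.tendsto s
        rw [sub_self, abs_zero] at this
        exact this.mono_left nhdsWithin_le_nhds
      simpa using ((hg.1 s hs).add h2).const_mul C
    refine squeeze_zero' (Eventually.of_forall fun _ => norm_nonneg _) ?_ h1
    filter_upwards [self_mem_nhdsWithin, mem_nhdsWithin_of_mem_nhds (Iio_mem_nhds hs.2)]
      with r hr hr'
    exact hf.abs_hamiltonian_sub_le (hP r ⟨hs.1.trans hr, le_of_lt hr'⟩) (hP s ⟨hs.1, hs.2.le⟩) r s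

omit [CompactSpace A] [CompactSpace B] in
theorem MVP.rightRegular (hf : IsPayoff f C) (X : MVP d T t μ) (ω : X.Ω) :
    RightRegular t T C fun s => hamiltonian f s (X.M s ω) :=
  (X.cadlag ω).rightRegular hf fun s hs => X.inP1 s hs ω

omit [Nonempty A] [Nonempty B] in
theorem MVP.measurable_hamiltonian (hf : IsPayoff f C) (X : MVP d T t μ) {s : ℝ}
    (hs : s ∈ Icc t T) : Measurable fun ω => hamiltonian f s (X.M s ω) :=
  hf.measurable_hamiltonian (X.meas s) (fun ω => (X.inP1 s hs ω).1) s

theorem MVP.measurable_integral_hamiltonian (hf : IsPayoff f C) (htT : t ≤ T) (X : MVP d T t μ) :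
    Measurable fun ω => ∫ s in Icc t T, hamiltonian f s (X.M s ω) := by
  rcases htT.lt_or_eq with h | rfl
  · obtain ⟨η, K, τ, hη, hg⟩ := exists_isGrid h
    refine measurable_of_tendsto_metrizable (f := fun n ω => ∑ q ∈ Finset.range (K n),
      (τ n (q + 1) - τ n q) * hamiltonian f (τ n q) (X.M (τ n q) ω)) (fun n => ?_)
      (tendsto_pi_nhds.2 fun ω => (X.rightRegular hf ω).tendsto_sum hη hg)
    refine Finset.measurable_fun_sum _ fun q hq => ?_
    exact (X.measurable_hamiltonian hf ((hg n).mem_Icc (Finset.mem_range.1 hq).le)).const_mul _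
  · simp

omit [CompactSpace A] [CompactSpace B] in
theorem MVP.abs_mvCost_le (hf : IsPayoff f C) (htT : t ≤ T) (X : MVP d T t μ) :
    |mvCost f X| ≤ C * (T - t) :=
  abs_integral_le_of_abs_le fun ω => (X.rightRegular hf ω).abs_integral_le htT

theorem MVP.integrable_integral_hamiltonian (hf : IsPayoff f C) (htT : t ≤ T) (X : MVP d T t μ) :
    Integrable (fun ω => ∫ s in Icc t T, hamiltonian f s (X.M s ω)) X.P :=
  integrable_of_abs_le (X.measurable_integral_hamiltonian hf htT)
    fun ω => (X.rightRegular hf ω).abs_integral_le htT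

theorem MVP.tendsto_sum (hf : IsPayoff f C) (X : MVP d T t μ)
    {η : ℕ → ℝ} (hη : Tendsto η atTop (𝓝 0)) {K : ℕ → ℕ} {τ : ℕ → ℕ → ℝ}
    (hg : ∀ n, IsGrid t T (η n) (K n) (τ n)) :
    Tendsto (fun n => ∫ ω, ∑ q ∈ Finset.range (K n),
      (τ n (q + 1) - τ n q) * hamiltonian f (τ n q) (X.M (τ n q) ω) ∂X.P) atTop
      (𝓝 (mvCost f X)) := by
  refine tendsto_integral_of_dominated_convergence (fun _ => C * (T - t))
    (fun n => (Finset.measurable_fun_sum _ fun q hq => ?_).aestronglyMeasurable)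
    (integrable_const _) (fun n => ae_of_all _ fun ω => ?_)
    (ae_of_all _ fun ω => (X.rightRegular hf ω).tendsto_sum hη hg)
  · exact (X.measurable_hamiltonian hf ((hg n).mem_Icc (Finset.mem_range.1 hq).le)).const_mul _
  · exact (hg n).abs_sum_le fun q hq => (X.rightRegular hf ω).bdd _ ((hg n).mem_Ico hq)

/-- Expected Riemann sums of a measure-valued process are close to its cost on fine grids. -/
theorem MVP.exists_mesh (hf : IsPayoff f C) (X : MVP d T t μ) {ε : ℝ} (hε : 0 < ε) :
    ∃ η > 0, ∀ K τ, IsGrid t T η K τ →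
      |∫ ω, ∑ q ∈ Finset.range K, (τ (q + 1) - τ q) * hamiltonian f (τ q) (X.M (τ q) ω) ∂X.P
        - mvCost f X| < ε := by
  by_contra! hcon
  choose K τ hg hlt using fun n : ℕ => hcon (1 / (n + 1 : ℝ)) (by positivity)
  have := X.tendsto_sum hf tendsto_one_div_add_atTop_nhds_zero_nat hg
  obtain ⟨n, hn⟩ := ((Metric.tendsto_nhds.1 this) ε hε).exists
  rw [Real.dist_eq] at hn
  exact absurd hn (not_lt.2 (hlt n))

end Cost

section Glue

variable {d : ℕ} {T t : ℝ} {μ : Measure (Ed d)}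

theorem genFiltration_le {Ω : Type} [mΩ : MeasurableSpace Ω] {M : ℝ → Ω → Measure (Ed d)}
    (hM : ∀ s, Measurable (M s)) (t s : ℝ) : genFiltration d M t s ≤ mΩ :=
  iInf₂_le_of_le (s + 1) (by simp) (iSup₂_le fun r _ => (hM r).comap_le)

theorem comap_le_genFiltration {Ω : Type} (M : ℝ → Ω → Measure (Ed d)) {t s : ℝ} (hts : t ≤ s) :
    MeasurableSpace.comap (M s) inferInstance ≤ genFiltration d M t s :=
  le_iInf₂ fun _ hu => le_iSup₂_of_le s ⟨hts, le_of_lt hu⟩ le_rfl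

theorem measurable_genFiltration {Ω : Type} (M : ℝ → Ω → Measure (Ed d)) {t s : ℝ} (hts : t ≤ s) :
    Measurable[genFiltration d M t s] (M s) :=
  measurable_iff_comap_le.2 (comap_le_genFiltration M hts)

theorem measurableSet_preimage_of_genFiltration {Ω Ω' : Type} {M : ℝ → Ω → Measure (Ed d)}
    {t s u : ℝ} (hu : s < u) (j : Ω' → Ω) {m' : MeasurableSpace Ω'}
    (hj : ∀ r ∈ Icc t u, Measurable[m'] fun ω => M r (j ω)) {S : Set Ω}
    (hS : MeasurableSet[genFiltration d M t s] S) : MeasurableSet[m'] (j ⁻¹' S) := by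
  have h : genFiltration d M t s ≤ MeasurableSpace.map j m' :=
    iInf₂_le_of_le u hu (iSup₂_le fun r hr => by
      rintro _ ⟨V, hV, rfl⟩
      exact hj r hr hV)
  exact h S hS

theorem abs_integral_bcf_le (μ : Measure (Ed d)) [IsProbabilityMeasure μ] (φ : Ed d →ᵇ ℝ) :
    |∫ x, φ x ∂μ| ≤ ‖φ‖ :=
  abs_integral_le_of_abs_le fun x => φ.norm_coe_le_norm x

theorem measurable_integral_bcf (φ : Ed d →ᵇ ℝ) :
    Measurable fun μ : Measure (Ed d) => ∫ x, φ x ∂μ := by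
  refine (StronglyMeasurable.integral_kernel (κ := ⟨fun μ : Measure (Ed d) => μ, measurable_id⟩)
    φ.continuous.measurable.stronglyMeasurable).measurable

/-- The martingale property integrated over an event of the filtration. -/
theorem MVP.setIntegral_eq (X : MVP d T t μ) {t₁ t₂ : ℝ} (h₀ : t ≤ t₁) (h₁ : t₁ ≤ t₂)
    (h₂ : t₂ ≤ T) (φ : Ed d →ᵇ ℝ) {S : Set X.Ω}
    (hS : MeasurableSet[genFiltration d X.M t t₁] S) :
    ∫ ω in S, (∫ x, φ x ∂(X.M t₂ ω)) ∂X.P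
      = ∫ ω in S, (∫ x, φ x ∂(heatFlow d t₁ t₂ (X.M t₁ ω))) ∂X.P := by
  have hle := genFiltration_le X.meas t t₁
  have hint : Integrable (fun ω => ∫ x, φ x ∂(X.M t₂ ω)) X.P := by
    refine integrable_of_abs_le ((measurable_integral_bcf φ).comp (X.meas t₂)) (K := ‖φ‖)
      fun ω => ?_
    have := (X.inP1 t₂ ⟨h₀.trans h₁, h₂⟩ ω).1
    exact abs_integral_bcf_le _ _
  rw [← setIntegral_condExp hle hint hS]
  exact integral_congr_ae (ae_restrict_of_ae (X.cond t₁ t₂ h₀ h₁ h₂ φ))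

theorem MVP.integral_eq (X : MVP d T t μ) [IsProbabilityMeasure μ] {s : ℝ} (h₀ : t ≤ s) (h₁ : s ≤ T)
    (φ : Ed d →ᵇ ℝ) :
    ∫ ω, (∫ x, φ x ∂(X.M s ω)) ∂X.P = ∫ x, φ x ∂(heatFlow d t s μ) := by
  have h := X.setIntegral_eq le_rfl h₀ h₁ φ (S := univ) MeasurableSet.univ
  rw [setIntegral_univ, setIntegral_univ] at h
  rw [h, integral_heatFlow_bcf, ← X.init]
  refine integral_congr_ae (ae_of_all _ fun ω => ?_)
  have := (X.inP1 t ⟨le_rfl, h₀.trans h₁⟩ ω).1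
  exact integral_heatFlow_bcf φ t s _

/-- The constant process when the horizon has been reached. -/
def MVP.const (d : ℕ) (T : ℝ) (μ : Measure (Ed d)) (hμ : MemP d 1 μ) : MVP d T T μ where
  Ω := Unit
  mΩ := ⊤
  P := @Measure.dirac Unit ⊤ ()
  probP := @Measure.dirac.isProbabilityMeasure Unit ⊤ ()
  M _ _ := μ
  meas _ := measurable_const
  inP1 _ _ _ := hμ
  cadlag _ := ⟨fun s hs => absurd hs (by simp), fun s hs => absurd hs (by simp)⟩
  init φ := by have := hμ.1; simp
  cond t₁ t₂ h₀ h₁ h₂ φ := by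
    obtain rfl : t₁ = T := le_antisymm (h₁.trans h₂) h₀
    obtain rfl : t₂ = t₁ := le_antisymm h₂ h₁
    have := hμ.1
    rw [condExp_const le_top, heatFlow_self]

end Glue

section SigmaMix

variable {ι : Type} [Fintype ι] {E : ι → Type} [∀ c, MeasurableSpace (E c)]

/-- The mixture, with weights `p`, of probability measures living on different spaces. -/
def sigmaMix (p : ι → ℝ) (P : ∀ c, Measure (E c)) : Measure (Σ c, E c) :=
  ∑ c, ENNReal.ofReal (p c) • (P c).map (Sigma.mk c)

omit [Fintype ι] in
theorem measurable_sigma_iff {Z : Type*} [MeasurableSpace Z] {g : (Σ c, E c) → Z} :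
    Measurable g ↔ ∀ c, Measurable fun x => g ⟨c, x⟩ := by
  refine ⟨fun h c S hS => MeasurableSpace.measurableSet_iInf.1 (h hS) c, fun h S hS => ?_⟩
  exact MeasurableSpace.measurableSet_iInf.2 fun c => h c hS

omit [Fintype ι] in
theorem measurable_sigmaMk (c : ι) : Measurable (Sigma.mk (β := E) c) :=
  fun _ hS => MeasurableSpace.measurableSet_iInf.1 hS c

theorem isProbabilityMeasure_sigmaMix {p : ι → ℝ} (hp : ∀ c, 0 ≤ p c) (hsum : ∑ c, p c = 1)
    {P : ∀ c, Measure (E c)} (hP : ∀ c, IsProbabilityMeasure (P c)) :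
    IsProbabilityMeasure (sigmaMix p P) := by
  constructor
  have : ∀ c, (P c).map (Sigma.mk c) univ = 1 := fun c => by
    rw [Measure.map_apply (measurable_sigmaMk c) MeasurableSet.univ, preimage_univ, measure_univ]
  simp only [sigmaMix, Measure.coe_finsetSum, Finset.sum_apply, Measure.smul_apply, smul_eq_mul,
    this, mul_one]
  rw [← ENNReal.ofReal_sum_of_nonneg fun c _ => hp c, hsum, ENNReal.ofReal_one]

theorem integral_sigmaMix {p : ι → ℝ} (hp : ∀ c, 0 ≤ p c)
    {P : ∀ c, Measure (E c)} (hP : ∀ c, IsProbabilityMeasure (P c)) {g : (Σ c, E c) → ℝ}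
    (hg : Measurable g) {K : ℝ} (hK : ∀ x, |g x| ≤ K) :
    ∫ x, g x ∂(sigmaMix p P) = ∑ c, p c * ∫ x, g ⟨c, x⟩ ∂(P c) := by
  have hfin : ∀ c, IsFiniteMeasure ((P c).map (Sigma.mk c)) := fun c =>
    have := hP c
    inferInstance
  rw [sigmaMix, integral_finsetSum_measure]
  · refine Finset.sum_congr rfl fun c _ => ?_
    rw [integral_smul_measure, ENNReal.toReal_ofReal (hp c),
      integral_map (measurable_sigmaMk c).aemeasurable hg.aestronglyMeasurable, smul_eq_mul]
  · intro c _
    have := hfin c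
    exact (integrable_of_abs_le hg hK).smul_measure ENNReal.ofReal_ne_top

theorem setIntegral_sigmaMix {p : ι → ℝ} (hp : ∀ c, 0 ≤ p c)
    {P : ∀ c, Measure (E c)} (hP : ∀ c, IsProbabilityMeasure (P c)) {g : (Σ c, E c) → ℝ}
    (hg : Measurable g) {K : ℝ} (hK : ∀ x, |g x| ≤ K) {S : Set (Σ c, E c)} (hS : MeasurableSet S) :
    ∫ x in S, g x ∂(sigmaMix p P) = ∑ c, p c * ∫ x in Sigma.mk c ⁻¹' S, g ⟨c, x⟩ ∂(P c) := by
  rw [← integral_indicator hS, integral_sigmaMix hp hP (hg.indicator hS) (K := K)]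
  · refine Finset.sum_congr rfl fun c _ => ?_
    rw [← integral_indicator (measurable_sigmaMk c hS)]
    rfl
  · intro x
    by_cases hx : x ∈ S
    · rw [indicator_of_mem hx]; exact hK x
    · rw [indicator_of_notMem hx, abs_zero]; exact (abs_nonneg _).trans (hK x)

end SigmaMix

section Glue

variable {d : ℕ} {T t t' : ℝ} {ι : Type} {ν : ι → Measure (Ed d)}

/-- Paths of the glued process: heat flow until `t'`, then a given process. -/
def glueM (t' : ℝ) (X : ∀ c, MVP d T t' (heatFlow d t t' (ν c))) (s : ℝ) (ω : Σ c, (X c).Ω) :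
    Measure (Ed d) :=
  if s < t' then heatFlow d t s (ν ω.1) else (X ω.1).M s ω.2

theorem glueM_of_lt (X : ∀ c, MVP d T t' (heatFlow d t t' (ν c))) {s : ℝ} (hs : s < t')
    (ω : Σ c, (X c).Ω) : glueM t' X s ω = heatFlow d t s (ν ω.1) := if_pos hs

theorem glueM_of_le (X : ∀ c, MVP d T t' (heatFlow d t t' (ν c))) {s : ℝ} (hs : t' ≤ s)
    (ω : Σ c, (X c).Ω) : glueM t' X s ω = (X ω.1).M s ω.2 := if_neg (not_lt.2 hs)

theorem measurable_glueM (X : ∀ c, MVP d T t' (heatFlow d t t' (ν c))) (s : ℝ) :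
    Measurable (glueM t' X s) := by
  refine measurable_sigma_iff.2 fun c => ?_
  rcases lt_or_ge s t' with h | h
  · simp only [glueM_of_lt X h]
    exact measurable_const
  · simp only [glueM_of_le X h]
    exact (X c).meas s

theorem memP_glueM (hν : ∀ c, MemP d 2 (ν c)) (X : ∀ c, MVP d T t' (heatFlow d t t' (ν c)))
    {s : ℝ} (hs : s ≤ T) (ω : Σ c, (X c).Ω) : MemP d 1 (glueM t' X s ω) := by
  rcases lt_or_ge s t' with h | h
  · rw [glueM_of_lt X h]
    exact ((hν ω.1).heatFlow_two t s).memP_one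
  · rw [glueM_of_le X h]
    exact (X ω.1).inP1 s ⟨h, hs⟩ ω.2

theorem cadlag_glueM (hν : ∀ c, MemP d 2 (ν c)) (htt' : t < t')
    (X : ∀ c, MVP d T t' (heatFlow d t t' (ν c))) (ω : Σ c, (X c).Ω) :
    CadlagD1 d t T fun s => glueM t' X s ω := by
  have := (hν ω.1).1
  refine ⟨fun s hs => ?_, fun s hs => ?_⟩
  · rcases lt_or_ge s t' with h | h
    · refine ((tendsto_wdist_heatFlow (ν ω.1) t s).mono_left nhdsWithin_le_nhds).congr' ?_
      filter_upwards [mem_nhdsWithin_of_mem_nhds (Iio_mem_nhds h)] with r hr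
      rw [glueM_of_lt X h, glueM_of_lt X hr]
    · refine (((X ω.1).cadlag ω.2).1 s ⟨h, hs.2⟩).congr' ?_
      filter_upwards [self_mem_nhdsWithin] with r hr
      rw [glueM_of_le X h, glueM_of_le X (h.trans hr)]
  · rcases le_or_gt s t' with h | h
    · refine ⟨heatFlow d t s (ν ω.1),
        ((tendsto_wdist_heatFlow (ν ω.1) t s).mono_left nhdsWithin_le_nhds).congr' ?_⟩
      filter_upwards [self_mem_nhdsWithin] with r hr
      rw [glueM_of_lt X (hr.2.trans_le h)]
    · obtain ⟨μ', hμ'⟩ := ((X ω.1).cadlag ω.2).2 s ⟨h, hs.2⟩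
      have heq : 𝓝[Ico t s] s = 𝓝[Ico t' s] s := by
        refine nhdsWithin_eq_nhdsWithin (mem_Ioi.2 h) isOpen_Ioi ?_
        ext r
        simp only [mem_inter_iff, mem_Ico, mem_Ioi]
        constructor
        · rintro ⟨⟨-, h2⟩, h3⟩; exact ⟨⟨h3.le, h2⟩, h3⟩
        · rintro ⟨⟨h1, h2⟩, h3⟩; exact ⟨⟨htt'.le.trans h1, h2⟩, h3⟩
      refine ⟨μ', ?_⟩
      rw [heq]
      refine hμ'.congr' ?_
      filter_upwards [self_mem_nhdsWithin] with r hr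
      rw [glueM_of_le X hr.1]

/-- The martingale property of the glued process, on each component. -/
theorem setIntegral_glueM (hν : ∀ c, MemP d 2 (ν c)) (htt' : t < t')
    (X : ∀ c, MVP d T t' (heatFlow d t t' (ν c))) {t₁ t₂ : ℝ} (h₀ : t ≤ t₁) (h₁ : t₁ ≤ t₂)
    (h₂ : t₂ ≤ T) (φ : Ed d →ᵇ ℝ) {S : Set (Σ c, (X c).Ω)}
    (hS : MeasurableSet[genFiltration d (glueM t' X) t t₁] S) (c : ι) :
    ∫ ω in Sigma.mk (β := fun c => (X c).Ω) c ⁻¹' S, (∫ x, φ x ∂(glueM t' X t₂ ⟨c, ω⟩)) ∂(X c).P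
      = ∫ ω in Sigma.mk (β := fun c => (X c).Ω) c ⁻¹' S,
          (∫ x, φ x ∂(heatFlow d t₁ t₂ (glueM t' X t₁ ⟨c, ω⟩))) ∂(X c).P := by
  have := (hν c).1
  rcases lt_or_ge t₁ t' with h | h
  · simp only [glueM_of_lt X h, heatFlow_heatFlow d h₀ h₁]
    rcases lt_or_ge t₂ t' with h' | h'
    · simp only [glueM_of_lt X h']
    have hSc : MeasurableSet[⊥] (Sigma.mk (β := fun c => (X c).Ω) c ⁻¹' S) := by
      refine measurableSet_preimage_of_genFiltration (left_lt_add_div_two.2 h) _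
        (m' := ⊥) (fun r hr => ?_) hS
      have hr' : r < t' := hr.2.trans_lt (add_div_two_lt_right.2 h)
      simp only [glueM_of_lt X hr']
      exact @measurable_const _ _ _ ⊥ _
    rcases MeasurableSpace.measurableSet_bot_iff.1 hSc with h3 | h3
    · simp [h3]
    · rw [h3, setIntegral_univ, setIntegral_univ]
      simp only [glueM_of_le X h']
      rw [(X c).integral_eq h' h₂, heatFlow_heatFlow d htt'.le h']
      simp
  · simp only [glueM_of_le X h, glueM_of_le X (h.trans h₁)]
    refine (X c).setIntegral_eq h h₁ h₂ φ ?_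
    rw [genFiltration, MeasurableSpace.measurableSet_iInf]
    intro u
    rw [MeasurableSpace.measurableSet_iInf]
    intro hu
    refine measurableSet_preimage_of_genFiltration hu _ (fun r hr => ?_) hS
    rcases lt_or_ge r t' with hr' | hr'
    · simp only [glueM_of_lt X hr']
      exact @measurable_const _ _ _ (_) _
    · simp only [glueM_of_le X hr']
      exact measurable_iff_comap_le.2 (le_iSup₂_of_le r ⟨hr', hr.2⟩ le_rfl)

variable [Fintype ι]

/-- Splitting of the initial law at time `t`, heat flow on `[t,t')`, and then given processes. -/
def MVP.glue {μ : Measure (Ed d)} {p : ι → ℝ} (hp : ∀ c, 0 ≤ p c) (hsum : ∑ c, p c = 1)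
    (hν : ∀ c, MemP d 2 (ν c)) (hμ : ∀ φ : Ed d →ᵇ ℝ, ∫ x, φ x ∂μ = ∑ c, p c * ∫ x, φ x ∂(ν c))
    (htt' : t < t') (ht'T : t' ≤ T) (X : ∀ c, MVP d T t' (heatFlow d t t' (ν c))) :
    MVP d T t μ where
  Ω := Σ c, (X c).Ω
  mΩ := inferInstance
  P := sigmaMix p fun c => (X c).P
  probP := isProbabilityMeasure_sigmaMix hp hsum fun c => (X c).probP
  M := glueM t' X
  meas := measurable_glueM X
  inP1 _ hs ω := memP_glueM hν X hs.2 ω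
  cadlag ω := cadlag_glueM hν htt' X ω
  init φ := by
    have hf : Measurable fun ω => ∫ x, φ x ∂(glueM t' X t ω) :=
      (measurable_integral_bcf φ).comp (measurable_glueM X t)
    rw [integral_sigmaMix hp (fun c => (X c).probP) hf (K := ‖φ‖), hμ]
    · refine Finset.sum_congr rfl fun c _ => ?_
      simp [glueM_of_lt X htt', heatFlow_self]
    · intro ω
      have := (memP_glueM hν X (htt'.le.trans ht'T) ω).1
      exact abs_integral_bcf_le _ _
  cond t₁ t₂ h₀ h₁ h₂ φ := by
    have hle := genFiltration_le (measurable_glueM X) t t₁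
    have hprob := isProbabilityMeasure_sigmaMix hp hsum fun c => (X c).probP
    have hP : ∀ s ≤ T, ∀ ω, IsProbabilityMeasure (glueM t' X s ω) :=
      fun s hs ω => (memP_glueM hν X hs ω).1
    have hf : Measurable fun ω => ∫ x, φ x ∂(glueM t' X t₂ ω) :=
      (measurable_integral_bcf φ).comp (measurable_glueM X t₂)
    have hfK : ∀ ω, |∫ x, φ x ∂(glueM t' X t₂ ω)| ≤ ‖φ‖ := fun ω => by
      have := hP t₂ h₂ ω
      exact abs_integral_bcf_le _ _
    have hg : Measurable[genFiltration d (glueM t' X) t t₁]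
        fun ω => ∫ x, φ x ∂(heatFlow d t₁ t₂ (glueM t' X t₁ ω)) := by
      have : (fun ω => ∫ x, φ x ∂(heatFlow d t₁ t₂ (glueM t' X t₁ ω)))
          = fun ω => ∫ x, heatBCF (t₂ - t₁) φ x ∂(glueM t' X t₁ ω) := by
        funext ω
        have := hP t₁ (h₁.trans h₂) ω
        exact integral_heatFlow_bcf φ _ _ _
      rw [this]
      exact (measurable_integral_bcf _).comp (measurable_genFiltration _ h₀)
    have hgK : ∀ ω, |∫ x, φ x ∂(heatFlow d t₁ t₂ (glueM t' X t₁ ω))| ≤ ‖φ‖ := fun ω => by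
      have := hP t₁ (h₁.trans h₂) ω
      exact abs_integral_bcf_le _ _
    refine (ae_eq_condExp_of_forall_setIntegral_eq hle (integrable_of_abs_le hf hfK)
      (fun S _ _ => (integrable_of_abs_le (hg.mono hle le_rfl) hgK).integrableOn)
      (fun S hS _ => ?_) hg.stronglyMeasurable.aestronglyMeasurable).symm
    rw [setIntegral_sigmaMix hp (fun c => (X c).probP) hf hfK (hle _ hS),
      setIntegral_sigmaMix hp (fun c => (X c).probP) (hg.mono hle le_rfl) hgK (hle _ hS)]
    exact Finset.sum_congr rfl fun c _ => congrArg _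
      (setIntegral_glueM hν htt' X h₀ h₁ h₂ φ hS c).symm

end Glue

section Value

variable {d : ℕ} {T t : ℝ} {μ : Measure (Ed d)}
  {A B : Type} [MetricSpace A] [CompactSpace A] [Nonempty A]
  [MetricSpace B] [CompactSpace B] [Nonempty B] {f : ℝ → Ed d → A → B → ℝ} {C : ℝ}

theorem MVP.nonempty (hμ : MemP d 2 μ) (htT : t ≤ T) : Nonempty (MVP d T t μ) := by
  rcases htT.lt_or_eq with h | rfl
  · exact ⟨MVP.glue (ι := Unit) (p := fun _ => 1) (ν := fun _ => μ) (fun _ => zero_le_one) (by simp)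
      (fun _ => hμ) (by simp) h le_rfl fun _ => MVP.const d T _ (hμ.heatFlow_two t T).memP_one⟩
  · exact ⟨MVP.const d t μ hμ.memP_one⟩

omit [CompactSpace A] [CompactSpace B] in
theorem gameValue_le (hf : IsPayoff f C) (htT : t ≤ T) (X : MVP d T t μ) :
    gameValue d f T t μ ≤ mvCost f X := by
  refine csInf_le ⟨-(C * (T - t)), ?_⟩ ⟨X, rfl⟩
  rintro _ ⟨Y, rfl⟩
  exact (abs_le.1 (Y.abs_mvCost_le hf htT)).1

omit [MetricSpace A] [CompactSpace A] [Nonempty A] [MetricSpace B] [CompactSpace B] [Nonempty B] in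
theorem exists_mvCost_lt (hμ : MemP d 2 μ) (htT : t ≤ T) {ε : ℝ} (hε : 0 < ε) :
    ∃ X : MVP d T t μ, mvCost f X < gameValue d f T t μ + ε := by
  obtain ⟨X⟩ := MVP.nonempty hμ htT
  obtain ⟨_, ⟨Y, rfl⟩, hY⟩ := Real.lt_sInf_add_pos
    (s := { r : ℝ | ∃ X : MVP d T t μ, r = mvCost f X }) ⟨_, X, rfl⟩ hε
  exact ⟨Y, hY⟩

omit [CompactSpace A] [CompactSpace B] in
theorem gameValue_self (hf : IsPayoff f C) (hμ : MemP d 2 μ) : gameValue d f T T μ ≤ 0 :=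
  (gameValue_le hf le_rfl (MVP.const d T μ hμ.memP_one)).trans (by
    have := (abs_le.1 (MVP.abs_mvCost_le hf le_rfl (MVP.const d T μ hμ.memP_one))).2
    simpa using this)

omit [CompactSpace A] [CompactSpace B] in
theorem rightRegular_heatFlow (hf : IsPayoff f C) (hμ : MemP d 2 μ) (t t' : ℝ) :
    RightRegular t t' C fun s => hamiltonian f s (heatFlow d t s μ) := by
  have := hμ.1
  refine CadlagD1.rightRegular hf ⟨fun s hs => ?_, fun s hs => ?_⟩
    fun s hs => (hμ.heatFlow_two t s).memP_one
  · exact (tendsto_wdist_heatFlow μ t s).mono_left nhdsWithin_le_nhds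
  · exact ⟨heatFlow d t s μ, (tendsto_wdist_heatFlow μ t s).mono_left nhdsWithin_le_nhds⟩

theorem mvCost_glue (hf : IsPayoff f C) {t' : ℝ} {ι : Type} [Fintype ι] {ν : ι → Measure (Ed d)}
    {p : ι → ℝ} (hp : ∀ c, 0 ≤ p c) (hsum : ∑ c, p c = 1)
    (hν : ∀ c, MemP d 2 (ν c)) (hμ : ∀ φ : Ed d →ᵇ ℝ, ∫ x, φ x ∂μ = ∑ c, p c * ∫ x, φ x ∂(ν c))
    (htt' : t < t') (ht'T : t' ≤ T) (X : ∀ c, MVP d T t' (heatFlow d t t' (ν c))) :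
    mvCost f (MVP.glue hp hsum hν hμ htt' ht'T X)
      = ∑ c, p c * ((∫ s in Icc t t', hamiltonian f s (heatFlow d t s (ν c))) + mvCost f (X c)) := by
  set Y := MVP.glue hp hsum hν hμ htt' ht'T X
  have h1 := Y.measurable_integral_hamiltonian hf (htt'.le.trans ht'T)
  have h2 := fun ω => (Y.rightRegular hf ω).abs_integral_le (htt'.le.trans ht'T)
  refine (integral_sigmaMix hp (fun c => (X c).probP) h1 h2).trans ?_
  refine Finset.sum_congr rfl fun c _ => ?_
  congr 1
  have h3 : ∀ ω : (X c).Ω, ∫ s in Icc t T, hamiltonian f s (Y.M s (⟨c, ω⟩ : Σ c, (X c).Ω))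
      = (∫ s in Icc t t', hamiltonian f s (heatFlow d t s (ν c)))
        + ∫ s in Icc t' T, hamiltonian f s ((X c).M s ω) := by
    intro ω
    have hint := (Y.rightRegular hf (⟨c, ω⟩ : Σ c, (X c).Ω)).integrableOn
    rw [integral_Icc_eq_integral_Ico (x := t) (y := t'),
      ← Ico_union_Icc_eq_Icc htt'.le ht'T, setIntegral_union _ measurableSet_Icc]
    · congr 1
      · refine setIntegral_congr_fun measurableSet_Ico fun s hs => ?_
        exact congrArg (hamiltonian f s) (glueM_of_lt X hs.2 ⟨c, ω⟩)
      · refine setIntegral_congr_fun measurableSet_Icc fun s hs => ?_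
        exact congrArg (hamiltonian f s) (glueM_of_le X hs.1 ⟨c, ω⟩)
    · exact hint.mono_set fun s hs => ⟨hs.1, hs.2.le.trans ht'T⟩
    · exact hint.mono_set fun s hs => ⟨htt'.le.trans hs.1, hs.2⟩
    · exact Set.disjoint_left.2 fun s hs hs' => absurd hs.2 (not_lt.2 hs'.1)
  refine (integral_congr_ae (ae_of_all _ h3)).trans ?_
  rw [integral_add (integrable_const _) ((X c).integrable_integral_hamiltonian hf ht'T)]
  simp [mvCost]

/-- Subsolution half of the dynamic programming principle, with a splitting of the initial law. -/
theorem gameValue_le_sum (hf : IsPayoff f C) {t' : ℝ} {ι : Type} [Fintype ι]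
    {ν : ι → Measure (Ed d)} {p : ι → ℝ} (hp : ∀ c, 0 ≤ p c) (hsum : ∑ c, p c = 1)
    (hν : ∀ c, MemP d 2 (ν c)) (hμ : ∀ φ : Ed d →ᵇ ℝ, ∫ x, φ x ∂μ = ∑ c, p c * ∫ x, φ x ∂(ν c))
    (htt' : t < t') (ht'T : t' ≤ T) :
    gameValue d f T t μ ≤ ∑ c, p c * ((∫ s in Icc t t', hamiltonian f s (heatFlow d t s (ν c)))
      + gameValue d f T t' (heatFlow d t t' (ν c))) := by
  refine le_of_forall_pos_le_add fun ε hε => ?_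
  choose X hX using fun c => exists_mvCost_lt (f := f) ((hν c).heatFlow_two t t') ht'T hε
  refine (gameValue_le hf (htt'.le.trans ht'T) (MVP.glue hp hsum hν hμ htt' ht'T X)).trans ?_
  rw [mvCost_glue hf]
  have : ε = ∑ c, p c * ε := by rw [← Finset.sum_mul, hsum, one_mul]
  rw [this, ← Finset.sum_add_distrib]
  refine Finset.sum_le_sum fun c _ => ?_
  rw [← mul_add]
  exact mul_le_mul_of_nonneg_left (by linarith [hX c]) (hp c)

end Value

section StageVal

variable {d : ℕ} {T t η : ℝ} {K : ℕ} {τ : ℕ → ℝ}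
  {A B : Type} [MetricSpace A] [CompactSpace A] [Nonempty A] [MeasurableSpace A] [BorelSpace A]
  [MetricSpace B] [CompactSpace B] [Nonempty B] [MeasurableSpace B] [BorelSpace B]
  {f : ℝ → Ed d → A → B → ℝ} {C : ℝ}

theorem measurable_snoc {X : Type*} [MeasurableSpace X] (q : ℕ) :
    Measurable fun p : (Fin q → X) × X => (Fin.snoc p.1 p.2 : Fin (q + 1) → X) := by
  refine measurable_pi_iff.2 fun i => ?_
  refine Fin.lastCases ?_ (fun i => ?_) i
  · simpa using measurable_snd
  · simp only [Fin.snoc_castSucc]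
    fun_prop

omit [Nonempty A] [Nonempty B] in
theorem IsPayoff.measurable (hf : IsPayoff f C) (s : ℝ) :
    Measurable fun p : Ed d × A × B => f s p.1 p.2.1 p.2.2 :=
  (hf.cont.comp (f := fun p : Ed d × A × B => (s, p)) (by fun_prop)).measurable

/-- The expected remaining payoff given the current state and the current pair of actions. -/
def actionVal (f : ℝ → Ed d → A → B → ℝ) (τg : ℕ → ℝ)
    (σs : (q : ℕ) → (Fin q → Ed d × A × B) → Ed d → Measure A)
    (τs : (q : ℕ) → (Fin q → A × B) → Measure B) (k q : ℕ) (h : Fin q → Ed d × A × B) (x : Ed d)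
    (u : A) (v : B) : ℝ :=
  (τg (q + 1) - τg q) * f (τg q) x u v
    + heatOp (τg (q + 1) - τg q) (stageVal d f τg σs τs k (q + 1) (Fin.snoc h (x, u, v))) x

variable {σs : (q : ℕ) → (Fin q → Ed d × A × B) → Ed d → Measure A}
  {τs : (q : ℕ) → (Fin q → A × B) → Measure B}

/-- Measurability and boundedness of the continuation payoffs. -/
structure StageRegular (f : ℝ → Ed d → A → B → ℝ) (τg : ℕ → ℝ)
    (σs : (q : ℕ) → (Fin q → Ed d × A × B) → Ed d → Measure A)
    (τs : (q : ℕ) → (Fin q → A × B) → Measure B) (k q : ℕ) (D : ℝ) : Prop where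
  meas : Measurable fun p : (Fin q → Ed d × A × B) × Ed d => stageVal d f τg σs τs k q p.1 p.2
  bdd : ∀ h x, |stageVal d f τg σs τs k q h x| ≤ D

omit [MetricSpace A] [CompactSpace A] [Nonempty A] [BorelSpace A]
  [MetricSpace B] [CompactSpace B] [Nonempty B] [BorelSpace B] in
theorem StageRegular.meas_right {k q : ℕ} {D : ℝ} (hr : StageRegular f τ σs τs k q D)
    (h : Fin q → Ed d × A × B) : Measurable (stageVal d f τ σs τs k q h) :=
  hr.meas.comp (measurable_const.prodMk measurable_id)

omit [MetricSpace A] [CompactSpace A] [Nonempty A] [BorelSpace A]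
  [MetricSpace B] [CompactSpace B] [Nonempty B] [BorelSpace B] in
theorem StageRegular.stageVal_succ {k q : ℕ} {D : ℝ} (hr : StageRegular f τ σs τs k (q + 1) D)
    (h : Fin q → Ed d × A × B) (x : Ed d) :
    stageVal d f τ σs τs (k + 1) q h x
      = ∫ u, (∫ v, actionVal f τ σs τs k q h x u v ∂(τs q fun i => ((h i).2.1, (h i).2.2)))
        ∂(σs q h x) := by
  have : ∀ u v, ∫ y, stageVal d f τ σs τs k (q + 1) (Fin.snoc h (x, u, v)) y
      ∂(heatFlow d (τ q) (τ (q + 1)) (Measure.dirac x))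
      = heatOp (τ (q + 1) - τ q) (stageVal d f τ σs τs k (q + 1) (Fin.snoc h (x, u, v))) x := by
    intro u v
    rw [integral_heatFlow (hr.meas_right _) (hr.bdd _), integral_dirac']
    exact (measurable_heatOp (hr.meas_right _) _).stronglyMeasurable
  simp only [stageVal, this, actionVal]

omit [Nonempty A] [Nonempty B] in
theorem StageRegular.measurable_actionVal (hf : IsPayoff f C) {k q : ℕ} {D : ℝ}
    (hr : StageRegular f τ σs τs k (q + 1) D) :
    Measurable fun p : (((Fin q → Ed d × A × B) × Ed d) × A) × B =>
      actionVal f τ σs τs k q p.1.1.1 p.1.1.2 p.1.2 p.2 := by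
  unfold actionVal
  refine Measurable.add ?_ ?_
  · refine Measurable.const_mul ?_ _
    exact (hf.measurable (τ q)).comp (g := fun p : Ed d × A × B => f (τ q) p.1 p.2.1 p.2.2)
      (f := fun p : (((Fin q → Ed d × A × B) × Ed d) × A) × B => (p.1.1.2, p.1.2, p.2))
      (by fun_prop)
  · unfold heatOp
    refine (StronglyMeasurable.integral_prod_right' (ν := stdG d)
      (f := fun p : ((((Fin q → Ed d × A × B) × Ed d) × A) × B) × Ed d =>
        stageVal d f τ σs τs k (q + 1) (Fin.snoc p.1.1.1.1 (p.1.1.1.2, p.1.1.2, p.1.2))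
          (p.1.1.1.2 + Real.sqrt (τ (q + 1) - τ q) • p.2)) ?_).measurable
    refine Measurable.stronglyMeasurable (hr.meas.comp (Measurable.prodMk ?_ ?_))
    · exact (measurable_snoc q).comp (f := fun p : ((((Fin q → Ed d × A × B) × Ed d) × A) × B) × Ed d
        => (p.1.1.1.1, ((p.1.1.1.2, p.1.1.2, p.1.2) : Ed d × A × B))) (by fun_prop)
    · fun_prop

omit [CompactSpace A] [Nonempty A] [BorelSpace A]
  [CompactSpace B] [Nonempty B] [BorelSpace B] in
theorem StageRegular.abs_actionVal_le (hf : IsPayoff f C) {k q : ℕ} {D : ℝ}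
    (hr : StageRegular f τ σs τs k (q + 1) D) (hτ : τ q ≤ τ (q + 1))
    (h : Fin q → Ed d × A × B) (x : Ed d) (u : A) (v : B) :
    |actionVal f τ σs τs k q h x u v| ≤ C * (τ (q + 1) - τ q) + D := by
  refine (abs_add_le _ _).trans (add_le_add ?_ (abs_heatOp_le (hr.bdd _) _ _))
  rw [abs_mul, abs_of_nonneg (sub_nonneg.2 hτ), mul_comm]
  exact mul_le_mul_of_nonneg_right (hf.bdd _ _ _ _) (sub_nonneg.2 hτ)

omit [Nonempty A] [Nonempty B] in
theorem StageRegular.measurable_integral_actionVal (hf : IsPayoff f C) (hτs : IsStrategy2 d τs)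
    {k q : ℕ} {D : ℝ} (hr : StageRegular f τ σs τs k (q + 1) D) :
    Measurable fun p : ((Fin q → Ed d × A × B) × Ed d) × A =>
      ∫ v, actionVal f τ σs τs k q p.1.1 p.1.2 p.2 v
        ∂(τs q fun i => ((p.1.1 i).2.1, (p.1.1 i).2.2)) := by
  let κ : ProbabilityTheory.Kernel (((Fin q → Ed d × A × B) × Ed d) × A) B :=
    ⟨fun p => τs q fun i => ((p.1.1 i).2.1, (p.1.1 i).2.2), (hτs q).2.comp (by fun_prop)⟩
  have : ProbabilityTheory.IsMarkovKernel κ := ⟨fun p => (hτs q).1 _⟩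
  exact (StronglyMeasurable.integral_kernel_prod_right' (κ := κ)
    (hr.measurable_actionVal hf).stronglyMeasurable).measurable

omit [Nonempty A] [Nonempty B] in
theorem StageRegular.succ (hf : IsPayoff f C) (hσs : IsStrategy1 d σs) (hτs : IsStrategy2 d τs)
    {k q : ℕ} {D : ℝ} (hr : StageRegular f τ σs τs k (q + 1) D) (hτ : τ q ≤ τ (q + 1)) :
    StageRegular f τ σs τs (k + 1) q (C * (τ (q + 1) - τ q) + D) := by
  constructor
  · simp only [hr.stageVal_succ]
    let κ : ProbabilityTheory.Kernel ((Fin q → Ed d × A × B) × Ed d) A :=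
      ⟨fun p => σs q p.1 p.2, (hσs q).2⟩
    have : ProbabilityTheory.IsMarkovKernel κ := ⟨fun p => (hσs q).1 _ _⟩
    exact (StronglyMeasurable.integral_kernel_prod_right' (κ := κ)
      (hr.measurable_integral_actionVal hf hτs).stronglyMeasurable).measurable
  · intro h x
    rw [hr.stageVal_succ]
    have := (hσs q).1 h x
    refine abs_integral_le_of_abs_le fun u => ?_
    have := (hτs q).1 fun i => ((h i).2.1, (h i).2.2)
    exact abs_integral_le_of_abs_le fun v => hr.abs_actionVal_le hf hτ h x u v

omit [Nonempty A] [Nonempty B] in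
theorem IsGrid.stageRegular (hg : IsGrid t T η K τ) (hf : IsPayoff f C) (hσs : IsStrategy1 d σs)
    (hτs : IsStrategy2 d τs) (k : ℕ) : ∀ q, q + k = K →
      StageRegular f τ σs τs k q (C * (T - τ q)) := by
  induction k with
  | zero =>
    intro q hq
    rw [add_zero] at hq
    subst hq
    exact ⟨measurable_const, fun h x => by simp [stageVal, hg.final]⟩
  | succ k ih =>
    intro q hq
    have h1 := (ih (q + 1) (by omega)).succ hf hσs hτs (hg.lt q (by omega)).le
    convert h1 using 1
    ring

end StageVal

section Softmin

variable {ι : Type} [Fintype ι] [Nonempty ι]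

/-- The partition function of the Gibbs weights. -/
def gibbsSum (r : ℝ) (v : ι → ℝ) : ℝ := ∑ c, Real.exp (-(r * v c))

/-- The Gibbs weights at inverse temperature `r`. -/
def gibbs (r : ℝ) (v : ι → ℝ) (c : ι) : ℝ := Real.exp (-(r * v c)) / gibbsSum r v

/-- A smooth approximation from below of the minimum. -/
def softmin (r : ℝ) (v : ι → ℝ) : ℝ := -(1 / r * Real.log (gibbsSum r v))

theorem gibbsSum_pos (r : ℝ) (v : ι → ℝ) : 0 < gibbsSum r v :=
  Finset.sum_pos (fun _ _ => Real.exp_pos _) Finset.univ_nonempty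

theorem gibbs_pos (r : ℝ) (v : ι → ℝ) (c : ι) : 0 < gibbs r v c :=
  div_pos (Real.exp_pos _) (gibbsSum_pos r v)

theorem sum_gibbs (r : ℝ) (v : ι → ℝ) : ∑ c, gibbs r v c = 1 := by
  unfold gibbs
  rw [← Finset.sum_div]
  exact div_self (gibbsSum_pos r v).ne'

theorem softmin_le {r : ℝ} (hr : 0 < r) (v : ι → ℝ) (c : ι) : softmin r v ≤ v c := by
  have h1 : Real.exp (-(r * v c)) ≤ gibbsSum r v :=
    Finset.single_le_sum (f := fun c => Real.exp (-(r * v c)))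
      (fun _ _ => (Real.exp_pos _).le) (Finset.mem_univ c)
  have h2 : -(r * v c) ≤ Real.log (gibbsSum r v) := (Real.le_log_iff_exp_le (gibbsSum_pos r v)).2 h1
  have h3 : 1 / r * -(r * v c) ≤ 1 / r * Real.log (gibbsSum r v) :=
    mul_le_mul_of_nonneg_left h2 (by positivity)
  have h4 : 1 / r * -(r * v c) = - v c := by field_simp
  unfold softmin
  linarith

theorem sum_gibbs_mul_le {r : ℝ} (hr : 0 < r) (v : ι → ℝ) :
    ∑ c, gibbs r v c * v c ≤ softmin r v + Fintype.card ι / r := by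
  have h : ∀ c, gibbs r v c * v c ≤ gibbs r v c * softmin r v + 1 / r := by
    intro c
    have h0 := gibbs_pos r v c
    have h1 : Real.log (gibbs r v c) = -(r * v c) - Real.log (gibbsSum r v) := by
      rw [gibbs, Real.log_div (Real.exp_pos _).ne' (gibbsSum_pos r v).ne', Real.log_exp]
    have h2 : v c = softmin r v - 1 / r * Real.log (gibbs r v c) := by
      rw [h1, softmin]
      field_simp
      ring
    have h3 : 1 - (gibbs r v c)⁻¹ ≤ Real.log (gibbs r v c) := Real.one_sub_inv_le_log_of_pos h0
    have h4 : -1 ≤ gibbs r v c * Real.log (gibbs r v c) := by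
      have := mul_le_mul_of_nonneg_left h3 h0.le
      rw [mul_sub, mul_inv_cancel₀ h0.ne'] at this
      linarith
    have h5 : 1 / r * (-1) ≤ 1 / r * (gibbs r v c * Real.log (gibbs r v c)) :=
      mul_le_mul_of_nonneg_left h4 (by positivity)
    calc gibbs r v c * v c
        = gibbs r v c * softmin r v - 1 / r * (gibbs r v c * Real.log (gibbs r v c)) := by
          conv_lhs => rw [h2]
          ring
      _ ≤ _ := by linarith
  refine (Finset.sum_le_sum fun c _ => h c).trans ?_
  rw [Finset.sum_add_distrib, ← Finset.sum_mul, sum_gibbs, one_mul, Finset.sum_const,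
    Finset.card_univ, nsmul_eq_mul, mul_one_div]

theorem le_softmin_add {r : ℝ} (hr : 0 < r) (v u : ι → ℝ) {D : ℝ} (hD : D ≤ 1)
    (h : ∀ c, |r * u c| ≤ D) :
    softmin r v + ∑ c, gibbs r v c * u c - 1 / r * D ^ 2 ≤ softmin r (fun c => v c + u c) := by
  have hsum : gibbsSum r (fun c => v c + u c)
      = gibbsSum r v * ∑ c, gibbs r v c * Real.exp (-(r * u c)) := by
    rw [Finset.mul_sum, gibbsSum]
    refine Finset.sum_congr rfl fun c _ => ?_
    rw [gibbs, ← mul_assoc, mul_div_cancel₀ _ (gibbsSum_pos r v).ne', ← Real.exp_add]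
    congr 1
    ring
  have hpos : 0 < ∑ c, gibbs r v c * Real.exp (-(r * u c)) :=
    Finset.sum_pos (fun c _ => mul_pos (gibbs_pos r v c) (Real.exp_pos _)) Finset.univ_nonempty
  have hle : ∑ c, gibbs r v c * Real.exp (-(r * u c))
      ≤ 1 - r * ∑ c, gibbs r v c * u c + D ^ 2 := by
    have h1 : ∀ c, gibbs r v c * Real.exp (-(r * u c))
        ≤ gibbs r v c * (1 + D ^ 2) - r * (gibbs r v c * u c) := by
      intro c
      have h2 := Real.abs_exp_sub_one_sub_id_le (x := -(r * u c))
        (by rw [abs_neg]; exact (h c).trans hD)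
      have h3 : (-(r * u c)) ^ 2 ≤ D ^ 2 := by
        rw [neg_sq, ← sq_abs]
        exact pow_le_pow_left₀ (abs_nonneg _) (h c) 2
      have h4 : Real.exp (-(r * u c)) ≤ 1 + D ^ 2 - r * u c := by linarith [(abs_le.1 h2).2]
      calc _ ≤ gibbs r v c * (1 + D ^ 2 - r * u c) :=
            mul_le_mul_of_nonneg_left h4 (gibbs_pos r v c).le
        _ = _ := by ring
    refine (Finset.sum_le_sum fun c _ => h1 c).trans ?_
    rw [Finset.sum_sub_distrib, ← Finset.sum_mul, sum_gibbs, ← Finset.mul_sum]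
    linarith
  have hlog : Real.log (∑ c, gibbs r v c * Real.exp (-(r * u c)))
      ≤ D ^ 2 - r * ∑ c, gibbs r v c * u c := by
    linarith [Real.log_le_sub_one_of_pos hpos]
  have h6 := mul_le_mul_of_nonneg_left hlog (one_div_pos.2 hr).le
  have h7 : 1 / r * (D ^ 2 - r * ∑ c, gibbs r v c * u c)
      = 1 / r * D ^ 2 - ∑ c, gibbs r v c * u c := by
    field_simp
  rw [softmin, softmin, hsum, Real.log_mul (gibbsSum_pos r v).ne' hpos.ne', mul_add]
  linarith

end Softmin

section Minimax

variable {ι : Type} [Fintype ι] [Nonempty ι] {X : Type*} [MeasurableSpace X]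

omit [Nonempty ι] in
theorem measurable_gibbsSum (r : ℝ) {a : ι → X → ℝ} (ha : ∀ c, Measurable (a c)) :
    Measurable fun x => gibbsSum r fun c => a c x :=
  Finset.measurable_fun_sum _ fun c _ => ((ha c).const_mul r).neg.exp

omit [Nonempty ι] in
theorem measurable_gibbs (r : ℝ) {a : ι → X → ℝ} (ha : ∀ c, Measurable (a c)) (c : ι) :
    Measurable fun x => gibbs r (fun c => a c x) c :=
  ((ha c).const_mul r).neg.exp.div (measurable_gibbsSum r ha)

omit [Nonempty ι] in
theorem measurable_softmin (r : ℝ) {a : ι → X → ℝ} (ha : ∀ c, Measurable (a c)) :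
    Measurable fun x => softmin r fun c => a c x :=
  ((measurable_gibbsSum r ha).log.const_mul _).neg

omit [Nonempty ι] in
theorem abs_sum_mul_le {w v : ι → ℝ} (hw : ∀ c, 0 ≤ w c) (hsum : ∑ c, w c = 1) {M : ℝ}
    (hv : ∀ c, |v c| ≤ M) : |∑ c, w c * v c| ≤ M := by
  refine (Finset.abs_sum_le_sum_abs _ _).trans ?_
  calc ∑ c, |w c * v c| ≤ ∑ c, w c * M := Finset.sum_le_sum fun c _ => by
        rw [abs_mul, abs_of_nonneg (hw c)]
        exact mul_le_mul_of_nonneg_left (hv c) (hw c)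
    _ = M := by rw [← Finset.sum_mul, hsum, one_mul]

theorem abs_softmin_le {r M : ℝ} (hr : 0 < r) {v : ι → ℝ} (hv : ∀ c, |v c| ≤ M) :
    |softmin r v| ≤ M + Fintype.card ι / r := by
  have h1 := sum_gibbs_mul_le hr v
  have h2 := abs_sum_mul_le (fun c => (gibbs_pos r v c).le) (sum_gibbs r v) hv
  have c : ι := Classical.arbitrary ι
  have h3 := softmin_le hr v c
  have h4 : 0 ≤ (Fintype.card ι : ℝ) / r := by positivity
  rw [abs_le] at h2 ⊢
  constructor <;> linarith [(abs_le.1 (hv c)).2]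

/-- Minimax principle: if every strictly positive measurable weighting of the components can be
countered within a convex family, then the minimum of the components can be handled uniformly. -/
theorem exists_integral_inf_ge (μ : Measure X) [IsProbabilityMeasure μ] {S : Set (ι → X → ℝ)}
    {M : ℝ}
    (hmeas : ∀ a ∈ S, ∀ c, Measurable (a c)) (hbdd : ∀ a ∈ S, ∀ c x, |a c x| ≤ M)
    (hconv : ∀ a ∈ S, ∀ b ∈ S, ∀ s ∈ Icc (0 : ℝ) 1,
      (fun c x => (1 - s) * a c x + s * b c x) ∈ S) {l : ℝ}
    (hS : ∀ w : ι → X → ℝ, (∀ c, Measurable (w c)) → (∀ c x, 0 < w c x) → (∀ x, ∑ c, w c x = 1) →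
      ∀ ε > 0, ∃ a ∈ S, l - ε ≤ ∫ x, ∑ c, w c x * a c x ∂μ) {ε : ℝ} (hε : 0 < ε) :
    ∃ a ∈ S, l - ε ≤ ∫ x, Finset.univ.inf' Finset.univ_nonempty (fun c => a c x) ∂μ := by
  have hbdd1 : ∀ a ∈ S, ∀ c x, |a c x| ≤ max M 1 := fun a ha c x =>
    (hbdd a ha c x).trans (le_max_left _ _)
  have hM : 1 ≤ max M 1 := le_max_right _ _
  generalize max M 1 = M' at hbdd1 hM
  clear hbdd
  obtain ⟨r, hr, hrK⟩ : ∃ r : ℝ, 0 < r ∧ Fintype.card ι / r ≤ ε / 4 := by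
    have hc : (0 : ℝ) < Fintype.card ι := by exact_mod_cast Fintype.card_pos
    exact ⟨4 * Fintype.card ι / ε, by positivity, by rw [div_div_eq_mul_div]; field_simp; rfl⟩
  obtain ⟨s, hs, hs1, hsD, hsε⟩ : ∃ s : ℝ, 0 < s ∧ s ≤ 1 ∧ r * (s * (2 * M')) ≤ 1 ∧
      1 / r * (r * (s * (2 * M'))) ^ 2 ≤ s * (ε / 4) := by
    have h1 : 0 < 1 / (r * (2 * M')) := by positivity
    have h2 : 0 < ε / (16 * r * M' ^ 2) := by positivity
    refine ⟨min 1 (min (1 / (r * (2 * M'))) (ε / (16 * r * M' ^ 2))), by positivity,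
      min_le_left _ _, ?_, ?_⟩
    · have h3 := (min_le_right 1 _).trans (min_le_left (1 / (r * (2 * M'))) (ε / (16 * r * M' ^ 2)))
      rw [le_div_iff₀ (by positivity)] at h3
      linarith
    · set s := min 1 (min (1 / (r * (2 * M'))) (ε / (16 * r * M' ^ 2)))
      have hs : 0 ≤ s := by positivity
      have h3 : s ≤ ε / (16 * r * M' ^ 2) := (min_le_right 1 _).trans (min_le_right _ _)
      rw [le_div_iff₀ (by positivity)] at h3
      have h4 : 1 / r * (r * (s * (2 * M'))) ^ 2 = s * (s * (16 * r * M' ^ 2) / 4) := by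
        field_simp; ring
      rw [h4]
      exact mul_le_mul_of_nonneg_left (by linarith) hs
  let I : (ι → X → ℝ) → ℝ := fun a => ∫ x, softmin r (fun c => a c x) ∂μ
  have hint : ∀ a ∈ S, Integrable (fun x => softmin r (fun c => a c x)) μ := fun a ha =>
    integrable_of_abs_le (measurable_softmin r (hmeas a ha)) fun x =>
      abs_softmin_le hr fun c => hbdd1 a ha c x
  have hne : (I '' S).Nonempty := by
    obtain ⟨a, ha, -⟩ := hS (fun _ _ => 1 / Fintype.card ι) (fun _ => measurable_const)
      (fun _ _ => one_div_pos.2 (by exact_mod_cast Fintype.card_pos))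
      (fun x => by
        rw [Finset.sum_const, Finset.card_univ, nsmul_eq_mul, mul_one_div]
        exact div_self (by exact_mod_cast Fintype.card_pos.ne')) 1 one_pos
    exact ⟨_, a, ha, rfl⟩
  have hbd : BddAbove (I '' S) := by
    refine ⟨M' + Fintype.card ι / r, ?_⟩
    rintro _ ⟨a, ha, rfl⟩
    exact (abs_le.1 (abs_integral_le_of_abs_le fun x =>
      abs_softmin_le hr fun c => hbdd1 a ha c x)).2
  obtain ⟨_, ⟨a, ha, rfl⟩, hamax⟩ := exists_lt_of_lt_csSup hne
    (show sSup (I '' S) - s * (ε / 4) < sSup (I '' S) by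
      linarith [mul_pos hs (show 0 < ε / 4 by linarith)])
  obtain ⟨b, hb, hbl⟩ := hS (fun c x => gibbs r (fun c => a c x) c)
    (fun c => measurable_gibbs r (hmeas a ha) c) (fun c x => gibbs_pos _ _ _)
    (fun x => sum_gibbs _ _) (ε / 4) (by linarith)
  have hsb := hconv a ha b hb s ⟨hs.le, hs1⟩
  have hmax : I (fun c x => (1 - s) * a c x + s * b c x) ≤ I a + s * (ε / 4) := by
    have := le_csSup hbd ⟨_, hsb, rfl⟩
    linarith
  have hwint : ∀ e ∈ S, Integrable (fun x => ∑ c, gibbs r (fun c => a c x) c * e c x) μ := fun e he =>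
    integrable_of_abs_le (Finset.measurable_fun_sum _ fun c _ =>
      (measurable_gibbs r (hmeas a ha) c).mul (hmeas e he c)) (K := M') fun x =>
        abs_sum_mul_le (fun c => (gibbs_pos _ _ c).le) (sum_gibbs _ _) fun c => hbdd1 e he c x
  have hstep : I a + s * (∫ x, ∑ c, gibbs r (fun c => a c x) c * b c x ∂μ
      - ∫ x, ∑ c, gibbs r (fun c => a c x) c * a c x ∂μ) - s * (ε / 4)
      ≤ I (fun c x => (1 - s) * a c x + s * b c x) := by
    have hi : Integrable (fun x => s * (∑ c, gibbs r (fun c => a c x) c * b c x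
        - ∑ c, gibbs r (fun c => a c x) c * a c x)) μ :=
      ((hwint b hb).sub (hwint a ha)).const_mul s
    have hi' : Integrable (fun x => softmin r (fun c => a c x)
        + s * (∑ c, gibbs r (fun c => a c x) c * b c x
        - ∑ c, gibbs r (fun c => a c x) c * a c x)) μ := (hint a ha).add hi
    have h0 : ∫ x, (softmin r (fun c => a c x) + s * (∑ c, gibbs r (fun c => a c x) c * b c x
        - ∑ c, gibbs r (fun c => a c x) c * a c x) - s * (ε / 4)) ∂μ
        = I a + s * (∫ x, ∑ c, gibbs r (fun c => a c x) c * b c x ∂μ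
      - ∫ x, ∑ c, gibbs r (fun c => a c x) c * a c x ∂μ) - s * (ε / 4) := by
      rw [integral_sub hi' (integrable_const _), integral_add (hint a ha) hi,
        integral_const_mul, integral_sub (hwint b hb) (hwint a ha)]
      simp [I]
    rw [← h0]
    refine integral_mono (hi'.sub (integrable_const _)) (hint _ hsb) fun x => ?_
    have h1 := le_softmin_add hr (fun c => a c x) (fun c => s * (b c x - a c x)) hsD (fun c => by
      rw [abs_mul, abs_mul, abs_of_pos hr, abs_of_pos hs]
      have : |b c x - a c x| ≤ 2 * M' := by
        have h2 := abs_le.1 (hbdd1 a ha c x)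
        have h3 := abs_le.1 (hbdd1 b hb c x)
        rw [abs_le]
        constructor <;> linarith
      gcongr)
    have h2 : (fun c => a c x + s * (b c x - a c x)) = fun c => (1 - s) * a c x + s * b c x := by
      funext c; ring
    rw [h2] at h1
    have h3 : ∑ c, gibbs r (fun c => a c x) c * (s * (b c x - a c x))
        = s * (∑ c, gibbs r (fun c => a c x) c * b c x - ∑ c, gibbs r (fun c => a c x) c * a c x) := by
      rw [← Finset.sum_sub_distrib, Finset.mul_sum]
      exact Finset.sum_congr rfl fun c _ => by ring
    simp only [← h3]
    linarith
  have hwa : ∫ x, ∑ c, gibbs r (fun c => a c x) c * b c x ∂μ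
      - ∫ x, ∑ c, gibbs r (fun c => a c x) c * a c x ∂μ ≤ ε / 2 := by
    by_contra! hcon
    have := mul_lt_mul_of_pos_left hcon hs
    linarith
  have hfin : ∫ x, ∑ c, gibbs r (fun c => a c x) c * a c x ∂μ ≤ I a + ε / 4 := by
    have h0 : ε / 4 = ∫ _, ε / 4 ∂μ := by simp
    rw [h0, ← integral_add (hint a ha) (integrable_const _)]
    refine integral_mono (hwint a ha) ((hint a ha).add (integrable_const _)) fun x => ?_
    exact (sum_gibbs_mul_le hr _).trans (add_le_add le_rfl hrK)
  refine ⟨a, ha, ?_⟩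
  have hlast : I a ≤ ∫ x, Finset.univ.inf' Finset.univ_nonempty (fun c => a c x) ∂μ := by
    refine integral_mono (hint a ha) (integrable_of_abs_le ?_ (K := M') fun x => ?_) fun x => ?_
    · have := Finset.inf'_induction (p := Measurable) Finset.univ_nonempty (fun c => a c)
        (fun f hf g hg => hf.inf hg) fun c _ => hmeas a ha c
      convert this using 2
      rw [Finset.inf'_apply]
    · obtain ⟨c, -, hc⟩ := Finset.exists_mem_eq_inf' Finset.univ_nonempty (fun c => a c x)
      rw [hc]
      exact hbdd1 a ha c x
    · exact Finset.le_inf' _ _ fun c _ => softmin_le hr _ c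
  linarith

end Minimax

section Guaranteed

variable {d : ℕ}

theorem heatOp_mono {φ ψ : Ed d → ℝ} (hφ : Measurable φ) {K L : ℝ} (hK : ∀ x, |φ x| ≤ K)
    (hψ : Measurable ψ) (hL : ∀ x, |ψ x| ≤ L) (h : ∀ x, φ x ≤ ψ x) (r : ℝ) (x : Ed d) :
    heatOp r φ x ≤ heatOp r ψ x :=
  integral_mono (integrable_of_abs_le (hφ.comp (by fun_prop)) fun _ => hK _)
    (integrable_of_abs_le (hψ.comp (by fun_prop)) fun _ => hL _) fun _ => h _

theorem heatOp_linear {φ ψ : Ed d → ℝ} (hφ : Measurable φ) {K L : ℝ} (hK : ∀ x, |φ x| ≤ K)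
    (hψ : Measurable ψ) (hL : ∀ x, |ψ x| ≤ L) (a b r : ℝ) (x : Ed d) :
    heatOp r (fun y => a * φ y + b * ψ y) x = a * heatOp r φ x + b * heatOp r ψ x := by
  unfold heatOp
  rw [integral_add, integral_const_mul, integral_const_mul]
  · exact (integrable_of_abs_le (hφ.comp (by fun_prop)) fun _ => hK _).const_mul _
  · exact (integrable_of_abs_le (hψ.comp (by fun_prop)) fun _ => hL _).const_mul _

theorem abs_convexComb_le {a b M s : ℝ} (ha : |a| ≤ M) (hb : |b| ≤ M) (hs : s ∈ Icc (0 : ℝ) 1) :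
    |(1 - s) * a + s * b| ≤ M := by
  have h1 := abs_le.1 ha
  have h2 := abs_le.1 hb
  have h3 := hs.1
  have h4 := sub_nonneg.2 hs.2
  rw [abs_le]
  constructor <;> nlinarith

variable {ιA ιB : Type} [Fintype ιA] [Fintype ιB]

/-- The vectors of expected payoffs player 2 can secure in one stage with a mixed action `ν`,
against each action of player 1, when the continuation payoffs are taken in `Ψ`. -/
def mixedVals (r : ℝ) (G : ιA → ιB → Ed d → ℝ) (Ψ : Set (Ed d → ℝ)) : Set (ιA → Ed d → ℝ) :=
  {α | ∃ ν : ιB → ℝ, (∀ j, 0 ≤ ν j) ∧ ∑ j, ν j = 1 ∧ ∃ φ : ιA → ιB → Ed d → ℝ,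
    (∀ c j, φ c j ∈ Ψ) ∧ α = fun c x => ∑ j, ν j * (r * G c j x + heatOp r (φ c j) x)}

/-- The functions `φ` such that player 2 can guarantee `φ x` in every state `x` simultaneously
over `k` stages starting from stage `q`. -/
def guaranteed (τ : ℕ → ℝ) (T D : ℝ) (G : ℕ → ιA → ιB → Ed d → ℝ) : ℕ → ℕ → Set (Ed d → ℝ)
  | 0, _ => {0}
  | k + 1, q => {φ | Measurable φ ∧ (∀ x, |φ x| ≤ D * (T - τ q)) ∧
      ∃ α ∈ mixedVals (τ (q + 1) - τ q) (G q) (guaranteed τ T D G k (q + 1)), ∀ c x, φ x ≤ α c x}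

variable {r M D : ℝ} {Ψ : Set (Ed d → ℝ)} {G : ιA → ιB → Ed d → ℝ}

omit [Fintype ιA] in
theorem measurable_of_mem_mixedVals (hG : ∀ c j, Measurable (G c j))
    (hΨ : ∀ φ ∈ Ψ, Measurable φ) {α : ιA → Ed d → ℝ} (hα : α ∈ mixedVals r G Ψ) (c : ιA) :
    Measurable (α c) := by
  obtain ⟨ν, -, -, φ, hφ, rfl⟩ := hα
  exact Finset.measurable_fun_sum _ fun j _ =>
    (((hG c j).const_mul r).add (measurable_heatOp (hΨ _ (hφ c j)) r)).const_mul _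

omit [Fintype ιA] in
theorem abs_le_of_mem_mixedVals (hr : 0 ≤ r) (hG : ∀ c j x, |G c j x| ≤ D)
    (hΨ : ∀ φ ∈ Ψ, ∀ x, |φ x| ≤ M) {α : ιA → Ed d → ℝ} (hα : α ∈ mixedVals r G Ψ) (c : ιA)
    (x : Ed d) : |α c x| ≤ r * D + M := by
  obtain ⟨ν, hν, hsum, φ, hφ, rfl⟩ := hα
  refine abs_sum_mul_le hν hsum fun j => (abs_add_le _ _).trans (add_le_add ?_ ?_)
  · rw [abs_mul, abs_of_nonneg hr]
    exact mul_le_mul_of_nonneg_left (hG c j x) hr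
  · exact abs_heatOp_le (hΨ _ (hφ c j)) _ _

omit [Fintype ιA] in
theorem mixedVals_convex (hmeas : ∀ φ ∈ Ψ, Measurable φ) (hbdd : ∀ φ ∈ Ψ, ∀ x, |φ x| ≤ M)
    (hΨ : ∀ φ ∈ Ψ, ∀ ψ ∈ Ψ, ∀ s ∈ Icc (0 : ℝ) 1, (fun x => (1 - s) * φ x + s * ψ x) ∈ Ψ) :
    ∀ α ∈ mixedVals r G Ψ, ∀ β ∈ mixedVals r G Ψ, ∀ s ∈ Icc (0 : ℝ) 1,
      (fun c x => (1 - s) * α c x + s * β c x) ∈ mixedVals r G Ψ := by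
  rintro _ ⟨ν, hν, hνs, φ, hφ, rfl⟩ _ ⟨ν', hν', hνs', φ', hφ', rfl⟩ s ⟨hs0, hs1⟩
  have hs1' := sub_nonneg.2 hs1
  have hw : ∀ j, 0 ≤ (1 - s) * ν j + s * ν' j := fun j =>
    add_nonneg (mul_nonneg hs1' (hν j)) (mul_nonneg hs0 (hν' j))
  let θ : ιB → ℝ := fun j => s * ν' j / ((1 - s) * ν j + s * ν' j)
  have hθ : ∀ j, θ j ∈ Icc (0 : ℝ) 1 := fun j =>
    ⟨div_nonneg (mul_nonneg hs0 (hν' j)) (hw j),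
      div_le_one_of_le₀ (le_add_of_nonneg_left (mul_nonneg hs1' (hν j))) (hw j)⟩
  have hθ1 : ∀ j, ((1 - s) * ν j + s * ν' j) * θ j = s * ν' j := by
    intro j
    rcases (hw j).eq_or_lt' with h | h
    · have h1 := mul_nonneg hs1' (hν j)
      have h2 := mul_nonneg hs0 (hν' j)
      rw [h, zero_mul]
      linarith
    · exact mul_div_cancel₀ _ h.ne'
  refine ⟨fun j => (1 - s) * ν j + s * ν' j, hw, ?_,
    fun c j x => (1 - θ j) * φ c j x + θ j * φ' c j x,
    fun c j => hΨ _ (hφ c j) _ (hφ' c j) _ (hθ j), ?_⟩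
  · rw [Finset.sum_add_distrib, ← Finset.mul_sum, ← Finset.mul_sum, hνs, hνs']
    ring
  · funext c x
    rw [Finset.mul_sum, Finset.mul_sum, ← Finset.sum_add_distrib]
    refine Finset.sum_congr rfl fun j _ => ?_
    rw [heatOp_linear (hmeas _ (hφ c j)) (hbdd _ (hφ c j)) (hmeas _ (hφ' c j)) (hbdd _ (hφ' c j))]
    linear_combination (heatOp r (φ c j) x - heatOp r (φ' c j) x) * hθ1 j

variable {τ : ℕ → ℝ} {T t η : ℝ} {K : ℕ} {G : ℕ → ιA → ιB → Ed d → ℝ}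

omit [Fintype ιA] in
theorem measurable_of_mem_guaranteed {k q : ℕ} {φ : Ed d → ℝ}
    (hφ : φ ∈ guaranteed τ T D G k q) : Measurable φ := by
  cases k with
  | zero =>
    rw [guaranteed, mem_singleton_iff] at hφ
    rw [hφ]
    exact measurable_const
  | succ k => exact hφ.1

omit [Fintype ιA] in
theorem abs_le_of_mem_guaranteed (hD : 0 ≤ D) {k q : ℕ} (hq : τ q ≤ T) {φ : Ed d → ℝ}
    (hφ : φ ∈ guaranteed τ T D G k q) (x : Ed d) : |φ x| ≤ D * (T - τ q) := by
  cases k with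
  | zero =>
    rw [guaranteed, mem_singleton_iff] at hφ
    rw [hφ, Pi.zero_apply, abs_zero]
    exact mul_nonneg hD (sub_nonneg.2 hq)
  | succ k => exact hφ.2.1 x

omit [Fintype ιA] in
theorem IsGrid.guaranteed_convex (hg : IsGrid t T η K τ) (hD : 0 ≤ D) (k : ℕ) :
    ∀ q, q + k = K → ∀ φ ∈ guaranteed τ T D G k q, ∀ ψ ∈ guaranteed τ T D G k q,
      ∀ s ∈ Icc (0 : ℝ) 1, (fun x => (1 - s) * φ x + s * ψ x) ∈ guaranteed τ T D G k q := by
  induction k with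
  | zero =>
    intro q _ φ hφ ψ hψ s _
    rw [guaranteed, mem_singleton_iff] at hφ hψ ⊢
    rw [hφ, hψ]
    funext x
    simp
  | succ k ih =>
    rintro q hq φ ⟨hφ, hφb, α, hα, hφα⟩ ψ ⟨hψ, hψb, β, hβ, hψβ⟩ s hs
    refine ⟨(hφ.const_mul _).add (hψ.const_mul _), fun x => abs_convexComb_le (hφb x) (hψb x) hs,
      _, mixedVals_convex (fun _ => measurable_of_mem_guaranteed)
        (fun _ h => abs_le_of_mem_guaranteed hD (hg.mem_Icc (q := q + 1) (by omega)).2 h)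
        (ih (q + 1) (by omega)) α hα β hβ s hs, fun c x => ?_⟩
    exact add_le_add (mul_le_mul_of_nonneg_left (hφα c x) (sub_nonneg.2 hs.2))
      (mul_le_mul_of_nonneg_left (hψβ c x) hs.1)

end Guaranteed

section Extraction

variable {d : ℕ} {T t η : ℝ} {K : ℕ} {τ : ℕ → ℝ}
  {A B : Type} [MetricSpace A] [CompactSpace A] [Nonempty A] [MeasurableSpace A] [BorelSpace A]
  [MetricSpace B] [CompactSpace B] [Nonempty B] [MeasurableSpace B] [BorelSpace B]
  {f : ℝ → Ed d → A → B → ℝ} {C D : ℝ}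
  {ιA ιB : Type} [Fintype ιA] [Fintype ιB] [MeasurableSpace ιA] [MeasurableSpace ιB]
  [MeasurableSingletonClass ιA] [MeasurableSingletonClass ιB]

omit [MetricSpace A] [CompactSpace A] [Nonempty A] [BorelSpace A]
  [MetricSpace B] [CompactSpace B] [Nonempty B] [BorelSpace B]
  [Fintype ιA] [MeasurableSpace ιA] [MeasurableSpace ιB]
  [MeasurableSingletonClass ιA] [MeasurableSingletonClass ιB] in
theorem exists_mixed_response {G : ℕ → ιA → ιB → Ed d → ℝ} (K : ℕ) {φ₀ : Ed d → ℝ}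
    (hφ₀ : φ₀ ∈ guaranteed τ T D G K 0) (b₀ : ιB) :
    ∃ (st : (q : ℕ) → (Fin q → ιA × ιB) → Ed d → ℝ) (ν : (q : ℕ) → (Fin q → ιA × ιB) → ιB → ℝ),
      st 0 (fun i => i.elim0) = φ₀ ∧ (∀ q g, q ≤ K → st q g ∈ guaranteed τ T D G (K - q) q) ∧
      (∀ q g j, 0 ≤ ν q g j) ∧ (∀ q g, ∑ j, ν q g j = 1) ∧
      ∀ q g, q < K → ∀ c x, st q g x ≤ ∑ j, ν q g j *
        ((τ (q + 1) - τ q) * G q c j x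
          + heatOp (τ (q + 1) - τ q) (st (q + 1) (Fin.snoc g (c, j))) x) := by
  classical
  have key : ∀ k q (φ : Ed d → ℝ), ∃ (ν : ιB → ℝ) (ψ : ιA → ιB → Ed d → ℝ),
      (∀ j, 0 ≤ ν j) ∧ ∑ j, ν j = 1 ∧ (φ ∈ guaranteed τ T D G (k + 1) q →
        (∀ c j, ψ c j ∈ guaranteed τ T D G k (q + 1)) ∧ ∀ c x, φ x ≤ ∑ j, ν j *
          ((τ (q + 1) - τ q) * G q c j x + heatOp (τ (q + 1) - τ q) (ψ c j) x)) := by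
    intro k q φ
    by_cases h : φ ∈ guaranteed τ T D G (k + 1) q
    · obtain ⟨-, -, α, ⟨ν, hν, hs, ψ, hψ, rfl⟩, hle⟩ := h
      exact ⟨ν, ψ, hν, hs, fun _ => ⟨hψ, hle⟩⟩
    · refine ⟨fun j => if j = b₀ then 1 else 0, fun _ _ => 0, fun j => ?_, by simp,
        fun h' => absurd h' h⟩
      dsimp only
      split_ifs <;> norm_num
  choose ν ψ hν hs hle using key
  let st : (q : ℕ) → (Fin q → ιA × ιB) → Ed d → ℝ := fun q => Nat.rec (fun _ => φ₀)
    (fun q ih g => ψ (K - 1 - q) q (ih (Fin.init g)) (g (Fin.last q)).1 (g (Fin.last q)).2) q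
  have hst : ∀ q g c j, st (q + 1) (Fin.snoc g (c, j)) = ψ (K - 1 - q) q (st q g) c j := by
    intro q g c j
    change ψ (K - 1 - q) q (st q (Fin.init (Fin.snoc g (c, j) : Fin (q + 1) → ιA × ιB))) _ _ = _
    rw [Fin.init_snoc, Fin.snoc_last]
  have hmem : ∀ q g, q ≤ K → st q g ∈ guaranteed τ T D G (K - q) q := by
    intro q
    induction q with
    | zero => intro g _; exact hφ₀
    | succ q ih =>
      intro g hq
      have h1 := ih (Fin.init g) (by omega)
      rw [show K - q = (K - 1 - q) + 1 by omega] at h1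
      rw [show K - (q + 1) = K - 1 - q by omega]
      exact (hle _ _ _ h1).1 _ _
  refine ⟨st, fun q g => ν (K - 1 - q) q (st q g), rfl, hmem, fun _ _ _ => hν _ _ _ _,
    fun _ _ => hs _ _ _, fun q g hq c x => ?_⟩
  have h1 := hmem q g hq.le
  rw [show K - q = (K - 1 - q) + 1 by omega] at h1
  simp only [hst]
  exact (hle _ _ _ h1).2 c x

omit [Nonempty A] in
/-- Guaranteed functions are guaranteed by behaviour strategies of player 2. -/
theorem IsGrid.exists_strategy2 (hg : IsGrid t T η K τ) (hf : IsPayoff f C)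
    {a : ιA → A} {b : ιB → B} {κA : A → ιA} {κB : B → ιB} (hκA : Measurable κA)
    (hκB : Measurable κB) (hb : ∀ j, κB (b j) = j) {e : Ed d → ℝ}
    (he : ∀ q < K, ∀ x u j, f (τ q) x (a (κA u)) (b j) - e x ≤ f (τ q) x u (b j))
    (hD : 0 ≤ D) {φ₀ : Ed d → ℝ}
    (hφ₀ : φ₀ ∈ guaranteed τ T D (fun q c j x => f (τ q) x (a c) (b j) - e x) K 0) :
    ∃ τs, IsStrategy2 d τs ∧ ∀ σs, IsStrategy1 d σs → ∀ x,
      φ₀ x ≤ stageVal d f τ σs τs K 0 (fun i => i.elim0) x := by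
  classical
  obtain ⟨st, ν, hst0, hst, hν, hνs, hle⟩ := exists_mixed_response K hφ₀
    (κB (Classical.arbitrary B))
  let code : (q : ℕ) → (Fin q → A × B) → Fin q → ιA × ιB := fun q h i => (κA (h i).1, κB (h i).2)
  let τs : (q : ℕ) → (Fin q → A × B) → Measure B := fun q h =>
    ∑ j, ENNReal.ofReal (ν q (code q h) j) • Measure.dirac (b j)
  have hτs : IsStrategy2 d τs := by
    refine fun q => ⟨fun h => ⟨?_⟩, ?_⟩
    · simp only [τs, Measure.coe_finsetSum, Finset.sum_apply, Measure.smul_apply, measure_univ,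
        smul_eq_mul, mul_one]
      rw [← ENNReal.ofReal_sum_of_nonneg fun j _ => hν _ _ _, hνs, ENNReal.ofReal_one]
    · have h1 : Measurable fun g : Fin q → ιA × ιB =>
          ∑ j, ENNReal.ofReal (ν q g j) • Measure.dirac (b j) := measurable_of_finite _
      refine h1.comp (measurable_pi_iff.2 fun i => ?_)
      exact (hκA.comp (measurable_fst.comp (measurable_pi_apply i))).prodMk
        (hκB.comp (measurable_snd.comp (measurable_pi_apply i)))
  refine ⟨τs, hτs, fun σs hσs => ?_⟩
  have main : ∀ k q, q + k = K → ∀ (h : Fin q → Ed d × A × B) x,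
      st q (code q fun i => ((h i).2.1, (h i).2.2)) x ≤ stageVal d f τ σs τs k q h x := by
    intro k
    induction k with
    | zero =>
      intro q hq h x
      have := hst q (code q fun i => ((h i).2.1, (h i).2.2)) (by omega)
      rw [show K - q = 0 by omega, guaranteed, mem_singleton_iff] at this
      rw [this]
      exact le_rfl
    | succ k ih =>
      intro q hq h x
      have hr := hg.stageRegular hf hσs hτs k (q + 1) (by omega)
      have hΔ := (hg.lt q (by omega)).le
      rw [hr.stageVal_succ]
      set g := code q fun i => ((h i).2.1, (h i).2.2) with hgdef
      have hin : ∀ u, ∫ v, actionVal f τ σs τs k q h x u v ∂(τs q fun i => ((h i).2.1, (h i).2.2))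
          = ∑ j, ν q g j * actionVal f τ σs τs k q h x u (b j) := by
        intro u
        have hmeas : Measurable (actionVal f τ σs τs k q h x u) :=
          (hr.measurable_actionVal hf).comp (f := fun v : B => (((h, x), u), v)) (by fun_prop)
        have hint : ∀ j, Integrable (actionVal f τ σs τs k q h x u)
            (ENNReal.ofReal (ν q g j) • Measure.dirac (b j)) := fun j =>
          (integrable_of_abs_le hmeas (hr.abs_actionVal_le hf hΔ h x u)).smul_measure
            ENNReal.ofReal_ne_top
        rw [integral_finsetSum_measure fun j _ => hint j]
        refine Finset.sum_congr rfl fun j _ => ?_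
        rw [integral_smul_measure, integral_dirac' _ _ hmeas.stronglyMeasurable,
          ENNReal.toReal_ofReal (hν _ _ _), smul_eq_mul]
      have hlow : ∀ u, st q g x ≤ ∫ v, actionVal f τ σs τs k q h x u v
          ∂(τs q fun i => ((h i).2.1, (h i).2.2)) := by
        intro u
        rw [hin]
        refine (hle q g (by omega) (κA u) x).trans (Finset.sum_le_sum fun j _ =>
          mul_le_mul_of_nonneg_left (add_le_add (mul_le_mul_of_nonneg_left
            (he q (by omega) x u j) (sub_nonneg.2 hΔ)) ?_) (hν _ _ _))
        have hmem := hst (q + 1) (Fin.snoc g (κA u, j)) (by omega)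
        refine heatOp_mono (measurable_of_mem_guaranteed hmem) (abs_le_of_mem_guaranteed hD
          (hg.mem_Icc (q := q + 1) (by omega)).2 hmem) (hr.meas_right _) (hr.bdd _) (fun y => ?_) _ _
        refine le_trans (le_of_eq ?_) (ih (q + 1) (by omega) (Fin.snoc h (x, u, b j)) y)
        congr 1
        funext i
        refine Fin.lastCases ?_ (fun i => ?_) i
        · simp [code, hb]
        · simp [code, hgdef]
      have hp := (hσs q).1 h x
      have hconst : st q g x = ∫ _, st q g x ∂(σs q h x) := by simp
      rw [hconst]
      refine integral_mono (integrable_const _) (integrable_of_abs_le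
        (K := C * (τ (q + 1) - τ q) + C * (T - τ (q + 1))) ?_ fun u => ?_) hlow
      · exact (hr.measurable_integral_actionVal hf hτs).comp (f := fun u : A => ((h, x), u))
          (by fun_prop)
      · have := (hτs q).1 fun i => ((h i).2.1, (h i).2.2)
        exact abs_integral_le_of_abs_le fun v => hr.abs_actionVal_le hf hΔ h x u v
  intro x
  have := main K 0 (by omega) (fun i => i.elim0) x
  rwa [show (code 0 fun i => _) = fun i : Fin 0 => i.elim0 from funext fun i => i.elim0, hst0] at this

end Extraction

section Split

variable {X : Type*} [MeasurableSpace X] {ι : Type} [Fintype ι] {μ : Measure X} {w : ι → X → ℝ}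
  {p : ι → ℝ} {ν : ι → Measure X}

/-- The law `μ` is the barycenter of the posteriors `ν c`, with weights `p c`, induced by the
type-dependent lottery `w`. -/
structure IsSplit (μ : Measure X) (w : ι → X → ℝ) (p : ι → ℝ) (ν : ι → Measure X) : Prop where
  nonneg : ∀ c, 0 ≤ p c
  sum_p : ∑ c, p c = 1
  prob : ∀ c, IsProbabilityMeasure (ν c)
  sum_w : ∀ x, ∑ c, w c x = 1
  integrable : ∀ φ : X → ℝ, Integrable φ μ → ∀ c, Integrable φ (ν c)
  integrable_mul : ∀ φ : X → ℝ, Integrable φ μ → ∀ c, Integrable (fun x => w c x * φ x) μ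
  integral : ∀ (φ : X → ℝ) c, ∫ x, w c x * φ x ∂μ = p c * ∫ x, φ x ∂(ν c)

theorem IsSplit.sum_integral (h : IsSplit μ w p ν) {φ : X → ℝ} (hφ : Integrable φ μ) :
    ∑ c, p c * ∫ x, φ x ∂(ν c) = ∫ x, φ x ∂μ := by
  simp only [← h.integral]
  rw [← integral_finsetSum _ fun c _ => h.integrable_mul φ hφ c]
  refine integral_congr_ae (ae_of_all _ fun x => ?_)
  simp only [← Finset.sum_mul, h.sum_w, one_mul]

theorem exists_isSplit [IsProbabilityMeasure μ] (hw : ∀ c, Measurable (w c))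
    (hpos : ∀ c x, 0 < w c x) (hsum : ∀ x, ∑ c, w c x = 1) : ∃ p ν, IsSplit μ w p ν := by
  have hle : ∀ c x, w c x ≤ 1 := fun c x => by
    rw [← hsum x]
    exact Finset.single_le_sum (fun c _ => (hpos c x).le) (Finset.mem_univ c)
  have habs : ∀ c x, |w c x| ≤ 1 := fun c x => by
    rw [abs_of_pos (hpos c x)]
    exact hle c x
  have hint : ∀ c, Integrable (w c) μ := fun c => integrable_of_abs_le (hw c) (habs c)
  let p : ι → ℝ := fun c => ∫ x, w c x ∂μ
  have hp : ∀ c, 0 < p c := fun c =>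
    (integral_pos_iff_support_of_nonneg (fun x => (hpos c x).le) (hint c)).2 (by
      rw [Function.support_eq_univ fun x => (hpos c x).ne', measure_univ]
      exact one_pos)
  have hmeas : ∀ c, Measurable fun x => (w c x / p c).toNNReal := fun c =>
    ((hw c).div_const _).real_toNNReal
  have hco : ∀ c x, (((w c x / p c).toNNReal : ℝ≥0) : ℝ) = w c x / p c := fun c x =>
    Real.coe_toNNReal _ (div_nonneg (hpos c x).le (hp c).le)
  have hmul : ∀ φ : X → ℝ, Integrable φ μ → ∀ c, Integrable (fun x => w c x * φ x) μ := by
    intro φ hφ c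
    exact hφ.bdd_mul (hw c).aestronglyMeasurable (c := 1) (ae_of_all _ fun x => habs c x)
  have hintegral : ∀ (φ : X → ℝ) c, ∫ x, w c x * φ x ∂μ
      = p c * ∫ x, φ x ∂(μ.withDensity fun x => ((w c x / p c).toNNReal : ℝ≥0∞)) := by
    intro φ c
    rw [integral_withDensity_eq_integral_smul (hmeas c), ← integral_const_mul]
    refine integral_congr_ae (ae_of_all _ fun x => ?_)
    simp only [NNReal.smul_def, hco, smul_eq_mul]
    field_simp [(hp c).ne']
  refine ⟨p, fun c => μ.withDensity fun x => ((w c x / p c).toNNReal : ℝ≥0∞), fun c => (hp c).le,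
    ?_, fun c => ⟨?_⟩, hsum, fun φ hφ c => ?_, hmul, hintegral⟩
  · rw [← integral_finsetSum _ fun c _ => hint c]
    simp [hsum]
  · rw [withDensity_apply _ MeasurableSet.univ, setLIntegral_univ]
    have : ∫⁻ x, ((w c x / p c).toNNReal : ℝ≥0∞) ∂μ = ENNReal.ofReal (∫ x, w c x / p c ∂μ) :=
      (ofReal_integral_eq_lintegral_ofReal ((hint c).div_const _)
        (ae_of_all _ fun x => div_nonneg (hpos c x).le (hp c).le)).symm
    rw [this, integral_div, div_self (hp c).ne', ENNReal.ofReal_one]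
  · rw [integrable_withDensity_iff_integrable_smul (hmeas c)]
    refine ((hmul φ hφ c).const_mul (p c)⁻¹).congr (ae_of_all _ fun x => ?_)
    simp only [NNReal.smul_def, hco, smul_eq_mul]
    field_simp

theorem IsSplit.memP {d : ℕ} {μ : Measure (Ed d)} {w : ι → Ed d → ℝ} {ν : ι → Measure (Ed d)}
    (h : IsSplit μ w p ν) (hμ : MemP d 2 μ) (c : ι) : MemP d 2 (ν c) := by
  rw [memP_two_iff] at hμ ⊢
  exact ⟨h.prob c, h.integrable _ hμ.2 c⟩

end Split

section Net

variable {d : ℕ} {A B : Type} [MetricSpace A] [CompactSpace A] [Nonempty A]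
  [MeasurableSpace A] [BorelSpace A]
  [MetricSpace B] [CompactSpace B] [Nonempty B] [MeasurableSpace B] [BorelSpace B]
  {f : ℝ → Ed d → A → B → ℝ} {C T ε : ℝ}

/-- The error made by replacing actions by elements of a finite net. -/
def netErr (C ε : ℝ) (x : Ed d) : ℝ := min (2 * C) (ε * (1 + ‖x‖ ^ 2))

theorem measurable_netErr : Measurable (netErr (d := d) C ε) :=
  (Continuous.min (by fun_prop) (by fun_prop)).measurable

theorem netErr_nonneg (hC : 0 ≤ C) (hε : 0 ≤ ε) (x : Ed d) : 0 ≤ netErr C ε x :=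
  le_min (by positivity) (by positivity)

theorem abs_netErr_le (hC : 0 ≤ C) (hε : 0 ≤ ε) (x : Ed d) : |netErr C ε x| ≤ 2 * C := by
  rw [abs_of_nonneg (netErr_nonneg hC hε x)]
  exact min_le_left _ _

theorem integrable_netErr (hC : 0 ≤ C) (hε : 0 ≤ ε) (μ : Measure (Ed d)) [IsFiniteMeasure μ] :
    Integrable (netErr C ε) μ :=
  integrable_of_abs_le measurable_netErr (abs_netErr_le hC hε)

theorem integral_netErr_le (hC : 0 ≤ C) (hε : 0 ≤ ε) {μ : Measure (Ed d)} (hμ : MemP d 2 μ) :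
    ∫ x, netErr C ε x ∂μ ≤ ε * (1 + ∫ x, ‖x‖ ^ 2 ∂μ) := by
  rw [memP_two_iff] at hμ
  have := hμ.1
  have h : Integrable (fun x : Ed d => 1 + ‖x‖ ^ 2) μ := (integrable_const _).add hμ.2
  calc ∫ x, netErr C ε x ∂μ ≤ ∫ x, ε * (1 + ‖x‖ ^ 2) ∂μ :=
        integral_mono (integrable_netErr hC hε μ) (h.const_mul ε) fun x => min_le_right _ _
    _ = _ := by
        rw [integral_const_mul, integral_add (integrable_const _) hμ.2]
        simp

/-- Finite nets of actions, with measurable projections. -/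
structure IsNet (f : ℝ → Ed d → A → B → ℝ) (C T ε : ℝ) {FA : Finset A} {FB : Finset B}
    (κA : A → FA) (κB : B → FB) : Prop where
  measA : Measurable κA
  measB : Measurable κB
  sectionA : ∀ c : FA, κA c = c
  sectionB : ∀ j : FB, κB j = j
  left : ∀ s ∈ Icc 0 T, ∀ x u v, |f s x u v - f s x (κA u) v| ≤ netErr C ε x
  right : ∀ s ∈ Icc 0 T, ∀ x u v, |f s x u v - f s x u (κB v)| ≤ netErr C ε x
  both : ∀ s ∈ Icc 0 T, ∀ x u v, |f s x u v - f s x (κA u) (κB v)| ≤ netErr C ε x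

theorem IsPayoff.exists_isNet (hf : IsPayoff f C) (T : ℝ) (hε : 0 < ε) :
    ∃ (FA : Finset A) (FB : Finset B) (κA : A → FA) (κB : B → FB),
      FA.Nonempty ∧ FB.Nonempty ∧ IsNet f C T ε κA κB := by
  obtain ⟨δ, hδ, hmod⟩ := hf.exists_modulus T hε
  obtain ⟨FA, hA, κA, hκA, hsA, hdA⟩ := exists_finite_net (X := A) hδ
  obtain ⟨FB, hB, κB, hκB, hsB, hdB⟩ := exists_finite_net (X := B) hδ
  have h2C : ∀ s (x : Ed d) u v u' v', |f s x u v - f s x u' v'| ≤ 2 * C :=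
    fun s x u v u' v' => by
      have := abs_sub (f s x u v) (f s x u' v')
      linarith [hf.bdd s x u v, hf.bdd s x u' v']
  refine ⟨FA, FB, κA, κB, hA, hB, hκA, hκB, hsA, hsB, fun s hs x u v => le_min (h2C _ _ _ _ _ _) ?_,
    fun s hs x u v => le_min (h2C _ _ _ _ _ _) ?_, fun s hs x u v => le_min (h2C _ _ _ _ _ _) ?_⟩
  · exact hmod s hs x _ _ _ _ (hdA u) (by rwa [dist_self])
  · exact hmod s hs x _ _ _ _ (by rwa [dist_self]) (hdB v)
  · exact hmod s hs x _ _ _ _ (hdA u) (hdB v)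

end Net

section Energy

variable {d : ℕ} {A B : Type} [MetricSpace A] [CompactSpace A] [Nonempty A]
  [MetricSpace B] [CompactSpace B] [Nonempty B]
  {f : ℝ → Ed d → A → B → ℝ} {C : ℝ} {μ : Measure (Ed d)}

/-- The integral of the payoff regularized in space at scale `h`. -/
def smoothed (f : ℝ → Ed d → A → B → ℝ) (h s : ℝ) (μ : Measure (Ed d)) (i : A × B) : ℝ :=
  ∫ x, heatOp h (fun y => f s y i.1 i.2) x ∂μ

/-- The quadratic energy of the regularized payoffs over finite sets of actions. -/
def energy (f : ℝ → Ed d → A → B → ℝ) (F : Finset (A × B)) (h s : ℝ) (μ : Measure (Ed d)) : ℝ :=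
  ∑ i ∈ F, smoothed f h s μ i ^ 2

omit [CompactSpace A] [Nonempty A] [CompactSpace B] [Nonempty B] in
theorem IsPayoff.abs_smoothed_le (hf : IsPayoff f C) [IsProbabilityMeasure μ] (h s : ℝ)
    (i : A × B) : |smoothed f h s μ i| ≤ C :=
  abs_integral_le_of_abs_le fun _ => abs_heatOp_le (fun _ => hf.bdd _ _ _ _) _ _

omit [CompactSpace A] [Nonempty A] [CompactSpace B] [Nonempty B] in
theorem IsPayoff.integrable_heatOp (hf : IsPayoff f C) [IsFiniteMeasure μ] (h s : ℝ)
    (u : A) (v : B) : Integrable (heatOp h fun y => f s y u v) μ :=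
  integrable_of_abs_le (measurable_heatOp (hf.measurable_space s u v) h) fun _ =>
    abs_heatOp_le (fun _ => hf.bdd _ _ _ _) _ _

omit [CompactSpace A] [Nonempty A] [CompactSpace B] [Nonempty B] in
theorem IsPayoff.lip_space (hf : IsPayoff f C) (s : ℝ) (u : A) (v : B) (x y : Ed d) :
    |f s x u v - f s y u v| ≤ C * ‖x - y‖ := by
  simpa using hf.lip u v s s x y

omit [CompactSpace A] [Nonempty A] [CompactSpace B] [Nonempty B] in
theorem IsPayoff.abs_integral_sub_smoothed_le (hf : IsPayoff f C) [IsProbabilityMeasure μ]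
    (h s : ℝ) (i : A × B) :
    |∫ x, f s x i.1 i.2 ∂μ - smoothed f h s μ i| ≤ C * (Real.sqrt h * gaussM1 d) := by
  unfold smoothed
  rw [← integral_sub (hf.integrable μ s _ _) (hf.integrable_heatOp h s _ _)]
  refine abs_integral_le_of_abs_le fun x => ?_
  have := abs_heatOp_sub_le (hf.lip_space s i.1 i.2) (hf.measurable_space s _ _)
    (fun y => hf.bdd _ _ _ _) 0 h x
  rwa [heatOp_zero, Real.sqrt_zero, zero_sub, abs_neg, abs_of_nonneg (Real.sqrt_nonneg h)] at this

omit [CompactSpace A] [Nonempty A] [CompactSpace B] [Nonempty B] in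
theorem IsPayoff.energy_le (hf : IsPayoff f C) [IsProbabilityMeasure μ] (F : Finset (A × B))
    (h s : ℝ) : energy f F h s μ ≤ F.card * C ^ 2 := by
  rw [← nsmul_eq_mul]
  refine Finset.sum_le_card_nsmul _ _ _ fun i _ => ?_
  rw [← sq_abs]
  exact pow_le_pow_left₀ (abs_nonneg _) (hf.abs_smoothed_le h s i) 2

omit [CompactSpace A] [CompactSpace B] in
theorem IsPayoff.abs_smoothed_heatFlow_sub_le (hf : IsPayoff f C) [IsProbabilityMeasure μ]
    {h s r : ℝ} (hh : 0 < h) (hsr : s ≤ r) (i : A × B) :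
    |smoothed f h r (heatFlow d s r μ) i - smoothed f h s μ i|
      ≤ C * (gaussM1 d / Real.sqrt h + 1) * (r - s) := by
  have hC := hf.nonneg
  have hr := sub_nonneg.2 hsr
  have hsq := Real.sqrt_pos.2 hh
  unfold smoothed
  rw [integral_heatFlow (measurable_heatOp (hf.measurable_space r _ _) h)
    (fun x => abs_heatOp_le (fun y => hf.bdd _ _ _ _) _ _),
    heatOp_heatOp (hf.measurable_space r _ _) (fun y => hf.bdd _ _ _ _) hr hh.le,
    ← integral_sub (hf.integrable_heatOp _ _ _ _) (hf.integrable_heatOp _ _ _ _)]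
  refine abs_integral_le_of_abs_le fun x => ?_
  have h1 := abs_heatOp_sub_le (hf.lip_space r i.1 i.2) (hf.measurable_space r _ _)
    (fun y => hf.bdd _ _ _ _) (r - s + h) h x
  have h2 : |heatOp h (fun y => f r y i.1 i.2) x - heatOp h (fun y => f s y i.1 i.2) x|
      ≤ C * (r - s) := by
    have hi : ∀ s', Integrable (fun z => f s' (x + Real.sqrt h • z) i.1 i.2) (stdG d) := fun s' =>
      integrable_of_abs_le ((hf.measurable_space s' i.1 i.2).comp
        (by fun_prop : Measurable fun z : Ed d => x + Real.sqrt h • z)) fun _ => hf.bdd _ _ _ _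
    unfold heatOp
    rw [← integral_sub (hi r) (hi s)]
    refine abs_integral_le_of_abs_le fun z => ?_
    simpa [abs_of_nonneg hr] using hf.lip i.1 i.2 r s (x + Real.sqrt h • z) (x + Real.sqrt h • z)
  have h3 : |Real.sqrt (r - s + h) - Real.sqrt h| ≤ (r - s) / Real.sqrt h := by
    have h4 : Real.sqrt h ≤ Real.sqrt (r - s + h) := Real.sqrt_le_sqrt (by linarith)
    rw [abs_of_nonneg (sub_nonneg.2 h4), le_div_iff₀ hsq]
    nlinarith [Real.mul_self_sqrt hh.le, Real.mul_self_sqrt (show 0 ≤ r - s + h by linarith)]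
  calc _ ≤ C * (|Real.sqrt (r - s + h) - Real.sqrt h| * gaussM1 d) + C * (r - s) :=
        (abs_sub_le _ _ _).trans (add_le_add h1 h2)
    _ ≤ C * ((r - s) / Real.sqrt h * gaussM1 d) + C * (r - s) := by
        have := gaussM1_nonneg d
        gcongr
    _ = _ := by ring

omit [CompactSpace A] [CompactSpace B] in
theorem IsPayoff.energy_sub_le (hf : IsPayoff f C) [IsProbabilityMeasure μ] (F : Finset (A × B))
    {h s r : ℝ} (hh : 0 < h) (hsr : s ≤ r) :
    energy f F h s μ - F.card * (2 * C * (C * (gaussM1 d / Real.sqrt h + 1))) * (r - s)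
      ≤ energy f F h r (heatFlow d s r μ) := by
  rw [sub_le_iff_le_add, ← sub_le_iff_le_add']
  unfold energy
  rw [← Finset.sum_sub_distrib, mul_assoc, ← nsmul_eq_mul]
  refine Finset.sum_le_card_nsmul _ _ _ fun i _ => ?_
  have h1 := abs_le.1 (hf.abs_smoothed_heatFlow_sub_le (μ := μ) hh hsr i)
  have h2 := abs_le.1 (hf.abs_smoothed_le (μ := μ) h s i)
  have h3 := abs_le.1 (hf.abs_smoothed_le (μ := heatFlow d s r μ) h r i)
  generalize smoothed f h r (heatFlow d s r μ) i = a at *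
  generalize smoothed f h s μ i = b at *
  generalize C * (gaussM1 d / Real.sqrt h + 1) = D at *
  have h4 : |(b - a) * (b + a)| ≤ D * (r - s) * (2 * C) := by
    rw [abs_mul]
    refine mul_le_mul ?_ ?_ (abs_nonneg _) (by linarith) <;> rw [abs_le] <;>
      constructor <;> linarith
  have h5 := (abs_le.1 h4).2
  calc b ^ 2 - a ^ 2 = (b - a) * (b + a) := by ring
    _ ≤ D * (r - s) * (2 * C) := h5
    _ = _ := by ring

omit [CompactSpace A] [Nonempty A] [CompactSpace B] [Nonempty B] in
/-- Splitting the law costs energy in proportion to the displacement of the posteriors. -/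
theorem IsSplit.sum_displacement_le (hf : IsPayoff f C) [IsProbabilityMeasure μ] {ι : Type}
    [Fintype ι] {w : ι → Ed d → ℝ} {p : ι → ℝ} {ν : ι → Measure (Ed d)} (hsp : IsSplit μ w p ν)
    (F : Finset (A × B)) {h s r β : ℝ} (hβ : 0 < β) :
    r * (2 * ∑ c, p c * ∑ i ∈ F, |smoothed f h s (ν c) i - smoothed f h s μ i|)
      ≤ F.card * (r ^ 2 / β) + β * (∑ c, p c * energy f F h s (ν c) - energy f F h s μ) := by
  have h1 : ∀ y : ℝ, 2 * r * |y| ≤ r ^ 2 / β + β * y ^ 2 := by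
    intro y
    rw [div_add' _ _ _ hβ.ne', le_div_iff₀ hβ, ← sq_abs y]
    linarith [show (r - β * |y|) ^ 2 = r ^ 2 - 2 * r * |y| * β + β * |y| ^ 2 * β by ring,
      sq_nonneg (r - β * |y|)]
  have hmean : ∀ i, ∑ c, p c * smoothed f h s (ν c) i = smoothed f h s μ i := fun i =>
    hsp.sum_integral (hf.integrable_heatOp h s i.1 i.2)
  have h2 : ∑ c, p c * energy f F h s (ν c) - energy f F h s μ
      = ∑ c, p c * ∑ i ∈ F, (smoothed f h s (ν c) i - smoothed f h s μ i) ^ 2 := by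
    have h3 : ∀ i, ∑ c, p c * smoothed f h s (ν c) i ^ 2 - smoothed f h s μ i ^ 2
        = ∑ c, p c * (smoothed f h s (ν c) i - smoothed f h s μ i) ^ 2 := by
      intro i
      have h4 : ∀ c, p c * (smoothed f h s (ν c) i - smoothed f h s μ i) ^ 2
          = p c * smoothed f h s (ν c) i ^ 2
            - 2 * smoothed f h s μ i * (p c * smoothed f h s (ν c) i)
            + p c * smoothed f h s μ i ^ 2 := fun c => by ring
      simp only [h4]
      rw [Finset.sum_add_distrib, Finset.sum_sub_distrib, ← Finset.mul_sum, hmean,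
        ← Finset.sum_mul, hsp.sum_p]
      ring
    unfold energy
    simp only [Finset.mul_sum]
    rw [Finset.sum_comm, ← Finset.sum_sub_distrib, Finset.sum_comm (s := Finset.univ)]
    exact Finset.sum_congr rfl fun i _ => h3 i
  rw [h2]
  calc _ = ∑ c, p c * ∑ i ∈ F, 2 * r * |smoothed f h s (ν c) i - smoothed f h s μ i| := by
        simp only [Finset.mul_sum]
        refine Finset.sum_congr rfl fun c _ => Finset.sum_congr rfl fun i _ => ?_
        ring
    _ ≤ ∑ c, p c * ∑ i ∈ F,
          (r ^ 2 / β + β * (smoothed f h s (ν c) i - smoothed f h s μ i) ^ 2) :=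
        Finset.sum_le_sum fun c _ => mul_le_mul_of_nonneg_left
          (Finset.sum_le_sum fun i _ => h1 _) (hsp.nonneg c)
    _ = _ := by
        simp only [Finset.sum_add_distrib, Finset.sum_const, nsmul_eq_mul, mul_add]
        rw [← Finset.sum_mul, hsp.sum_p, one_mul, Finset.mul_sum]
        congr 1
        refine Finset.sum_congr rfl fun c _ => ?_
        rw [← Finset.mul_sum]
        ring

end Energy

section OneStep

variable {d : ℕ} {A B : Type} [MetricSpace A] [CompactSpace A] [Nonempty A]
  [MeasurableSpace A] [BorelSpace A]
  [MetricSpace B] [CompactSpace B] [Nonempty B] [MeasurableSpace B] [BorelSpace B]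
  {f : ℝ → Ed d → A → B → ℝ} {C T ε : ℝ} {FA : Finset A} {FB : Finset B} {κA : A → FA}
  {κB : B → FB} {μ ν : Measure (Ed d)}

/-- The displacement of the regularized payoffs from `μ` to `ν`. -/
def displacement (f : ℝ → Ed d → A → B → ℝ) (F : Finset (A × B)) (h s : ℝ)
    (μ ν : Measure (Ed d)) : ℝ :=
  ∑ i ∈ F, |smoothed f h s ν i - smoothed f h s μ i|

omit [CompactSpace A] [Nonempty A] [MeasurableSpace A] [BorelSpace A] [CompactSpace B]
  [Nonempty B] [MeasurableSpace B] [BorelSpace B] in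
theorem IsPayoff.abs_integral_sub_le_displacement (hf : IsPayoff f C) [IsProbabilityMeasure μ]
    [IsProbabilityMeasure ν] {F : Finset (A × B)} (h s : ℝ) {i : A × B} (hi : i ∈ F) :
    |∫ x, f s x i.1 i.2 ∂ν - ∫ x, f s x i.1 i.2 ∂μ|
      ≤ displacement f F h s μ ν + 2 * (C * (Real.sqrt h * gaussM1 d)) := by
  have h1 := abs_le.1 (hf.abs_integral_sub_smoothed_le (μ := μ) h s i)
  have h2 := abs_le.1 (hf.abs_integral_sub_smoothed_le (μ := ν) h s i)
  have h3 : |smoothed f h s ν i - smoothed f h s μ i| ≤ displacement f F h s μ ν :=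
    Finset.single_le_sum (f := fun i => |smoothed f h s ν i - smoothed f h s μ i|)
      (fun _ _ => abs_nonneg _) hi
  rw [abs_le] at h3 ⊢
  constructor <;> linarith

theorem integral_le_add_netErr {φ ψ : Ed d → ℝ} [IsProbabilityMeasure μ] (hC : 0 ≤ C) (hε : 0 ≤ ε)
    (hφ : Integrable φ μ) (hψ : Integrable ψ μ) (h : ∀ x, |φ x - ψ x| ≤ netErr C ε x) :
    ∫ x, φ x ∂μ ≤ ∫ x, ψ x ∂μ + ∫ x, netErr C ε x ∂μ := by
  rw [← integral_add hψ (integrable_netErr hC hε μ)]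
  refine integral_mono hφ (hψ.add (integrable_netErr hC hε μ)) fun x => ?_
  have := (abs_le.1 (h x)).2
  dsimp only
  linarith

omit [CompactSpace A] [BorelSpace A] [CompactSpace B] [BorelSpace B] in
theorem IsNet.hamiltonian_le (hN : IsNet f C T ε κA κB) (hf : IsPayoff f C) (hε : 0 ≤ ε)
    [IsProbabilityMeasure μ] [IsProbabilityMeasure ν] (h : ℝ) {s : ℝ} (hs : s ∈ Icc 0 T) :
    hamiltonian f s ν ≤ hamiltonian f s μ + (displacement f (FA ×ˢ FB) h s μ ν
      + 2 * (C * (Real.sqrt h * gaussM1 d)) + ∫ x, netErr C ε x ∂ν + ∫ x, netErr C ε x ∂μ) := by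
  refine hf.hamiltonian_le_add _ _ fun u v => ?_
  have h1 := integral_le_add_netErr hf.nonneg hε (hf.integrable ν s u v)
    (hf.integrable ν s (κA u) (κB v)) fun x => hN.both s hs x u v
  have h2 := integral_le_add_netErr hf.nonneg hε (hf.integrable μ s (κA u) (κB v))
    (hf.integrable μ s u v) fun x => (abs_sub_comm _ _).trans_le (hN.both s hs x u v)
  have h3 := (abs_le.1 (hf.abs_integral_sub_le_displacement (μ := μ) (ν := ν) (F := FA ×ˢ FB) h s
    (i := ((κA u : A), (κB v : B))) (Finset.mk_mem_product (κA u).2 (κB v).2))).2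
  linarith

omit [CompactSpace A] [MeasurableSpace A] [BorelSpace A] [CompactSpace B] [MeasurableSpace B]
  [BorelSpace B] in
theorem integral_hamiltonian_heatFlow_le (hf : IsPayoff f C) (hν : MemP d 2 ν) {s r : ℝ}
    (hsr : s ≤ r) :
    ∫ s' in Icc s r, hamiltonian f s' (heatFlow d s s' ν)
      ≤ (r - s) * (hamiltonian f s ν + C * (gaussM1 d * Real.sqrt (r - s) + (r - s))) := by
  have hC := hf.nonneg
  have hg := gaussM1_nonneg d
  set D := hamiltonian f s ν + C * (gaussM1 d * Real.sqrt (r - s) + (r - s)) with hD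
  have h1 : ∫ s' in Icc s r, hamiltonian f s' (heatFlow d s s' ν) ≤ ∫ _ in Icc s r, D := by
    refine setIntegral_mono_on (rightRegular_heatFlow hf hν s r).integrableOn
      (integrableOn_const (by simp)) measurableSet_Icc fun s' hs' => ?_
    have h2 := (abs_le.1 (hf.abs_hamiltonian_sub_le (hν.heatFlow_two s s').memP_one hν.memP_one
      s' s)).2
    have := hν.1
    have h3 := wdist_heatFlow_le ν s s' s
    rw [heatFlow_self, sub_self, Real.sqrt_zero, sub_zero, abs_of_nonneg (Real.sqrt_nonneg _)] at h3
    have h4 : Real.sqrt (s' - s) ≤ Real.sqrt (r - s) := Real.sqrt_le_sqrt (by linarith [hs'.2])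
    have h5 : wdist d 1 (heatFlow d s s' ν) ν + |s' - s|
        ≤ gaussM1 d * Real.sqrt (r - s) + (r - s) := by
      rw [abs_of_nonneg (sub_nonneg.2 hs'.1)]
      nlinarith [mul_le_mul_of_nonneg_right h4 hg, hs'.2]
    have h6 := mul_le_mul_of_nonneg_left h5 hC
    rw [hD]
    linarith
  refine h1.trans_eq ?_
  simp [hsr]

omit [CompactSpace A] [BorelSpace A] [CompactSpace B] [BorelSpace B] in
theorem IsNet.exists_action2 (hN : IsNet f C T ε κA κB) (hf : IsPayoff f C) (hε : 0 ≤ ε)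
    [IsProbabilityMeasure μ] {s δ : ℝ} (hs : s ∈ Icc 0 T) (hδ : 0 < δ)
    (hI : (⨅ u : A, ⨆ v : B, ∫ x, f s x u v ∂μ) = ⨆ v : B, ⨅ u : A, ∫ x, f s x u v ∂μ) :
    ∃ j : FB, ∀ u : A, hamiltonian f s μ ≤ ∫ x, f s x u j ∂μ + ∫ x, netErr C ε x ∂μ + δ := by
  have h1 : hamiltonian f s μ - δ < ⨆ v : B, ⨅ u : A, ∫ x, f s x u v ∂μ := by
    rw [← hI]
    exact sub_lt_self _ hδ
  obtain ⟨v, hv⟩ := exists_lt_of_lt_ciSup h1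
  refine ⟨κB v, fun u => ?_⟩
  have h2 : ⨅ u : A, ∫ x, f s x u v ∂μ ≤ ∫ x, f s x u v ∂μ :=
    ciInf_le ⟨-C, by rintro _ ⟨u, rfl⟩; exact (abs_le.1 (hf.abs_integral_le μ s u v)).1⟩ u
  have h3 := integral_le_add_netErr hf.nonneg hε (hf.integrable μ s u v)
    (hf.integrable μ s u (κB v)) fun x => hN.right s hs x u v
  linarith

omit [BorelSpace A] [BorelSpace B] in
/-- Isaacs' condition turns the dynamic programming inequality into a statement about the splitting
induced by the actions of player 1 against a fixed action of player 2. -/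
theorem IsNet.exists_gameValue_le (hN : IsNet f C T ε κA κB) (hf : IsPayoff f C) (hε : 0 ≤ ε)
    (hμ : MemP d 2 μ) {w : FA → Ed d → ℝ} {p : FA → ℝ} {ν : FA → Measure (Ed d)}
    (hsp : IsSplit μ w p ν) {s r δ : ℝ} (hs : 0 ≤ s) (hsr : s < r) (hrT : r ≤ T) (hδ : 0 < δ)
    (hI : (⨅ u : A, ⨆ v : B, ∫ x, f s x u v ∂μ) = ⨆ v : B, ⨅ u : A, ∫ x, f s x u v ∂μ) (h : ℝ) :
    ∃ j : FB, gameValue d f T s μ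
      ≤ ∑ c, p c * ((r - s) * ∫ x, (f s x c j - netErr C ε x) ∂(ν c)
          + gameValue d f T r (heatFlow d s r (ν c)))
        + (r - s) * (4 * ∫ x, netErr C ε x ∂μ + δ + 4 * (C * (Real.sqrt h * gaussM1 d))
          + C * (gaussM1 d * Real.sqrt (r - s) + (r - s)))
        + (r - s) * (2 * ∑ c, p c * displacement f (FA ×ˢ FB) h s μ (ν c)) := by
  have := hμ.1
  have hsT : s ∈ Icc 0 T := ⟨hs, hsr.le.trans hrT⟩
  obtain ⟨j, hj⟩ := hN.exists_action2 hf hε hsT hδ hI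
  refine ⟨j, ?_⟩
  have h1 := gameValue_le_sum hf hsp.nonneg hsp.sum_p (hsp.memP hμ) (μ := μ)
    (fun φ => (hsp.sum_integral (φ.integrable μ)).symm) hsr hrT
  refine h1.trans ?_
  have hE := hsp.sum_integral (integrable_netErr hf.nonneg hε μ)
  set ω := C * (gaussM1 d * Real.sqrt (r - s) + (r - s))
  set ρ := C * (Real.sqrt h * gaussM1 d)
  set E := ∫ x, netErr C ε x ∂μ
  have h2 : ∀ c : FA, p c * ((∫ s' in Icc s r, hamiltonian f s' (heatFlow d s s' (ν c)))
      + gameValue d f T r (heatFlow d s r (ν c)))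
      ≤ p c * ((r - s) * ∫ x, (f s x c j - netErr C ε x) ∂(ν c)
          + gameValue d f T r (heatFlow d s r (ν c)))
        + (r - s) * (p c * (2 * E + δ + 4 * ρ + ω) + 2 * (p c * ∫ x, netErr C ε x ∂(ν c))
          + 2 * (p c * displacement f (FA ×ˢ FB) h s μ (ν c))) := by
    intro c
    have := hsp.prob c
    have h3 := integral_hamiltonian_heatFlow_le hf (hsp.memP hμ c) hsr.le
    have h4 := hN.hamiltonian_le hf hε (μ := μ) (ν := ν c) h hsT
    have h5 := hj c
    have h6 := (abs_le.1 (hf.abs_integral_sub_le_displacement (μ := μ) (ν := ν c)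
      (F := FA ×ˢ FB) h s (i := ((c : A), (j : B))) (Finset.mk_mem_product c.2 j.2))).1
    have h7 : ∫ x, (f s x c j - netErr C ε x) ∂(ν c)
        = ∫ x, f s x c j ∂(ν c) - ∫ x, netErr C ε x ∂(ν c) :=
      integral_sub (hf.integrable _ _ _ _) (integrable_netErr hf.nonneg hε _)
    have h8 : hamiltonian f s (ν c) + ω ≤ ∫ x, (f s x c j - netErr C ε x) ∂(ν c)
        + (2 * E + δ + 4 * ρ + ω) + 2 * ∫ x, netErr C ε x ∂(ν c)
        + 2 * displacement f (FA ×ˢ FB) h s μ (ν c) := by linarith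
    have h9 := mul_le_mul_of_nonneg_left (h3.trans
      (mul_le_mul_of_nonneg_left h8 (sub_nonneg.2 hsr.le))) (hsp.nonneg c)
    linarith
  refine (Finset.sum_le_sum fun c _ => h2 c).trans_eq ?_
  rw [Finset.sum_add_distrib, ← Finset.mul_sum, Finset.sum_add_distrib, Finset.sum_add_distrib,
    ← Finset.sum_mul, hsp.sum_p, ← Finset.mul_sum, ← Finset.mul_sum, hE]
  ring

end OneStep

section Potential

variable {d : ℕ} {A B : Type} [MetricSpace A] [CompactSpace A] [Nonempty A]
  [MeasurableSpace A] [BorelSpace A]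
  [MetricSpace B] [CompactSpace B] [Nonempty B] [MeasurableSpace B] [BorelSpace B]
  {f : ℝ → Ed d → A → B → ℝ} {C T ε : ℝ} {FA : Finset A} {FB : Finset B} {κA : A → FA}
  {κB : B → FB} {μ : Measure (Ed d)}

/-- Expectation at time `s` of one plus the second moment at time `T`. -/
def momentAt (d : ℕ) (T s : ℝ) (μ : Measure (Ed d)) : ℝ :=
  1 + ∫ x, ‖x‖ ^ 2 ∂μ + gaussM2 d * (T - s)

/-- The game value, minus the cumulated errors of discretization. -/
def penalized (f : ℝ → Ed d → A → B → ℝ) (C T ε β h : ℝ) (F : Finset (A × B)) (s : ℝ)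
    (μ : Measure (Ed d)) : ℝ :=
  gameValue d f T s μ - 9 * ε * (T - s) * momentAt d T s μ - β * (F.card * C ^ 2 - energy f F h s μ)

theorem one_le_momentAt {s : ℝ} (hs : s ≤ T) : 1 + ∫ x, ‖x‖ ^ 2 ∂μ ≤ momentAt d T s μ :=
  le_add_of_nonneg_right (mul_nonneg (gaussM2_nonneg d) (sub_nonneg.2 hs))

theorem IsSplit.sum_momentAt {ι : Type} [Fintype ι] {w : ι → Ed d → ℝ} {p : ι → ℝ}
    {ν : ι → Measure (Ed d)} (hsp : IsSplit μ w p ν) (hμ : MemP d 2 μ) {s r : ℝ} (hsr : s ≤ r) :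
    ∑ c, p c * momentAt d T r (heatFlow d s r (ν c)) = momentAt d T s μ := by
  have h1 := hsp.sum_integral (memP_two_iff.1 hμ).2
  have h2 : ∀ c, p c * momentAt d T r (heatFlow d s r (ν c))
      = p c * ∫ x, ‖x‖ ^ 2 ∂(ν c) + p c * (1 + gaussM2 d * (T - s)) := by
    intro c
    unfold momentAt
    rw [integral_sq_heatFlow (hsp.memP hμ c) hsr]
    ring
  simp only [h2]
  rw [Finset.sum_add_distrib, h1, ← Finset.sum_mul, hsp.sum_p, momentAt]
  ring

omit [BorelSpace A] [BorelSpace B] in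
theorem IsNet.exists_penalized_le (hN : IsNet f C T ε κA κB) (hf : IsPayoff f C) (hε : 0 < ε)
    {β h : ℝ} (hβ : 0 < β) (hh : 0 < h) (hhε : 4 * (C * (Real.sqrt h * gaussM1 d)) ≤ ε)
    (hβε : β * ((FA ×ˢ FB).card * (2 * C * (C * (gaussM1 d / Real.sqrt h + 1)))) ≤ ε)
    (hμ : MemP d 2 μ) {w : FA → Ed d → ℝ} {p : FA → ℝ} {ν : FA → Measure (Ed d)}
    (hsp : IsSplit μ w p ν) {s r : ℝ} (hs : 0 ≤ s) (hsr : s < r) (hrT : r ≤ T)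
    (hrε : C * (gaussM1 d * Real.sqrt (r - s) + (r - s)) ≤ ε)
    (hrβ : (FA ×ˢ FB).card * ((r - s) / β) ≤ ε)
    (hI : (⨅ u : A, ⨆ v : B, ∫ x, f s x u v ∂μ) = ⨆ v : B, ⨅ u : A, ∫ x, f s x u v ∂μ) :
    ∃ j : FB, penalized f C T ε β h (FA ×ˢ FB) s μ
      ≤ ∑ c, p c * ((r - s) * ∫ x, (f s x c j - netErr C ε x) ∂(ν c)
          + penalized f C T ε β h (FA ×ˢ FB) r (heatFlow d s r (ν c))) := by
  have := hμ.1
  have hr := sub_pos.2 hsr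
  obtain ⟨j, hj⟩ := hN.exists_gameValue_le hf hε.le hμ hsp hs hsr hrT hε hI h
  refine ⟨j, ?_⟩
  have hdisp := hsp.sum_displacement_le hf (FA ×ˢ FB) (h := h) (s := s) (r := r - s) hβ
  have hmom := hsp.sum_momentAt (T := T) hμ hsr.le
  have hE := integral_netErr_le hf.nonneg hε.le hμ
  have hb := one_le_momentAt (μ := μ) (hsr.le.trans hrT)
  have hm0 : 0 ≤ ∫ x, ‖x‖ ^ 2 ∂μ := integral_nonneg fun x => by positivity
  have hen : β * ∑ c, p c * energy f (FA ×ˢ FB) h s (ν c)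
      ≤ β * ∑ c, p c * energy f (FA ×ˢ FB) h r (heatFlow d s r (ν c)) + ε * (r - s) := by
    have h1 : ∑ c, p c * energy f (FA ×ˢ FB) h s (ν c)
        ≤ ∑ c, p c * energy f (FA ×ˢ FB) h r (heatFlow d s r (ν c))
          + (FA ×ˢ FB).card * (2 * C * (C * (gaussM1 d / Real.sqrt h + 1))) * (r - s) := by
      generalize hK : (FA ×ˢ FB).card * (2 * C * (C * (gaussM1 d / Real.sqrt h + 1))) * (r - s) = K
      have hsumK : K = ∑ c, p c * K := by rw [← Finset.sum_mul, hsp.sum_p, one_mul]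
      rw [hsumK, ← Finset.sum_add_distrib]
      refine Finset.sum_le_sum fun c _ => ?_
      have := hsp.prob c
      rw [← mul_add]
      refine mul_le_mul_of_nonneg_left ?_ (hsp.nonneg c)
      rw [← sub_le_iff_le_add, ← hK]
      exact hf.energy_sub_le (μ := ν c) (FA ×ˢ FB) hh hsr.le
    have h2 := mul_le_mul_of_nonneg_left h1 hβ.le
    have h3 := mul_le_mul_of_nonneg_right hβε hr.le
    linarith
  have hq : (FA ×ˢ FB).card * ((r - s) ^ 2 / β) ≤ ε * (r - s) := by
    have := mul_le_mul_of_nonneg_right hrβ hr.le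
    calc _ = (FA ×ˢ FB).card * ((r - s) / β) * (r - s) := by ring
      _ ≤ _ := this
  have hsum : ∑ c, p c * ((r - s) * ∫ x, (f s x c j - netErr C ε x) ∂(ν c)
          + penalized f C T ε β h (FA ×ˢ FB) r (heatFlow d s r (ν c)))
      = ∑ c, p c * ((r - s) * ∫ x, (f s x c j - netErr C ε x) ∂(ν c)
          + gameValue d f T r (heatFlow d s r (ν c)))
        - 9 * ε * (T - r) * momentAt d T s μ - β * ((FA ×ˢ FB).card * C ^ 2)
        + β * ∑ c, p c * energy f (FA ×ˢ FB) h r (heatFlow d s r (ν c)) := by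
    rw [← hmom, Finset.mul_sum, Finset.mul_sum]
    have : β * ((FA ×ˢ FB).card * C ^ 2) = ∑ c, p c * (β * ((FA ×ˢ FB).card * C ^ 2)) := by
      rw [← Finset.sum_mul, hsp.sum_p, one_mul]
    rw [this, ← Finset.sum_sub_distrib, ← Finset.sum_sub_distrib, ← Finset.sum_add_distrib]
    refine Finset.sum_congr rfl fun c _ => ?_
    unfold penalized
    ring
  rw [hsum]
  unfold penalized
  have hfin : (r - s) * (4 * ∫ x, netErr C ε x ∂μ + ε + 4 * (C * (Real.sqrt h * gaussM1 d))
          + C * (gaussM1 d * Real.sqrt (r - s) + (r - s)))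
      ≤ 7 * ε * (r - s) * momentAt d T s μ := by
    have h1 : 4 * ∫ x, netErr C ε x ∂μ + ε + 4 * (C * (Real.sqrt h * gaussM1 d))
          + C * (gaussM1 d * Real.sqrt (r - s) + (r - s)) ≤ 7 * ε * momentAt d T s μ := by
      have h2 := mul_le_mul_of_nonneg_left hb hε.le
      have h3 := mul_nonneg hε.le hm0
      linarith
    have := mul_le_mul_of_nonneg_left h1 hr.le
    linarith
  have hone : ε * (r - s) ≤ ε * (r - s) * momentAt d T s μ :=
    le_mul_of_one_le_right (by positivity) (by linarith)
  unfold displacement at hj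
  linarith

end Potential

section LowerBound

variable {d : ℕ} {A B : Type} [MetricSpace A] [CompactSpace A] [Nonempty A]
  [MeasurableSpace A] [BorelSpace A]
  [MetricSpace B] [CompactSpace B] [Nonempty B] [MeasurableSpace B] [BorelSpace B]
  {f : ℝ → Ed d → A → B → ℝ} {C T t η ε : ℝ} {FA : Finset A} {FB : Finset B} {κA : A → FA}
  {κB : B → FB} {K : ℕ} {τ : ℕ → ℝ}

omit [BorelSpace A] [BorelSpace B] in
/-- The penalized value is guaranteed by player 2 on fine grids. -/
theorem IsNet.exists_mem_guaranteed (hN : IsNet f C T ε κA κB) (hf : IsPayoff f C) (hε : 0 < ε)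
    (hI : ∀ s ∈ Icc 0 T, ∀ μ : Measure (Ed d), MemP d 2 μ →
      (⨅ u : A, ⨆ v : B, ∫ x, f s x u v ∂μ) = ⨆ v : B, ⨅ u : A, ∫ x, f s x u v ∂μ)
    {β h : ℝ} (hβ : 0 < β) (hh : 0 < h) (hhε : 4 * (C * (Real.sqrt h * gaussM1 d)) ≤ ε)
    (hβε : β * ((FA ×ˢ FB).card * (2 * C * (C * (gaussM1 d / Real.sqrt h + 1)))) ≤ ε)
    (ht : 0 ≤ t) (hg : IsGrid t T η K τ)
    (hηε : ∀ r, 0 < r → r < η → C * (gaussM1 d * Real.sqrt r + r) ≤ ε)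
    (hηβ : ∀ r, 0 < r → r < η → (FA ×ˢ FB).card * (r / β) ≤ ε) (k : ℕ) :
    ∀ q, q + k = K → ∀ μ : Measure (Ed d), MemP d 2 μ → ∀ δ > 0,
      ∃ φ ∈ guaranteed τ T (3 * C)
          (fun q (c : FA) (j : FB) x => f (τ q) x c j - netErr C ε x) k q,
        penalized f C T ε β h (FA ×ˢ FB) (τ q) μ - δ ≤ ∫ x, φ x ∂μ := by
  have hC := hf.nonneg
  have hnA : Nonempty FA := ⟨κA (Classical.arbitrary A)⟩
  have hG : ∀ q (c : FA) (j : FB), Measurable fun x => f (τ q) x c j - netErr C ε x :=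
    fun q c j => (hf.measurable_space _ _ _).sub measurable_netErr
  have hGb : ∀ q (c : FA) (j : FB) x, |f (τ q) x c j - netErr C ε x| ≤ 3 * C :=
    fun q c j x => (abs_sub _ _).trans (by
      linarith [hf.bdd (τ q) x c j, abs_netErr_le hC hε.le x])
  induction k with
  | zero =>
    intro q hq μ hμ δ hδ
    have := hμ.1
    refine ⟨0, by rw [guaranteed]; rfl, ?_⟩
    rw [add_zero] at hq
    rw [hq, hg.final]
    have h1 := gameValue_self (T := T) hf hμ
    have h2 := mul_nonneg hβ.le (sub_nonneg.2 (hf.energy_le (μ := μ) (FA ×ˢ FB) h T))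
    simp only [penalized, sub_self, mul_zero, zero_mul, Pi.zero_apply, integral_zero]
    linarith
  | succ k ih =>
    intro q hq μ hμ δ hδ
    have := hμ.1
    have hqK : q < K := by omega
    have hlt := hg.lt q hqK
    have hr := sub_pos.2 hlt
    have hq1 := hg.mem_Icc (q := q + 1) (by omega)
    have hqm := hg.mem_Icc hqK.le
    have hmeas : ∀ φ ∈ guaranteed τ T (3 * C)
        (fun q (c : FA) (j : FB) x => f (τ q) x c j - netErr C ε x) k (q + 1), Measurable φ :=
      fun φ hφ => measurable_of_mem_guaranteed hφ
    have hbdd : ∀ φ ∈ guaranteed τ T (3 * C)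
        (fun q (c : FA) (j : FB) x => f (τ q) x c j - netErr C ε x) k (q + 1),
        ∀ x, |φ x| ≤ 3 * C * (T - τ (q + 1)) :=
      fun φ hφ x => abs_le_of_mem_guaranteed (by positivity) hq1.2 hφ x
    obtain ⟨a, ha, hal⟩ := exists_integral_inf_ge μ
      (S := mixedVals (τ (q + 1) - τ q) (fun (c : FA) (j : FB) x => f (τ q) x c j - netErr C ε x)
        (guaranteed τ T (3 * C)
          (fun q (c : FA) (j : FB) x => f (τ q) x c j - netErr C ε x) k (q + 1)))
      (fun a ha c => measurable_of_mem_mixedVals (hG q) hmeas ha c)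
      (fun a ha c x => abs_le_of_mem_mixedVals hr.le (hGb q) hbdd ha c x)
      (mixedVals_convex hmeas hbdd (hg.guaranteed_convex (by positivity) k (q + 1) (by omega)))
      (l := penalized f C T ε β h (FA ×ˢ FB) (τ q) μ) (fun w hw hwp hws δ' hδ' => by
        obtain ⟨p, ν, hsp⟩ := exists_isSplit (μ := μ) hw hwp hws
        obtain ⟨j, hj⟩ := hN.exists_penalized_le hf hε hβ hh hhε hβε hμ hsp (ht.trans hqm.1) hlt
          hq1.2 (hηε _ hr (hg.mesh q hqK)) (hηβ _ hr (hg.mesh q hqK))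
          (hI _ ⟨ht.trans hqm.1, hqm.2⟩ μ hμ)
        choose φ hφ hφl using fun c => ih (q + 1) (by omega) _
          ((hsp.memP hμ c).heatFlow_two (τ q) (τ (q + 1))) δ' hδ'
        classical
        refine ⟨_, ⟨fun j' => if j' = j then 1 else 0, fun j' => by positivity, by simp,
          fun c _ => φ c, fun c _ => hφ c, rfl⟩, ?_⟩
        simp only [ite_mul, one_mul, zero_mul, Finset.sum_ite_eq', Finset.mem_univ, if_true]
        have hint : ∀ c : FA, Integrable (fun x => (τ (q + 1) - τ q) * (f (τ q) x c j - netErr C ε x)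
            + heatOp (τ (q + 1) - τ q) (φ c) x) μ := fun c =>
          (integrable_of_abs_le (hG q c j) (hGb q c j)).const_mul _ |>.add
            (integrable_of_abs_le (measurable_heatOp (hmeas _ (hφ c)) _)
              (abs_heatOp_le (hbdd _ (hφ c)) _))
        rw [integral_finsetSum _ fun c _ => hsp.integrable_mul _ (hint c) c]
        have h1 : ∀ c : FA, ∫ x, w c x * ((τ (q + 1) - τ q) * (f (τ q) x c j - netErr C ε x)
            + heatOp (τ (q + 1) - τ q) (φ c) x) ∂μ
            = p c * ((τ (q + 1) - τ q) * ∫ x, (f (τ q) x c j - netErr C ε x) ∂(ν c)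
              + ∫ x, φ c x ∂(heatFlow d (τ q) (τ (q + 1)) (ν c))) := by
          intro c
          have := hsp.prob c
          rw [hsp.integral, integral_add, integral_const_mul,
            integral_heatFlow (hmeas _ (hφ c)) (hbdd _ (hφ c))]
          · exact (integrable_of_abs_le (hG q c j) (hGb q c j)).const_mul _
          · exact integrable_of_abs_le (measurable_heatOp (hmeas _ (hφ c)) _)
              (abs_heatOp_le (hbdd _ (hφ c)) _)
        simp only [h1]
        have h2 : δ' = ∑ c, p c * δ' := by rw [← Finset.sum_mul, hsp.sum_p, one_mul]
        rw [sub_le_iff_le_add, h2, ← Finset.sum_add_distrib]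
        refine hj.trans (Finset.sum_le_sum fun c _ => ?_)
        rw [← mul_add]
        exact mul_le_mul_of_nonneg_left (by linarith [hφl c]) (hsp.nonneg c)) hδ
    refine ⟨_, ⟨?_, fun x => ?_, a, ha, fun c x => Finset.inf'_le _ (Finset.mem_univ c)⟩, hal⟩
    · have h1 := Finset.inf'_induction (p := Measurable) Finset.univ_nonempty a
        (fun _ h₁ _ h₂ => h₁.inf h₂)
        (fun c _ => measurable_of_mem_mixedVals (hG q) hmeas ha c)
      convert h1 using 1
      funext x
      rw [Finset.inf'_apply]
    · obtain ⟨c, -, hc⟩ := Finset.exists_mem_eq_inf' (Finset.univ_nonempty (α := FA))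
        fun c => a c x
      rw [hc]
      refine (abs_le_of_mem_mixedVals hr.le (hGb q) hbdd ha c x).trans_eq ?_
      ring

/-- Player 2 asymptotically guarantees the value of the control problem. -/
theorem exists_strategy2_ge (hf : IsPayoff f C)
    (hI : ∀ s ∈ Icc 0 T, ∀ μ : Measure (Ed d), MemP d 2 μ →
      (⨅ u : A, ⨆ v : B, ∫ x, f s x u v ∂μ) = ⨆ v : B, ⨅ u : A, ∫ x, f s x u v ∂μ)
    (ht : t ∈ Icc 0 T) {m : Measure (Ed d)} (hm : MemP d 2 m) {ε₀ : ℝ} (hε₀ : 0 < ε₀) :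
    ∃ η > 0, ∀ K τ, IsGrid t T η K τ → ∃ τs, IsStrategy2 d τs ∧ ∀ σs, IsStrategy1 d σs →
      gameValue d f T t m - ε₀ ≤ discretePayoff d f m (K + 1) τ σs τs := by
  have hC := hf.nonneg
  have hg1 := gaussM1_nonneg d
  have := hm.1
  have hTt := sub_nonneg.2 ht.2
  have hb : 1 ≤ momentAt d T t m := by
    have : 0 ≤ ∫ x, ‖x‖ ^ 2 ∂m := integral_nonneg fun x => by positivity
    linarith [one_le_momentAt (μ := m) ht.2]
  obtain ⟨ε, hε, hεle⟩ : ∃ ε > 0, 9 * ε * (T - t) * momentAt d T t m + 2 * ε ≤ ε₀ := by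
    refine ⟨ε₀ / (9 * (T - t) * momentAt d T t m + 2), by positivity, le_of_eq ?_⟩
    field_simp
  obtain ⟨FA, FB, κA, κB, -, -, hN⟩ := hf.exists_isNet T hε
  obtain ⟨h, hh, hhε⟩ : ∃ h > 0, 4 * (C * (Real.sqrt h * gaussM1 d)) ≤ ε := by
    refine ⟨(ε / (4 * (C * gaussM1 d) + 1)) ^ 2, by positivity, ?_⟩
    rw [Real.sqrt_sq (by positivity)]
    rw [show 4 * (C * (ε / (4 * (C * gaussM1 d) + 1) * gaussM1 d))
      = ε * (4 * (C * gaussM1 d)) / (4 * (C * gaussM1 d) + 1) by ring, div_le_iff₀ (by positivity)]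
    linarith
  obtain ⟨β, hβ, hβε, hβC⟩ : ∃ β > 0,
      β * ((FA ×ˢ FB).card * (2 * C * (C * (gaussM1 d / Real.sqrt h + 1)))) ≤ ε
        ∧ β * ((FA ×ˢ FB).card * C ^ 2) ≤ ε := by
    have h1 : 0 ≤ (FA ×ˢ FB).card * (2 * C * (C * (gaussM1 d / Real.sqrt h + 1))) := by positivity
    have h2 : 0 ≤ (FA ×ˢ FB).card * C ^ 2 := by positivity
    generalize (FA ×ˢ FB).card * (2 * C * (C * (gaussM1 d / Real.sqrt h + 1))) = x at *
    generalize (FA ×ˢ FB).card * C ^ 2 = y at *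
    refine ⟨ε / (x + y + 1), by positivity, ?_, ?_⟩ <;>
      rw [div_mul_eq_mul_div, div_le_iff₀ (by positivity)] <;>
      exact mul_le_mul_of_nonneg_left (by linarith) hε.le
  obtain ⟨η, hη, hηle⟩ : ∃ η > 0, ∀ r, 0 < r → r < η →
      C * (gaussM1 d * Real.sqrt r + r) + (FA ×ˢ FB).card * (r / β) < ε := by
    have hcont : Continuous fun r : ℝ =>
        C * (gaussM1 d * Real.sqrt r + r) + (FA ×ˢ FB).card * (r / β) := by fun_prop
    have h0 : ∀ᶠ r in 𝓝 (0 : ℝ),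
        C * (gaussM1 d * Real.sqrt r + r) + (FA ×ˢ FB).card * (r / β) < ε :=
      hcont.continuousAt.eventually_lt continuousAt_const (by simpa using hε)
    obtain ⟨η, hη, hball⟩ := Metric.eventually_nhds_iff.1 h0
    exact ⟨η, hη, fun r hr hrη => hball (by rwa [Real.dist_eq, sub_zero, abs_of_pos hr])⟩
  refine ⟨η, hη, fun K τ hg => ?_⟩
  have h1 : ∀ r, 0 < r → r < η → C * (gaussM1 d * Real.sqrt r + r) ≤ ε := fun r hr hrη => by
    have : 0 ≤ (FA ×ˢ FB).card * (r / β) := by positivity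
    linarith [hηle r hr hrη]
  have h2 : ∀ r, 0 < r → r < η → (FA ×ˢ FB).card * (r / β) ≤ ε := fun r hr hrη => by
    have : 0 ≤ C * (gaussM1 d * Real.sqrt r + r) := by positivity
    linarith [hηle r hr hrη]
  obtain ⟨φ, hφ, hφl⟩ := hN.exists_mem_guaranteed hf hε hI hβ hh hhε hβε ht.1 hg h1 h2 K 0
    (zero_add K) m hm ε hε
  obtain ⟨τs, hτs, hle⟩ := hg.exists_strategy2 hf (a := fun c : FA => (c : A))
    (b := fun j : FB => (j : B)) hN.measA hN.measB hN.sectionB (e := netErr C ε)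
    (fun q hq x u j => by
      have := (abs_le.1 (hN.left (τ q) ⟨ht.1.trans (hg.mem_Icc hq.le).1, (hg.mem_Icc hq.le).2⟩
        x u j)).1
      linarith) (by positivity) hφ
  refine ⟨τs, hτs, fun σs hσs => ?_⟩
  have hreg := hg.stageRegular hf hσs hτs K 0 (zero_add K)
  have h3 : ∫ x, φ x ∂m ≤ discretePayoff d f m (K + 1) τ σs τs := by
    refine integral_mono (integrable_of_abs_le (measurable_of_mem_guaranteed hφ)
      (abs_le_of_mem_guaranteed (by positivity) (hg.mem_Icc (Nat.zero_le K)).2 hφ))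
      (integrable_of_abs_le (hreg.meas_right _) (hreg.bdd _)) fun x => hle σs hσs x
  refine le_trans ?_ (hφl.trans h3)
  rw [hg.start]
  have h4 : 0 ≤ β * energy f (FA ×ˢ FB) h t m :=
    mul_nonneg hβ.le (Finset.sum_nonneg fun i _ => sq_nonneg _)
  unfold penalized
  linarith

end LowerBound

section Selection

/-- Measurable selection of a minimizer over a finite set. -/
theorem exists_measurable_argmin {Ω ι : Type*} [MeasurableSpace Ω] [Finite ι] [Nonempty ι]
    [MeasurableSpace ι] {g : ι → Ω → ℝ} (hg : ∀ c, Measurable (g c)) :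
    ∃ κ : Ω → ι, Measurable κ ∧ ∀ ω c, g (κ ω) ω ≤ g c ω := by
  classical
  obtain ⟨e, he⟩ := exists_surjective_nat ι
  have hp : ∀ ω, ∃ n, ∀ c, g (e n) ω ≤ g c ω := fun ω => by
    obtain ⟨c, hc⟩ := Finite.exists_min fun c => g c ω
    obtain ⟨n, rfl⟩ := he c
    exact ⟨n, hc⟩
  refine ⟨fun ω => e (Nat.find (hp ω)), ?_, fun ω => Nat.find_spec (hp ω)⟩
  refine (measurable_from_nat (f := e)).comp (measurable_find hp fun n => ?_)
  have : {ω | ∀ c, g (e n) ω ≤ g c ω} = ⋂ c, {ω | g (e n) ω ≤ g c ω} := by ext; simp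
  rw [this]
  exact MeasurableSet.iInter fun c => measurableSet_le (hg _) (hg _)

/-- Finite measures have densities forming a partition of unity with respect to their sum. -/
theorem exists_weights {X ι : Type*} [MeasurableSpace X] [Fintype ι] [Nonempty ι]
    (ρ : ι → Measure X) [∀ c, IsFiniteMeasure (ρ c)] :
    ∃ w : ι → X → ℝ, (∀ c, Measurable (w c)) ∧ (∀ c x, 0 ≤ w c x) ∧ (∀ x, ∑ c, w c x = 1) ∧
      ∀ c (φ : X → ℝ), ∫ x, φ x ∂(ρ c) = ∫ x, w c x * φ x ∂(∑ c, ρ c) := by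
  classical
  set ν := ∑ c, ρ c with hν
  have hle : ∀ c, ρ c ≤ ν := fun c => by
    rw [hν]
    exact Finset.single_le_sum (f := ρ) (fun _ _ => Measure.zero_le _) (Finset.mem_univ c)
  have hac : ∀ c, ρ c ≪ ν := fun c => (hle c).absolutelyContinuous
  let r : ι → X → ℝ := fun c x => ((ρ c).rnDeriv ν x).toReal
  have hr : ∀ c, Measurable (r c) := fun c => (Measure.measurable_rnDeriv _ _).ennreal_toReal
  have hri : ∀ c, Integrable (r c) ν := fun c => Measure.integrable_toReal_rnDeriv
  have hs : Measurable fun x => ∑ c, r c x := Finset.measurable_fun_sum _ fun c _ => hr c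
  have hsum : ∀ᵐ x ∂ν, ∑ c, r c x = 1 := by
    refine Integrable.ae_eq_of_forall_setIntegral_eq _ _ (integrable_finsetSum _ fun c _ => hri c)
      (integrable_const _) fun s hs _ => ?_
    rw [integral_finsetSum _ fun c _ => (hri c).integrableOn]
    simp only [r, Measure.setIntegral_toReal_rnDeriv (hac _), setIntegral_const, smul_eq_mul,
      mul_one]
    simp only [Measure.real, hν, Measure.coe_finsetSum, Finset.sum_apply]
    rw [ENNReal.toReal_sum fun c _ => measure_ne_top _ _]
  let c₀ := Classical.arbitrary ι
  refine ⟨fun c x => if ∑ c, r c x = 1 then r c x else if c = c₀ then 1 else 0,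
    fun c => Measurable.ite (hs (measurableSet_singleton 1)) (hr c) measurable_const,
    fun c x => ?_, fun x => ?_, fun c φ => ?_⟩
  · dsimp only
    split_ifs
    exacts [ENNReal.toReal_nonneg, zero_le_one, le_rfl]
  · by_cases h : ∑ c, r c x = 1
    · simp [h]
    · simp [h]
  · rw [← integral_rnDeriv_smul (hac c)]
    refine integral_congr_ae ?_
    filter_upwards [hsum] with x hx
    simp [hx, r]

end Selection

section CodedLaw

variable {d : ℕ} {Ω : Type} [MeasurableSpace Ω] {P : Measure Ω} [IsFiniteMeasure P]
  {M : Ω → Measure (Ed d)}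

theorem integral_bind_of_abs_le (hM : Measurable M) [∀ ω, IsProbabilityMeasure (M ω)]
    {φ : Ed d → ℝ} {D : ℝ} (hφ : Measurable φ) (hD : ∀ x, |φ x| ≤ D) :
    ∫ x, φ x ∂(P.bind M) = ∫ ω, (∫ x, φ x ∂(M ω)) ∂P := by
  let κ : ProbabilityTheory.Kernel Ω (Ed d) := ⟨M, hM⟩
  have : ProbabilityTheory.IsMarkovKernel κ :=
    ⟨fun ω => inferInstanceAs (IsProbabilityMeasure (M ω))⟩
  have h : P.bind M =
      (ProbabilityTheory.Kernel.comp κ (ProbabilityTheory.Kernel.const Unit P)) () := by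
    rw [ProbabilityTheory.Kernel.comp_apply]; rfl
  rw [h, ProbabilityTheory.Kernel.integral_comp]
  · rfl
  · exact integrable_of_abs_le hφ hD

theorem isFiniteMeasure_bind (hM : Measurable M) [∀ ω, IsProbabilityMeasure (M ω)] :
    IsFiniteMeasure (P.bind M) := by
  refine ⟨?_⟩
  rw [Measure.bind_apply MeasurableSet.univ hM.aemeasurable]
  simp

/-- The event that a given sequence of codes is realized. -/
def codeSet {ι : Type*} (κ : ℕ → Ω → ι) (q : ℕ) (g : Fin q → ι) : Set Ω :=
  {ω | ∀ i : Fin q, κ i ω = g i}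

variable {ι : Type*} {κ : ℕ → Ω → ι}

omit [MeasurableSpace Ω] in
theorem mem_codeSet_snoc {q : ℕ} {g : Fin q → ι} {c : ι} {ω : Ω} :
    ω ∈ codeSet κ (q + 1) (Fin.snoc g c : Fin (q + 1) → ι) ↔ ω ∈ codeSet κ q g ∧ κ q ω = c := by
  simp only [codeSet, Set.mem_ofPred_eq]
  constructor
  · intro h
    refine ⟨fun i => ?_, ?_⟩
    · simpa using h i.castSucc
    · simpa using h (Fin.last q)
  · rintro ⟨h1, h2⟩ i
    refine Fin.lastCases ?_ (fun i => ?_) i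
    · simpa using h2
    · simpa using h1 i

theorem measurableSet_codeSet [MeasurableSpace ι] [MeasurableSingletonClass ι] {q : ℕ}
    (hκ : ∀ i < q, Measurable (κ i)) (g : Fin q → ι) : MeasurableSet (codeSet κ q g) := by
  have : codeSet κ q g = ⋂ i : Fin q, κ i ⁻¹' {g i} := by ext; simp [codeSet]
  rw [this]
  exact MeasurableSet.iInter fun i => hκ i i.2 (measurableSet_singleton _)

omit [IsFiniteMeasure P] in
theorem restrict_codeSet_eq_sum [Fintype ι] [MeasurableSpace ι] [MeasurableSingletonClass ι]
    (hκ : ∀ i, Measurable (κ i)) {q : ℕ} (g : Fin q → ι) :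
    P.restrict (codeSet κ q g)
      = ∑ c, P.restrict (codeSet κ (q + 1) (Fin.snoc g c : Fin (q + 1) → ι)) := by
  have : codeSet κ q g = ⋃ c, codeSet κ (q + 1) (Fin.snoc g c : Fin (q + 1) → ι) := by
    ext ω; simp [mem_codeSet_snoc]
  rw [this, Measure.restrict_iUnion, Measure.sum_fintype]
  · intro c c' hc
    refine Set.disjoint_left.2 fun ω h h' => hc ?_
    exact (mem_codeSet_snoc.1 h).2.symm.trans (mem_codeSet_snoc.1 h').2
  · exact fun c => measurableSet_codeSet (fun i _ => hκ i) _

omit [IsFiniteMeasure P] in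
theorem bind_restrict_codeSet_eq_sum [Fintype ι] [MeasurableSpace ι] [MeasurableSingletonClass ι]
    (hκ : ∀ i, Measurable (κ i)) (hM : Measurable M) {q : ℕ} (g : Fin q → ι) :
    (P.restrict (codeSet κ q g)).bind M
      = ∑ c, (P.restrict (codeSet κ (q + 1) (Fin.snoc g c : Fin (q + 1) → ι))).bind M := by
  ext s hs
  simp only [Measure.coe_finsetSum, Finset.sum_apply,
    Measure.bind_apply hs hM.aemeasurable]
  rw [restrict_codeSet_eq_sum hκ g, lintegral_finsetSum_measure]

end CodedLaw

section Coded

variable {d : ℕ} {T t η : ℝ} {K : ℕ} {τ : ℕ → ℝ}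
  {A B : Type} [MetricSpace A] [CompactSpace A] [Nonempty A] [MeasurableSpace A] [BorelSpace A]
  [MetricSpace B] [CompactSpace B] [Nonempty B] [MeasurableSpace B] [BorelSpace B]
  {f : ℝ → Ed d → A → B → ℝ} {C : ℝ}

omit [MetricSpace A] [CompactSpace A] [Nonempty A] [BorelSpace A]
  [MetricSpace B] [CompactSpace B] [Nonempty B] [BorelSpace B] in
/-- If player 1 disregards the past observations, so do the continuation payoffs. -/
theorem stageVal_congr {σs : (q : ℕ) → (Fin q → Ed d × A × B) → Ed d → Measure A}
    {τs : (q : ℕ) → (Fin q → A × B) → Measure B}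
    (hσ : ∀ q h h', (∀ i, (h i).2 = (h' i).2) → σs q h = σs q h') (k : ℕ) :
    ∀ q h h', (∀ i, (h i).2 = (h' i).2) →
      stageVal d f τ σs τs k q h = stageVal d f τ σs τs k q h' := by
  induction k with
  | zero => intros; rfl
  | succ k ih =>
    intro q h h' hh
    funext x
    simp only [stageVal, hσ q h h' hh, hh]
    have : ∀ u v, stageVal d f τ σs τs k (q + 1) (Fin.snoc h (x, u, v))
        = stageVal d f τ σs τs k (q + 1) (Fin.snoc h' (x, u, v)) := fun u v => by
      refine ih _ _ _ fun i => ?_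
      refine Fin.lastCases ?_ (fun i => ?_) i
      · simp
      · simpa using hh i
    simp only [this]

/-- A measure-valued process on a grid, together with codes which preserve its heat flow
martingale property. -/
structure IsCodedChain {Ω ι : Type} [MeasurableSpace Ω] [MeasurableSpace ι] (P : Measure Ω)
    (M : ℕ → Ω → Measure (Ed d)) (κ : ℕ → Ω → ι) (τ : ℕ → ℝ) (K : ℕ) (m : Measure (Ed d)) :
    Prop where
  prob : ∀ q ω, IsProbabilityMeasure (M q ω)
  meas : ∀ q, Measurable (M q)
  code : ∀ q, Measurable (κ q)
  init : P.bind (M 0) = m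
  step : ∀ q < K, ∀ g : Fin (q + 1) → ι,
    (P.restrict (codeSet κ (q + 1) g)).bind (M (q + 1))
      = heatFlow d (τ q) (τ (q + 1)) ((P.restrict (codeSet κ (q + 1) g)).bind (M q))

omit [Nonempty A] [Nonempty B] in
/-- Player 1 can play so that the posterior of player 2 is a given coded chain. -/
theorem IsCodedChain.exists_strategy1 {Ω ι : Type} [MeasurableSpace Ω] [Fintype ι] [Nonempty ι]
    [MeasurableSpace ι] [MeasurableSingletonClass ι] {P : Measure Ω} [IsProbabilityMeasure P]
    {M : ℕ → Ω → Measure (Ed d)} {κ : ℕ → Ω → ι} {m : Measure (Ed d)}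
    (hc : IsCodedChain P M κ τ K m) (hg : IsGrid t T η K τ) (hf : IsPayoff f C)
    {a : ι → A} {κA : A → ι} (hκA : Measurable κA) (ha : ∀ c, κA (a c) = c)
    {G : ℕ → Ω → ℝ} {D : ℝ} (hGm : ∀ q, Measurable (G q)) (hGD : ∀ q ω, |G q ω| ≤ D)
    (hG : ∀ q < K, ∀ ω v, ∫ x, f (τ q) x (a (κ q ω)) v ∂(M q ω) ≤ G q ω) :
    ∃ σs, IsStrategy1 d σs ∧ ∀ τs, IsStrategy2 d τs →
      discretePayoff d f m (K + 1) τ σs τs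
        ≤ ∫ ω, ∑ q ∈ Finset.range K, (τ (q + 1) - τ q) * G q ω ∂P := by
  classical
  have hprob := hc.prob
  let law : (q r : ℕ) → (Fin r → ι) → Measure (Ed d) := fun q r g =>
    (P.restrict (codeSet κ r g)).bind (M q)
  have hfin : ∀ q r g, IsFiniteMeasure (law q r g) := fun q r g => isFiniteMeasure_bind (hc.meas q)
  have hw := fun (q : ℕ) (g : Fin q → ι) => exists_weights fun c =>
    law q (q + 1) (Fin.snoc g c : Fin (q + 1) → ι)
  choose w hwm hw0 hw1 hwi using hw
  have hlaw : ∀ q g, law q q g = ∑ c, law q (q + 1) (Fin.snoc g c : Fin (q + 1) → ι) := fun q g =>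
    bind_restrict_codeSet_eq_sum hc.code (hc.meas q) g
  let σs : (q : ℕ) → (Fin q → Ed d × A × B) → Ed d → Measure A := fun q h x =>
    ∑ c, ENNReal.ofReal (w q (fun i => κA (h i).2.1) c x) • Measure.dirac (a c)
  have hσs : IsStrategy1 d σs := by
    refine fun q => ⟨fun h x => ⟨?_⟩, ?_⟩
    · simp only [σs, Measure.coe_finsetSum, Finset.sum_apply, Measure.smul_apply, measure_univ,
        smul_eq_mul, mul_one]
      rw [← ENNReal.ofReal_sum_of_nonneg fun j _ => hw0 _ _ _ _, hw1, ENNReal.ofReal_one]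
    · refine Measure.measurable_of_measurable_coe _ fun s hs => ?_
      simp only [σs, Measure.coe_finsetSum, Finset.sum_apply, Measure.smul_apply, smul_eq_mul]
      refine Finset.measurable_fun_sum _ fun c _ => Measurable.mul_const ?_ _
      have h1 : Measurable fun p : (Fin q → ι) × Ed d => w q p.1 c p.2 :=
        measurable_from_prod_countable_right fun g => hwm q g c
      refine (h1.comp (f := fun p : (Fin q → Ed d × A × B) × Ed d =>
        ((fun i => κA (p.1 i).2.1 : Fin q → ι), p.2)) ?_).ennreal_ofReal
      fun_prop
  have hσc : ∀ q h h', (∀ i, (h i).2 = (h' i).2) → σs q h = σs q h' := fun q h h' hh => by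
    simp only [σs, hh]
  refine ⟨σs, hσs, fun τs hτs => ?_⟩
  have hSm : ∀ k q, Measurable fun ω =>
      ∑ j ∈ Finset.range k, (τ (q + j + 1) - τ (q + j)) * G (q + j) ω := fun k q =>
    Finset.measurable_fun_sum _ fun j _ => (hGm _).const_mul _
  have hSi : ∀ k q (ρ : Measure Ω) [IsFiniteMeasure ρ], Integrable (fun ω =>
      ∑ j ∈ Finset.range k, (τ (q + j + 1) - τ (q + j)) * G (q + j) ω) ρ := fun k q ρ _ =>
    integrable_finsetSum _ fun j _ => (integrable_of_abs_le (hGm _) (hGD _)).const_mul _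
  have main : ∀ k q, q + k = K → ∀ (h : Fin q → Ed d × A × B),
      ∫ x, stageVal d f τ σs τs k q h x ∂(law q q fun i => κA (h i).2.1)
        ≤ ∫ ω in codeSet κ q (fun i => κA (h i).2.1),
          ∑ j ∈ Finset.range k, (τ (q + j + 1) - τ (q + j)) * G (q + j) ω ∂P := by
    intro k
    induction k with
    | zero => intro q hq h; simp [stageVal]
    | succ k ih =>
      intro q hq h
      have hr := hg.stageRegular hf hσs hτs k (q + 1) (by omega)
      have hΔ := (hg.lt q (by omega)).le
      set g : Fin q → ι := fun i => κA (h i).2.1 with hgdef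
      let Sc : ι → Set Ω := fun c => codeSet κ (q + 1) (Fin.snoc g c : Fin (q + 1) → ι)
      let πc : ι → Measure (Ed d) := fun c => law q (q + 1) (Fin.snoc g c : Fin (q + 1) → ι)
      have hπ : ∀ c, IsFiniteMeasure (πc c) := fun c => hfin _ _ _
      have hτp := (hτs q).1 fun i => ((h i).2.1, (h i).2.2)
      let ψ : ι → Ed d → ℝ := fun c x =>
        ∫ v, actionVal f τ σs τs k q h x (a c) v ∂(τs q fun i => ((h i).2.1, (h i).2.2))
      have hψm : ∀ c, Measurable (ψ c) := fun c =>
        (hr.measurable_integral_actionVal hf hτs).comp (f := fun x : Ed d => ((h, x), a c))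
          (by fun_prop)
      have hψb : ∀ c x, |ψ c x| ≤ C * (τ (q + 1) - τ q) + C * (T - τ (q + 1)) := fun c x =>
        abs_integral_le_of_abs_le fun v => hr.abs_actionVal_le hf hΔ h x (a c) v
      have hval : ∀ x, stageVal d f τ σs τs (k + 1) q h x = ∑ c, w q g c x * ψ c x := by
        intro x
        rw [hr.stageVal_succ]
        have hm : Measurable fun u => ∫ v, actionVal f τ σs τs k q h x u v
            ∂(τs q fun i => ((h i).2.1, (h i).2.2)) :=
          (hr.measurable_integral_actionVal hf hτs).comp (f := fun u : A => ((h, x), u))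
            (by fun_prop)
        rw [integral_finsetSum_measure fun c _ => (integrable_of_abs_le hm fun u =>
          abs_integral_le_of_abs_le fun v => hr.abs_actionVal_le hf hΔ h x u v).smul_measure
            ENNReal.ofReal_ne_top]
        refine Finset.sum_congr rfl fun c _ => ?_
        rw [integral_smul_measure, integral_dirac' _ _ hm.stronglyMeasurable,
          ENNReal.toReal_ofReal (hw0 _ _ _ _), smul_eq_mul]
      have hwle : ∀ c x, |w q g c x| ≤ 1 := fun c x => by
        rw [abs_of_nonneg (hw0 _ _ _ _), ← hw1 q g x]
        exact Finset.single_le_sum (f := fun c => w q g c x) (fun _ _ => hw0 _ _ _ _)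
          (Finset.mem_univ c)
      have hone : ∀ c, ∫ x, ψ c x ∂(πc c) ≤ ∫ ω in Sc c,
          ∑ j ∈ Finset.range (k + 1), (τ (q + j + 1) - τ (q + j)) * G (q + j) ω ∂P := by
        intro c
        have hjm : Measurable fun p : Ed d × B => actionVal f τ σs τs k q h p.1 (a c) p.2 :=
          (hr.measurable_actionVal hf).comp (f := fun p : Ed d × B => (((h, p.1), a c), p.2))
            (by fun_prop)
        rw [integral_integral_swap (integrable_of_abs_le hjm fun p =>
          hr.abs_actionVal_le hf hΔ h p.1 (a c) p.2)]
        have hv : ∀ v, ∫ x, actionVal f τ σs τs k q h x (a c) v ∂(πc c) ≤ ∫ ω in Sc c,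
            ∑ j ∈ Finset.range (k + 1), (τ (q + j + 1) - τ (q + j)) * G (q + j) ω ∂P := by
          intro v
          let h' : Fin (q + 1) → Ed d × A × B := Fin.snoc h (0, a c, v)
          have hh' : (fun i => κA (h' i).2.1) = (Fin.snoc g c : Fin (q + 1) → ι) := by
            funext i
            refine Fin.lastCases ?_ (fun i => ?_) i
            · simp [h', ha]
            · simp [h', hgdef]
          have hact : ∀ x, actionVal f τ σs τs k q h x (a c) v
              = (τ (q + 1) - τ q) * f (τ q) x (a c) v
                + heatOp (τ (q + 1) - τ q) (stageVal d f τ σs τs k (q + 1) h') x := fun x => by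
            rw [actionVal, stageVal_congr hσc k (q + 1) (Fin.snoc h (x, a c, v)) h' fun i => ?_]
            refine Fin.lastCases ?_ (fun i => ?_) i
            · simp [h']
            · simp [h']
          simp only [hact]
          rw [integral_add ((hf.integrable _ _ _ _).const_mul _) (integrable_of_abs_le
            (measurable_heatOp (hr.meas_right _) _) (abs_heatOp_le (hr.bdd _) _)),
            integral_const_mul, ← integral_heatFlow (hr.meas_right _) (hr.bdd _)]
          have hfirst : ∫ x, f (τ q) x (a c) v ∂(πc c) ≤ ∫ ω in Sc c, G q ω ∂P := by
            rw [integral_bind_of_abs_le (hc.meas q) (hf.measurable_space _ _ _) fun x =>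
              hf.bdd _ _ _ _]
            refine setIntegral_mono_on (integrable_of_abs_le (hf.measurable_integral (hc.meas q) _ _ _)
              fun ω => hf.abs_integral_le _ _ _ _) (integrable_of_abs_le (hGm q) (hGD q))
              (measurableSet_codeSet (fun i _ => hc.code i) _) fun ω hω => ?_
            have := hG q (by omega) ω v
            rwa [(mem_codeSet_snoc.1 hω).2] at this
          have hsecond := ih (q + 1) (by omega) h'
          rw [hh'] at hsecond
          have hst := hc.step q (by omega) (Fin.snoc g c)
          rw [show heatFlow d (τ q) (τ (q + 1)) (πc c) = law (q + 1) (q + 1) (Fin.snoc g c) from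
            hst.symm]
          refine (add_le_add (mul_le_mul_of_nonneg_left hfirst (sub_nonneg.2 hΔ)) hsecond).trans
            (le_of_eq ?_)
          rw [← integral_const_mul, ← integral_add ((integrable_of_abs_le (hGm q)
            (hGD q)).const_mul _) (hSi _ _ _)]
          refine integral_congr_ae (ae_of_all _ fun ω => ?_)
          simp only [Finset.sum_range_succ', add_zero]
          rw [add_comm]
          congr 1
          refine Finset.sum_congr rfl fun j _ => ?_
          rw [show q + (j + 1) = q + 1 + j by ring]
        calc _ ≤ ∫ _, (∫ ω in Sc c, ∑ j ∈ Finset.range (k + 1),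
              (τ (q + j + 1) - τ (q + j)) * G (q + j) ω ∂P)
              ∂(τs q fun i => ((h i).2.1, (h i).2.2)) := by
                refine integral_mono (Integrable.integral_prod_right (integrable_of_abs_le hjm
                  fun p => hr.abs_actionVal_le hf hΔ h p.1 (a c) p.2)) (integrable_const _) hv
          _ = _ := by simp
      calc ∫ x, stageVal d f τ σs τs (k + 1) q h x ∂(law q q g)
          = ∑ c, ∫ x, w q g c x * ψ c x ∂(law q q g) := by
            simp only [hval]
            refine integral_finsetSum _ fun c _ => integrable_of_abs_le
              ((hwm q g c).mul (hψm c)) (K := 1 * (C * (τ (q + 1) - τ q) + C * (T - τ (q + 1))))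
              fun x => ?_
            rw [abs_mul]
            exact mul_le_mul (hwle c x) (hψb c x) (abs_nonneg _) zero_le_one
        _ = ∑ c, ∫ x, ψ c x ∂(πc c) := by
            refine Finset.sum_congr rfl fun c _ => ?_
            rw [hlaw, ← hwi]
        _ ≤ ∑ c, ∫ ω in Sc c,
            ∑ j ∈ Finset.range (k + 1), (τ (q + j + 1) - τ (q + j)) * G (q + j) ω ∂P :=
            Finset.sum_le_sum fun c _ => hone c
        _ = _ := by
            rw [restrict_codeSet_eq_sum hc.code g, integral_finsetSum_measure fun c _ => hSi _ _ _]
  have h0 := main K 0 (by omega) fun i => i.elim0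
  have huniv : codeSet κ 0 (fun i : Fin 0 => κA (i.elim0 : Ed d × A × B).2.1) = univ := by
    ext ω; simp [codeSet]
  simp only [law] at h0
  rw [huniv, Measure.restrict_univ, hc.init] at h0
  simpa [discretePayoff] using h0

end Coded

section UpperBound

variable {d : ℕ} {T t η : ℝ} {K : ℕ} {τ : ℕ → ℝ} {m : Measure (Ed d)}

theorem genFiltration_mono {Ω : Type} (M : ℝ → Ω → Measure (Ed d)) (t : ℝ) {s r : ℝ} (h : s ≤ r) :
    genFiltration d M t s ≤ genFiltration d M t r :=
  le_iInf₂ fun u hu => iInf₂_le u (h.trans_lt hu)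

theorem MVP.bind_eq (X : MVP d T t m) [IsProbabilityMeasure m] {s : ℝ} (hs : s ∈ Icc t T) :
    X.P.bind (X.M s) = heatFlow d t s m := by
  have hp : ∀ ω, IsProbabilityMeasure (X.M s ω) := fun ω => (X.inP1 s hs ω).1
  have := isFiniteMeasure_bind (P := X.P) (X.meas s)
  refine ext_of_forall_integral_eq_of_IsFiniteMeasure fun φ => ?_
  rw [integral_bind_of_abs_le (X.meas s) φ.continuous.measurable fun x => φ.norm_coe_le_norm x,
    X.integral_eq hs.1 hs.2]

/-- Sampling a measure-valued process on a grid yields a coded chain, for all adapted codes. -/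
theorem MVP.isCodedChain (X : MVP d T t m) [IsProbabilityMeasure m] (hg : IsGrid t T η K τ)
    {ι : Type} [Finite ι] [MeasurableSpace ι] [MeasurableSingletonClass ι] {κ : ℕ → X.Ω → ι}
    (hκ : ∀ q, Measurable[genFiltration d X.M t (τ (min q K))] (κ q)) :
    IsCodedChain X.P (fun q => X.M (τ (min q K))) κ τ K m := by
  have hp : ∀ q ω, IsProbabilityMeasure (X.M (τ (min q K)) ω) := fun q ω =>
    (X.inP1 _ (hg.mem_Icc (min_le_right q K)) ω).1
  refine ⟨hp, fun q => X.meas _, fun q => (hκ q).mono (genFiltration_le X.meas _ _) le_rfl, ?_, ?_⟩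
  · rw [X.bind_eq (hg.mem_Icc (min_le_right 0 K)), Nat.zero_min, hg.start, heatFlow_self]
  · intro q hq g
    have hS : MeasurableSet[genFiltration d X.M t (τ q)] (codeSet κ (q + 1) g) := by
      refine @measurableSet_codeSet _ (genFiltration d X.M t (τ q)) _ κ _ _ (q + 1)
        (fun i hi => (hκ i).mono (genFiltration_mono _ _ ?_) le_rfl) g
      exact hg.mono_le (by omega) hq.le
    have hq0 := hp q
    have hq1 := hp (q + 1)
    have h1 := hg.mem_Icc hq.le
    have h2 := hg.mem_Icc (q := q + 1) hq
    have e0 : min q K = q := min_eq_left hq.le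
    have e1 : min (q + 1) K = q + 1 := min_eq_left hq
    simp only [e0, e1] at hq0 hq1 ⊢
    have := isFiniteMeasure_bind (P := X.P.restrict (codeSet κ (q + 1) g)) (X.meas (τ q))
    have := isFiniteMeasure_bind (P := X.P.restrict (codeSet κ (q + 1) g)) (X.meas (τ (q + 1)))
    refine ext_of_forall_integral_eq_of_IsFiniteMeasure fun φ => ?_
    rw [integral_bind_of_abs_le (X.meas _) φ.continuous.measurable fun x => φ.norm_coe_le_norm x,
      integral_heatFlow_bcf, integral_bind_of_abs_le (X.meas _)
        (heatBCF _ φ).continuous.measurable fun x => (heatBCF _ φ).norm_coe_le_norm x,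
      X.setIntegral_eq h1.1 (hg.lt q hq).le h2.2 φ hS]
    exact integral_congr_ae (ae_of_all _ fun ω => integral_heatFlow_bcf φ _ _ _)

variable {A B : Type} [MetricSpace A] [CompactSpace A] [Nonempty A]
  [MeasurableSpace A] [BorelSpace A]
  [MetricSpace B] [CompactSpace B] [Nonempty B] [MeasurableSpace B] [BorelSpace B]
  {f : ℝ → Ed d → A → B → ℝ} {C ε : ℝ} {FA : Finset A} {FB : Finset B} {κA : A → FA}
  {κB : B → FB}

omit [CompactSpace A] [BorelSpace A] [CompactSpace B] [BorelSpace B] in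
/-- The best action in the net is almost optimal for the Hamiltonian. -/
theorem IsNet.iSup_le_hamiltonian (hN : IsNet f C T ε κA κB) (hf : IsPayoff f C) (hε : 0 ≤ ε)
    {s : ℝ} (hs : s ∈ Icc 0 T) (μ : Measure (Ed d)) [IsProbabilityMeasure μ] {c : FA}
    (hc : ∀ c' : FA, ⨆ v, ∫ x, f s x c v ∂μ ≤ ⨆ v, ∫ x, f s x c' v ∂μ) :
    ⨆ v, ∫ x, f s x c v ∂μ ≤ hamiltonian f s μ + ∫ x, netErr C ε x ∂μ := by
  rw [← sub_le_iff_le_add]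
  refine le_ciInf fun u => ?_
  rw [sub_le_iff_le_add]
  refine (hc (κA u)).trans (ciSup_le fun v => ?_)
  refine (integral_le_add_netErr hf.nonneg hε (hf.integrable _ _ _ _) (hf.integrable _ _ u v)
    fun x => ?_).trans (add_le_add_left (le_ciSup (hf.bddAbove μ s u) v) _)
  rw [abs_sub_comm]
  exact hN.left s hs x u v

/-- Player 1 asymptotically guarantees the value of the control problem. -/
theorem exists_strategy1_le (hf : IsPayoff f C) (ht : t ∈ Icc 0 T) (hm : MemP d 2 m) {ε₀ : ℝ}
    (hε₀ : 0 < ε₀) :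
    ∃ η > 0, ∀ K τ, IsGrid t T η K τ → ∃ σs, IsStrategy1 d σs ∧ ∀ τs, IsStrategy2 d τs →
      discretePayoff d f m (K + 1) τ σs τs ≤ gameValue d f T t m + ε₀ := by
  have hC := hf.nonneg
  have := hm.1
  have hTt := sub_nonneg.2 ht.2
  have hb : 1 ≤ momentAt d T t m := by
    have : 0 ≤ ∫ x, ‖x‖ ^ 2 ∂m := integral_nonneg fun x => by positivity
    linarith [one_le_momentAt (μ := m) ht.2]
  obtain ⟨ε, hε, hεle⟩ : ∃ ε > 0, ε * momentAt d T t m * (T - t) + 2 * ε ≤ ε₀ := by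
    refine ⟨ε₀ / (momentAt d T t m * (T - t) + 2), by positivity, le_of_eq ?_⟩
    field_simp
  obtain ⟨FA, FB, κA, κB, hFA, -, hN⟩ := hf.exists_isNet T hε
  have : Nonempty FA := hFA.to_subtype
  obtain ⟨X, hX⟩ := exists_mvCost_lt (f := f) hm ht.2 hε
  obtain ⟨η, hη, hmesh⟩ := X.exists_mesh hf hε
  refine ⟨η, hη, fun K τ hg => ?_⟩
  let θ : ℕ → ℝ := fun q => τ (min q K)
  have hθ : ∀ q, θ q ∈ Icc t T := fun q => hg.mem_Icc (min_le_right q K)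
  have hp : ∀ q ω, IsProbabilityMeasure (X.M (θ q) ω) := fun q ω => (X.inP1 _ (hθ q) ω).1
  let S : ℕ → FA → X.Ω → ℝ := fun q c ω => ⨆ v, ∫ x, f (θ q) x c v ∂(X.M (θ q) ω)
  choose κ hκm hκ using fun q => @exists_measurable_argmin X.Ω FA
    (genFiltration d X.M t (θ q)) _ _ _ (S q) fun c =>
      @IsPayoff.measurable_iSup _ _ _ _ _ _ _ _ hf X.Ω (genFiltration d X.M t (θ q)) _
        (measurable_genFiltration X.M (hθ q).1) (hp q) (θ q) c
  have hch := X.isCodedChain hg hκm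
  have hSm : ∀ q c, Measurable (S q c) := fun q c =>
    hf.measurable_iSup (X.meas (θ q)) (hp q) (θ q) (c : A)
  have hGm : ∀ q, Measurable fun ω => S q (κ q ω) ω := fun q =>
    (measurable_from_prod_countable_right (f := fun p : FA × X.Ω => S q p.1 p.2)
      fun c => hSm q c).comp ((hch.code q).prodMk measurable_id)
  have hGD : ∀ q ω, |S q (κ q ω) ω| ≤ C := fun q ω => hf.abs_iSup_le _ _ _
  obtain ⟨σs, hσs, hle⟩ := hch.exists_strategy1 hg hf (a := fun c : FA => (c : A)) hN.measA
    hN.sectionA hGm hGD fun q hq ω v => by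
      have := (X.inP1 _ (hg.mem_Icc hq.le) ω).1
      simp only [S, θ, min_eq_left hq.le]
      exact le_ciSup (hf.bddAbove (X.M (τ q) ω) (τ q) (κ q ω : A)) v
  refine ⟨σs, hσs, fun τs hτs => (hle τs hτs).trans ?_⟩
  have hHi : ∀ q < K, Integrable (fun ω => hamiltonian f (τ q) (X.M (τ q) ω)) X.P := fun q hq =>
    integrable_of_abs_le (X.measurable_hamiltonian hf (hg.mem_Icc hq.le)) fun ω => by
      have := (X.inP1 _ (hg.mem_Icc hq.le) ω).1
      exact hf.abs_hamiltonian_le _ _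
  have hGi : ∀ q, Integrable (fun ω => S q (κ q ω) ω) X.P := fun q =>
    integrable_of_abs_le (hGm q) (hGD q)
  have hone : ∀ q < K, ∫ ω, S q (κ q ω) ω ∂X.P
      ≤ ∫ ω, hamiltonian f (τ q) (X.M (τ q) ω) ∂X.P + ε * momentAt d T t m := by
    intro q hq
    have hq1 := hg.mem_Icc hq.le
    have e : θ q = τ q := by simp [θ, min_eq_left hq.le]
    have hpq : ∀ ω, IsProbabilityMeasure (X.M (τ q) ω) := fun ω => (X.inP1 _ hq1 ω).1
    have hbind := X.bind_eq hq1
    have hnm : Measurable fun ω => ∫ x, netErr C ε x ∂(X.M (τ q) ω) :=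
      (StronglyMeasurable.integral_kernel (κ := ⟨X.M (τ q), X.meas (τ q)⟩)
        measurable_netErr.stronglyMeasurable).measurable
    have hni : Integrable (fun ω => ∫ x, netErr C ε x ∂(X.M (τ q) ω)) X.P :=
      integrable_of_abs_le hnm fun ω => abs_integral_le_of_abs_le (abs_netErr_le hC hε.le)
    have h1 : ∫ ω, S q (κ q ω) ω ∂X.P ≤ ∫ ω, (hamiltonian f (τ q) (X.M (τ q) ω)
        + ∫ x, netErr C ε x ∂(X.M (τ q) ω)) ∂X.P := by
      refine integral_mono (hGi q) ((hHi q hq).add hni) fun ω => ?_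
      have hc := hκ q ω
      simp only [S, e] at hc ⊢
      exact hN.iSup_le_hamiltonian hf hε.le ⟨ht.1.trans hq1.1, hq1.2⟩ _ hc
    rw [integral_add (hHi q hq) hni, ← integral_bind_of_abs_le (X.meas (τ q)) measurable_netErr
      (abs_netErr_le hC hε.le), hbind] at h1
    refine h1.trans (add_le_add_right ((integral_netErr_le hC hε.le
      (hm.heatFlow_two t (τ q))).trans (mul_le_mul_of_nonneg_left ?_ hε.le)) _)
    rw [integral_sq_heatFlow hm hq1.1, momentAt, mul_comm, ← add_assoc]
    exact add_le_add_right (mul_le_mul_of_nonneg_left (by linarith [hq1.2]) (gaussM2_nonneg d)) _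
  have hmX := (abs_lt.1 (hmesh K τ hg)).2
  rw [integral_finsetSum _ fun q hq => (hHi q (Finset.mem_range.1 hq)).const_mul _] at hmX
  rw [integral_finsetSum _ fun q _ => (hGi q).const_mul _]
  have hsum : ∑ q ∈ Finset.range K, ∫ ω, (τ (q + 1) - τ q) * S q (κ q ω) ω ∂X.P
      ≤ ∑ q ∈ Finset.range K, ((∫ ω, (τ (q + 1) - τ q) * hamiltonian f (τ q) (X.M (τ q) ω) ∂X.P)
        + (τ (q + 1) - τ q) * (ε * momentAt d T t m)) := by
    refine Finset.sum_le_sum fun q hq => ?_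
    rw [Finset.mem_range] at hq
    rw [integral_const_mul, integral_const_mul, ← mul_add]
    exact mul_le_mul_of_nonneg_left (hone q hq) (sub_nonneg.2 (hg.lt q hq).le)
  rw [Finset.sum_add_distrib, ← Finset.sum_mul, hg.sum_eq] at hsum
  linarith

end UpperBound

/-- If the minimizer guarantees `w + ε` and the maximizer guarantees `w - ε` in a game with
bounded payoff, then its lower and upper values are both within `ε` of `w`. -/
theorem abs_lower_upper_sub_le {α β : Type*} {P : α → Prop} {Q : β → Prop} {g : α → β → ℝ}
    {D w ε : ℝ} (hg : ∀ a b, P a → Q b → |g a b| ≤ D)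
    (hupper : ∃ a, P a ∧ ∀ b, Q b → g a b ≤ w + ε)
    (hlower : ∃ b, Q b ∧ ∀ a, P a → w - ε ≤ g a b) :
    |sSup { r : ℝ | ∃ b, Q b ∧ r = sInf { r' : ℝ | ∃ a, P a ∧ r' = g a b } } - w| ≤ ε ∧
      |sInf { r : ℝ | ∃ a, P a ∧ r = sSup { r' : ℝ | ∃ b, Q b ∧ r' = g a b } } - w| ≤ ε := by
  obtain ⟨a₀, ha₀, hle⟩ := hupper
  obtain ⟨b₀, hb₀, hge⟩ := hlower
  have hbelow : ∀ b, Q b → BddBelow { r' : ℝ | ∃ a, P a ∧ r' = g a b } := fun b hb =>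
    ⟨-D, by rintro _ ⟨a, ha, rfl⟩; exact (abs_le.1 (hg a b ha hb)).1⟩
  have habove : ∀ a, P a → BddAbove { r' : ℝ | ∃ b, Q b ∧ r' = g a b } := fun a ha =>
    ⟨D, by rintro _ ⟨b, hb, rfl⟩; exact (abs_le.1 (hg a b ha hb)).2⟩
  have hinf : ∀ b, Q b → ∀ a, P a → sInf { r' : ℝ | ∃ a, P a ∧ r' = g a b } ≤ g a b :=
    fun b hb a ha => csInf_le (hbelow b hb) ⟨a, ha, rfl⟩
  have hsup : ∀ a, P a → ∀ b, Q b → g a b ≤ sSup { r' : ℝ | ∃ b, Q b ∧ r' = g a b } :=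
    fun a ha b hb => le_csSup (habove a ha) ⟨b, hb, rfl⟩
  have hinf₀ : w - ε ≤ sInf { r' : ℝ | ∃ a, P a ∧ r' = g a b₀ } :=
    le_csInf ⟨_, a₀, ha₀, rfl⟩ (by rintro _ ⟨a, ha, rfl⟩; exact hge a ha)
  have hsup₀ : sSup { r' : ℝ | ∃ b, Q b ∧ r' = g a₀ b } ≤ w + ε :=
    csSup_le ⟨_, b₀, hb₀, rfl⟩ (by rintro _ ⟨b, hb, rfl⟩; exact hle b hb)
  refine ⟨abs_le.2 ⟨?_, ?_⟩, abs_le.2 ⟨?_, ?_⟩⟩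
  · refine le_sub_iff_add_le'.2 ((hinf₀.trans' (by linarith)).trans (le_csSup ⟨w + ε, ?_⟩
      ⟨b₀, hb₀, rfl⟩))
    rintro _ ⟨b, hb, rfl⟩
    exact (hinf b hb a₀ ha₀).trans (hle b hb)
  · refine sub_le_iff_le_add'.2 (csSup_le ⟨_, b₀, hb₀, rfl⟩ ?_)
    rintro _ ⟨b, hb, rfl⟩
    exact (hinf b hb a₀ ha₀).trans (hle b hb)
  · rw [le_sub_iff_add_le]
    refine le_csInf ⟨_, a₀, ha₀, rfl⟩ ?_
    rintro _ ⟨a, ha, rfl⟩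
    have := (hge a ha).trans (hsup a ha b₀ hb₀)
    linarith
  · rw [sub_le_iff_le_add']
    refine le_trans (csInf_le ⟨w - ε, ?_⟩ ⟨a₀, ha₀, rfl⟩) hsup₀
    rintro _ ⟨a, ha, rfl⟩
    exact (hge a ha).trans (hsup a ha b₀ hb₀)

theorem IsGrid.mono_mesh {t T η η' : ℝ} {K : ℕ} {τ : ℕ → ℝ} (hg : IsGrid t T η K τ)
    (h : η ≤ η') : IsGrid t T η' K τ :=
  ⟨hg.start, hg.final, hg.lt, fun q hq => (hg.mesh q hq).trans_le h⟩

/-- **main convergence theorem.** For all `(t,m) ∈ [0,T] × 𝒫₂`, the values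
of the discrete-time games `Γ_π(t,m)` converge, as the mesh `|π| → 0`, to
`V(t,m) = inf_{M ∈ 𝓜(t,m)} E[∫_t^T H(s,M_s) ds]` (both the lower value `sup inf` and the
upper value `inf sup` of `Γ_π(t,m)` converge to `V(t,m)`). -/
theorem discrete_values_converge (d : ℕ) (T : ℝ) (hT : 0 ≤ T)
    {A B : Type} [MetricSpace A] [CompactSpace A] [Nonempty A]
    [MeasurableSpace A] [BorelSpace A]
    [MetricSpace B] [CompactSpace B] [Nonempty B]
    [MeasurableSpace B] [BorelSpace B]
    (f : ℝ → Ed d → A → B → ℝ) (C : ℝ)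
    (hfbdd : ∀ s x u v, |f s x u v| ≤ C)
    (hfcont : Continuous fun q : ℝ × Ed d × A × B => f q.1 q.2.1 q.2.2.1 q.2.2.2)
    (hflip : ∀ (u : A) (v : B), ∀ s s' : ℝ, ∀ x x' : Ed d,
      |f s x u v - f s' x' u v| ≤ C * (‖x - x'‖ + |s - s'|))
    (hIsaacs : ∀ s ∈ Set.Icc 0 T, ∀ μ : Measure (Ed d), MemP d 2 μ →
      (⨅ u : A, ⨆ v : B, ∫ x, f s x u v ∂μ) = ⨆ v : B, ⨅ u : A, ∫ x, f s x u v ∂μ)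
    (t : ℝ) (ht : t ∈ Set.Icc 0 T) (m : Measure (Ed d)) (hm : MemP d 2 m) :
    ∀ ε > (0:ℝ), ∃ η > (0:ℝ), ∀ (N : ℕ) (τg : ℕ → ℝ), 2 ≤ N →
      τg 0 = t → τg (N - 1) = T →
      (∀ q, q + 1 < N → τg q < τg (q + 1)) →
      (∀ q, q + 1 < N → τg (q + 1) - τg q < η) →
      |lowerValueDisc d f m N τg - gameValue d f T t m| ≤ ε ∧
      |upperValueDisc d f m N τg - gameValue d f T t m| ≤ ε := by
  intro ε hε
  have hf : IsPayoff f C := ⟨hfbdd, hfcont, hflip⟩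
  obtain ⟨η₁, hη₁, hlower⟩ := exists_strategy2_ge hf hIsaacs ht hm hε
  obtain ⟨η₂, hη₂, hupper⟩ := exists_strategy1_le hf ht hm hε
  refine ⟨min η₁ η₂, lt_min hη₁ hη₂, fun N τ hN h0 h1 hlt hmesh => ?_⟩
  obtain ⟨K, rfl⟩ := Nat.exists_eq_add_of_le' (one_le_two.trans hN)
  have hg : IsGrid t T (min η₁ η₂) K τ :=
    ⟨h0, h1, fun q hq => hlt q (by omega), fun q hq => hmesh q (by omega)⟩
  have := hm.1
  exact abs_lower_upper_sub_le
    (fun σs τs hσs hτs => abs_integral_le_of_abs_le fun x =>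
      (hg.stageRegular hf hσs hτs K 0 (zero_add K)).bdd _ x)
    (hupper K τ (hg.mono_mesh (min_le_right _ _))) (hlower K τ (hg.mono_mesh (min_le_left _ _)))

end
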